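/- Let ℚ̄ be an algebraic closure of ℚ and n ≥ 1. Let γ₁, …, γ_r ∈ GL_n(ℚ̄) all be semi-simple matrices. Let γ ∈ GL_n(ℚ̄) be a semi-simple matrix having an eigenvalue λ ∈ ℚ̄ˣ that is not a root of unity and such that the cyclic subgroup ⟨λ⟩ of ℚ̄ˣ intersects the product of subgroups Λ(γ₁)⋯Λ(γ_r) trivially. Then the set J = { m ∈ ℤ : γ^m = γ₁^{k₁}⋯γ_r^{k_r} for some k₁,…,k_r ∈ ℤ } is finite. -/

import Mathlib

section
open Matrix

/-- An element of `GL n ℚ̄` is semi-simple if the corresponding linear endomorphism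
of `ℚ̄^n` is a semisimple endomorphism. -/
def IsSemisimpleElt {n : ℕ} (g : GL (Fin n) (AlgebraicClosure ℚ)) : Prop :=
  Module.End.IsSemisimple ((g : Matrix (Fin n) (Fin n) (AlgebraicClosure ℚ)).mulVecLin)

/-- `Λ(g)`: the subgroup of `ℚ̄ˣ` generated by the eigenvalues of `g`
(the roots of its characteristic polynomial). -/
noncomputable def eigGroup {n : ℕ} (g : GL (Fin n) (AlgebraicClosure ℚ)) :
    Subgroup (AlgebraicClosure ℚ)ˣ :=
  Subgroup.closure {u : (AlgebraicClosure ℚ)ˣ |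
    ((g : Matrix (Fin n) (Fin n) (AlgebraicClosure ℚ)).charpoly).IsRoot
      (u : AlgebraicClosure ℚ)}

end

set_option linter.all false
set_option autoImplicit false

namespace SubTh
open Finsupp (single_apply single mapDomain_notin_range mapDomain_apply prod_fintype single_injective tail_cons cons_zero filter_apply)
open Function (Injective update_self update_of_ne ne_iff)
open Matrix (of of_apply det_mul det_apply vecMul zero_vecMul mul_nonsing_inv vecMul_vecMul smul_mul nonsing_inv_mul mulVec_zero mulVec mulVec_mulVec one_mulVec mulVec_smul)
open Submodule (span span_induction smul_mem subset_span)
open Module (Basis End)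
open Equiv (Perm ofBijective)
open Real (log log_nonneg exp exp_add add_one_le_exp exp_nat_mul exp_le_exp log_le_log log_pow log_mul log_exp exp_sum exp_pos log_prod exp_log one_le_exp sqrt_nonneg sq_sqrt)
open Fintype (sum_prod_type piFinset card_piFinset card_fun card_prod card_coe prod_prod_type prod_sum_type)
open Filter (atTop)
open Units (val_mul val_inv_eq_inv_val val_one val_mk0)
open Finset
noncomputable section
theorem mll {α : Type*} [Mul α] [Zero α] [Preorder α] [PosMulMono α] {a b c : α} (h : b ≤ c) (al : 0 ≤ a) : a * b ≤ a * c := mul_le_mul_of_nonneg_left h al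
theorem mlr {α : Type*} [Mul α] [Zero α] [Preorder α] [MulPosMono α] {a b c : α} (h : b ≤ c) (al : 0 ≤ a) : b * a ≤ c * a := mul_le_mul_of_nonneg_right h al
local notation "MP" => MvPolynomial
local notation "fc" => Fintype.card
local notation "icr" => Int.castRingHom
local notation:max "Mx" n:max => Matrix (Fin n) (Fin n)
local notation:max "AV" K:max => AbsoluteValue K ℝ
section
structure PlaceSys (K : Type) [Field K] (S : Type) [Fintype S] where
  R : Subring K
  w : S → AV K
  prod_ge : ∀ x ∈ R, x ≠ 0 → 1 ≤ ∏ s, w s x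
  cop : ∀ x : K, ∃ a ∈ R, ∃ b ∈ R, b ≠ 0 ∧ x = a / b ∧ ∃ u ∈ R, ∃ v ∈ R, u * a + v * b = 1
  count : ∃ C : ℝ, ∃ κ : ℕ, 1 ≤ C ∧ ∀ B : ℝ, 1 ≤ B → ∀ t : Finset K,
    (∀ x ∈ t, x ∈ R ∧ ∀ s, w s x ≤ B) → (t.card : ℝ) ≤ C * B ^ κ
  mink : ∀ (n : ℕ) (L : S → Mx n K), 1 ≤ n → (∀ s, (L s).det ≠ 0) →
    ∃ C : ℝ, 0 < C ∧ ∀ A : S → Fin n → ℝ, (∀ s i, 0 < A s i) → C ≤ ∏ s, ∏ i, A s i →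
      ∃ y : Fin n → K, y ≠ 0 ∧ (∀ i, y i ∈ R) ∧ ∀ s i, w s ((L s).mulVec y i) ≤ A s i
section norm
variable {K : Type} [CommRing K] [IsDomain K] {σ τ : Type} [Fintype σ] [Fintype τ]
def nrm (w : AV K) (r : σ → ℝ) (f : MP σ K) : ℝ :=
  ∑ E ∈ f.support, w (f.coeff E) * ∏ i, r i ^ E i
lemma nrm_eq (w : AV K) (r : σ → ℝ) (f : MP σ K) (t : Finset (σ →₀ ℕ))
    (h : f.support ⊆ t) : nrm w r f = ∑ E ∈ t, w (f.coeff E) * ∏ i, r i ^ E i := by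
  unfold nrm
  apply sum_subset h
  intro E _ hE
  rw [MvPolynomial.notMem_support_iff.1 hE]; simp
lemma nrm_nonneg (w : AV K) (r : σ → ℝ) (hr : ∀ i, 0 ≤ r i) (f : MP σ K) :
    0 ≤ nrm w r f :=
  sum_nonneg fun E _ => mul_nonneg (w.nonneg _)
    (prod_nonneg fun i _ => pow_nonneg (hr i) _)
lemma coeff_le_nrm (w : AV K) (r : σ → ℝ) (hr : ∀ i, 0 ≤ r i) (f : MP σ K)
    (E : σ →₀ ℕ) : w (f.coeff E) * ∏ i, r i ^ E i ≤ nrm w r f := by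
  classical
  rw [nrm_eq w r f (insert E f.support) (subset_insert _ _)]
  exact single_le_sum (f := fun E => w (f.coeff E) * ∏ i, r i ^ E i)
    (fun E _ => mul_nonneg (w.nonneg _)
    (prod_nonneg fun i _ => pow_nonneg (hr i) _)) (mem_insert_self _ _)
lemma nrm_add (w : AV K) (r : σ → ℝ) (hr : ∀ i, 0 ≤ r i) (f g : MP σ K) :
    nrm w r (f + g) ≤ nrm w r f + nrm w r g := by
  classical
  rw [nrm_eq w r (f+g) (f.support ∪ g.support) (MvPolynomial.support_add),
    nrm_eq w r f (f.support ∪ g.support) (subset_union_left),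
    nrm_eq w r g (f.support ∪ g.support) (subset_union_right), ← sum_add_distrib]
  apply sum_le_sum
  intro E _
  rw [← add_mul, MvPolynomial.coeff_add]
  exact mlr (w.add_le _ _)
    (prod_nonneg fun i _ => pow_nonneg (hr i) _)
lemma nrm_zero (w : AV K) (r : σ → ℝ) : nrm w r (0 : MP σ K) = 0 := by
  simp [nrm]
lemma nrm_sum (w : AV K) (r : σ → ℝ) (hr : ∀ i, 0 ≤ r i) {α : Type*} (t : Finset α)
    (f : α → MP σ K) : nrm w r (∑ a ∈ t, f a) ≤ ∑ a ∈ t, nrm w r (f a) := by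
  classical
  induction t using Finset.induction_on with
  | empty => simp [nrm_zero]
  | insert a t ha ih =>
    rw [sum_insert ha, sum_insert ha]
    exact (nrm_add w r hr _ _).trans (by linarith)
lemma nrm_monomial (w : AV K) (r : σ → ℝ) (E : σ →₀ ℕ) (a : K) :
    nrm w r (MvPolynomial.monomial E a) = w a * ∏ i, r i ^ E i := by
  classical
  rw [nrm_eq w r _ {E} MvPolynomial.support_monomial_subset]
  simp
lemma nrm_C (w : AV K) (r : σ → ℝ) (a : K) :
    nrm w r (MvPolynomial.C a) = w a := by
  rw [← MvPolynomial.monomial_zero', nrm_monomial]; simp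
lemma nrm_X (w : AV K) (r : σ → ℝ) (i : σ) :
    nrm w r (MvPolynomial.X i) = r i := by
  classical
  rw [MvPolynomial.X, nrm_monomial]
  simp only [map_one, one_mul]
  rw [prod_eq_single i]
  · simp
  · intro j _ h; simp [single_apply, h.symm]
  · simp
lemma nrm_mul (w : AV K) (r : σ → ℝ) (hr : ∀ i, 0 ≤ r i) (f g : MP σ K) :
    nrm w r (f * g) ≤ nrm w r f * nrm w r g := by
  classical
  have : f * g = ∑ E ∈ f.support, ∑ F ∈ g.support,
      MvPolynomial.monomial (E + F) (f.coeff E * g.coeff F) := by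
    conv_lhs => rw [f.as_sum, g.as_sum, sum_mul_sum]
    simp [MvPolynomial.monomial_mul]
  rw [this]
  refine (nrm_sum w r hr _ _).trans ?_
  conv_rhs => rw [nrm, nrm, sum_mul_sum]
  apply sum_le_sum; intro E _
  refine (nrm_sum w r hr _ _).trans ?_
  apply sum_le_sum; intro F _
  rw [nrm_monomial, map_mul]
  apply le_of_eq
  simp only [Finsupp.add_apply, pow_add, prod_mul_distrib]; ring
lemma nrm_one (w : AV K) (r : σ → ℝ) : nrm w r (1 : MP σ K) = 1 := by
  rw [← MvPolynomial.C_1, nrm_C]; simp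
lemma nrm_prod (w : AV K) (r : σ → ℝ) (hr : ∀ i, 0 ≤ r i) {α : Type*} (t : Finset α)
    (f : α → MP σ K) : nrm w r (∏ a ∈ t, f a) ≤ ∏ a ∈ t, nrm w r (f a) := by
  classical
  induction t using Finset.induction_on with
  | empty => simp [nrm_one]
  | insert a t ha ih =>
    rw [prod_insert ha, prod_insert ha]
    exact (nrm_mul w r hr _ _).trans (mll ih (nrm_nonneg w r hr _))
lemma nrm_pow (w : AV K) (r : σ → ℝ) (hr : ∀ i, 0 ≤ r i) (f : MP σ K)
    (k : ℕ) : nrm w r (f ^ k) ≤ nrm w r f ^ k := by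
  have := nrm_prod w r hr (range k) (fun _ => f)
  simpa using this
lemma nrm_aeval (w : AV K) (r : σ → ℝ) (hr : ∀ i, 0 ≤ r i) (ρ : τ → ℝ)
    (l : τ → MP σ K) (hl : ∀ i, nrm w r (l i) ≤ ρ i) (f : MP τ K) :
    nrm w r (MvPolynomial.aeval l f) ≤ nrm w ρ f := by
  classical
  rw [MvPolynomial.aeval_def, MvPolynomial.eval₂_eq']
  refine (nrm_sum w r hr _ _).trans ?_
  apply sum_le_sum; intro E _
  refine (nrm_mul w r hr _ _).trans ?_
  rw [MvPolynomial.algebraMap_eq, nrm_C]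
  apply mll _ (w.nonneg _)
  refine (nrm_prod w r hr _ _).trans ?_
  apply prod_le_prod
  · intro i _; exact nrm_nonneg w r hr _
  · intro i _
    exact (nrm_pow w r hr _ _).trans (pow_le_pow_left₀ (nrm_nonneg w r hr _) (hl i) _)
lemma nrm_mono (w : AV K) (r ρ : σ → ℝ) (hr : ∀ i, 0 ≤ r i) (h : ∀ i, r i ≤ ρ i)
    (f : MP σ K) : nrm w r f ≤ nrm w ρ f := by
  apply sum_le_sum; intro E _
  apply mll _ (w.nonneg _)
  apply prod_le_prod
  · intro i _; exact pow_nonneg (hr i) _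
  · intro i _; exact pow_le_pow_left₀ (hr i) (h i) _
def absZ : AbsoluteValue ℤ ℝ where
  toFun n := |(n : ℝ)|
  map_mul' a b := by simp [abs_mul]
  nonneg' a := abs_nonneg _
  eq_zero' a := by simp
  add_le' a b := by simpa using abs_add_le (a : ℝ) b
lemma absZ_apply (n : ℤ) : absZ n = |(n : ℝ)| := rfl
lemma w_natCast (w : AV K) (n : ℕ) : w (n : K) ≤ n := by
  induction n with
  | zero => simp
  | succ n ih => push_cast; exact (w.add_le _ _).trans (by simpa using ih)
lemma w_intCast (w : AV K) (n : ℤ) : w (n : K) ≤ absZ n := by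
  rw [absZ_apply]
  obtain ⟨k, rfl | rfl⟩ := n.eq_nat_or_neg
  · simpa using w_natCast w k
  · simpa using w_natCast w k
lemma nrm_map_int (w : AV K) (r : σ → ℝ) (hr : ∀ i, 0 ≤ r i) (F : MP σ ℤ) :
    nrm w r (MvPolynomial.map (icr K) F) ≤ nrm absZ r F := by
  rw [nrm_eq w r _ F.support (MvPolynomial.support_map_subset _ _)]
  apply sum_le_sum; intro E _
  apply mlr _ (prod_nonneg fun i _ => pow_nonneg (hr i) _)
  rw [MvPolynomial.coeff_map]
  exact w_intCast w _
end norm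
end
section
open MvPolynomial
section hasse
variable {A : Type} [CommRing A] {σ : Type} [Fintype σ]
def chs (E I : σ →₀ ℕ) : ℕ := ∏ i, (E i).choose (I i)
lemma chs_eq_zero {E I : σ →₀ ℕ} (h : ¬ I ≤ E) : chs E I = 0 := by
  rw [Finsupp.le_def] at h; push Not at h
  obtain ⟨i, hi⟩ := h
  exact prod_eq_zero (mem_univ i) (Nat.choose_eq_zero_of_lt hi)
def hD (I : σ →₀ ℕ) (f : MP σ A) : MP σ A :=
  ∑ E ∈ f.support, monomial (E - I) (f.coeff E * (chs E I : A))
lemma coeff_hD (I E : σ →₀ ℕ) (f : MP σ A) :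
    (hD I f).coeff E = (chs (E + I) I : A) * f.coeff (E + I) := by
  classical
  unfold hD
  rw [coeff_sum]
  simp only [coeff_monomial]
  rw [sum_eq_single (E + I)]
  · simp [mul_comm]
  · intro E' _ hne
    split_ifs with h
    · have : ¬ I ≤ E' := fun hle => hne (by rw [← h, tsub_add_cancel_of_le hle])
      rw [chs_eq_zero this]; simp
    · rfl
  · intro h; rw [notMem_support_iff.1 h]; simp
lemma hD_add (I : σ →₀ ℕ) (f g : MP σ A) : hD I (f + g) = hD I f + hD I g := by
  ext E; simp only [coeff_hD, coeff_add]; ring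
lemma hD_smul (I : σ →₀ ℕ) (a : A) (f : MP σ A) : hD I (a • f) = a • hD I f := by
  ext E; simp only [coeff_hD, coeff_smul, smul_eq_mul]; ring
lemma hD_zero (I : σ →₀ ℕ) : hD I (0 : MP σ A) = 0 := by
  ext E; simp [coeff_hD]
lemma hD_sum (I : σ →₀ ℕ) {α : Type*} (t : Finset α) (f : α → MP σ A) :
    hD I (∑ a ∈ t, f a) = ∑ a ∈ t, hD I (f a) := by
  classical
  induction t using Finset.induction_on with
  | empty => simp [hD_zero]
  | insert a t ha ih => rw [sum_insert ha, sum_insert ha, hD_add, ih]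
lemma hD_idx_zero (f : MP σ A) : hD 0 f = f := by
  ext E; simp [coeff_hD, chs]
lemma hD_succ [DecidableEq σ] (I : σ →₀ ℕ) (h : σ) (f : MP σ A) :
    ((I h + 1 : ℕ) : A) • hD (I + single h 1) f = pderiv h (hD I f) := by
  ext E
  have key : (I h + 1) * chs (E + single h 1 + I) (I + single h 1)
      = chs (E + single h 1 + I) I * (E h + 1) := by
    unfold chs
    rw [← mul_prod_erase _ _ (mem_univ h),
      ← mul_prod_erase _ (fun i => ((E + single h 1 + I : σ →₀ ℕ) i).choose (I i)) (mem_univ h)]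
    have hw : ∏ x ∈ univ.erase h, ((E + single h 1 + I : σ →₀ ℕ) x).choose ((I + single h 1 : σ →₀ ℕ) x) =
        ∏ x ∈ univ.erase h, ((E + single h 1 + I : σ →₀ ℕ) x).choose (I x) := by
      apply prod_congr rfl
      intro i hi
      have : h ≠ i := (ne_of_mem_erase hi).symm
      simp [single_apply, this]
    rw [hw]
    simp only [Finsupp.add_apply, Finsupp.single_eq_same]
    have ea := Nat.choose_succ_right_eq (E h + 1 + I h) (I h)
    rw [Nat.add_sub_cancel] at ea
    rw [← mul_assoc, mul_comm (I h + 1), ea]; ring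
  have key2 := congrArg (Nat.cast (R := A)) key
  push_cast at key2
  rw [coeff_smul, coeff_hD, coeff_pderiv, coeff_hD, smul_eq_mul,
    show E + (I + single h 1) = E + single h 1 + I by abel]
  push_cast
  linear_combination (coeff (E + single h 1 + I) f) * key2
end hasse
section shift
variable {σ : Type} [Fintype σ] {K : Type} [Field K] [CharZero K]
def shift (β : σ → K) : MP σ K →ₐ[K] MP σ K :=
  aeval (fun i => X i + C (β i))
lemma pderiv_shift (β : σ → K) (h : σ) (f : MP σ K) :
    pderiv h (shift β f) = shift β (pderiv h f) := by
  classical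
  induction f using induction_on with
  | C a => simp [shift]
  | add p q hp hq => simp [hp, hq]
  | mul_X p i hp =>
    simp only [map_mul, Derivation.leibniz, hp, smul_eq_mul, map_add]
    by_cases hi : i = h
    · subst hi; simp [shift]
    · simp [shift, pderiv_X, Pi.single_apply, hi, Ne.symm hi]
lemma hD_shift (β : σ → K) (I : σ →₀ ℕ) (f : MP σ K) :
    hD I (shift β f) = shift β (hD I f) := by
  classical
  have H : ∀ n : ℕ, ∀ I : σ →₀ ℕ, ∑ i, I i = n → hD I (shift β f) = shift β (hD I f) := by
    intro n
    induction n with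
    | zero =>
      intro I hI
      have : I = 0 := by
        ext i
        have := (sum_eq_zero_iff.1 hI) i (mem_univ i)
        simpa using this
      subst this
      simp [hD_idx_zero]
    | succ n ih =>
      intro I hI
      have : ∃ h, I h ≠ 0 := by
        by_contra hc
        push Not at hc
        simp [hc] at hI
      obtain ⟨h, hh⟩ := this
      have hle : single h 1 ≤ I := by
        rw [Finsupp.single_le_iff]; omega
      obtain ⟨I', rfl⟩ : ∃ I', I = I' + single h 1 := ⟨I - single h 1, by
        rw [tsub_add_cancel_of_le hle]⟩
      have hI' : ∑ i, I' i = n := by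
        simp only [Finsupp.add_apply, sum_add_distrib] at hI
        rw [show ∑ i, (single h 1 : σ →₀ ℕ) i = 1 by simp [single_apply]] at hI
        omega
      have hne : ((I' h + 1 : ℕ) : K) ≠ 0 := Nat.cast_ne_zero.2 (by omega)
      have hw := hD_succ I' h (shift β f)
      rw [ih I' hI', pderiv_shift, ← hD_succ, map_smul] at hw
      exact smul_right_injective _ hne hw
  exact H _ I rfl
end shift
section wronsk
variable {σ : Type} [Fintype σ] [LinearOrder σ]
lemma sep_points {r : ℕ} (E : Fin r → (σ →₀ ℕ)) (hE : Injective E) :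
    ∃ I : Fin r → (σ →₀ ℕ), (∀ i, ∑ h, I i h ≤ r - 1) ∧
      (of fun i k => ((chs (E k) (I i) : ℕ) : ℚ)).det ≠ 0 := by
  classical
  set φ : (σ →₀ ℕ) → (Fin r → ℚ) := fun I k => (chs (E k) I : ℚ) with hφ
  set M : ℕ → Submodule ℚ (Fin r → ℚ) := fun n => span ℚ (φ '' {I | ∑ h, I h ≤ n}) with hM
  have step : ∀ (n : ℕ) (h : σ) (c : ℚ) (g : Fin r → ℚ), g ∈ M n →
      (fun k => ((E k h : ℚ) - c) * g k) ∈ M (n+1) := by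
    intro n h c g hg
    induction hg using span_induction with
    | mem x hx =>
      obtain ⟨I, hI, rfl⟩ := hx
      have e : (fun k => ((E k h : ℚ) - c) * φ I k) =
          ((I h + 1 : ℕ) : ℚ) • φ (I + single h 1) + ((I h : ℚ) - c) • φ I := by
        ext k
        have key : (I h + 1) * chs (E k) (I + single h 1) + I h * chs (E k) I =
            E k h * chs (E k) I := by
          unfold chs
          rw [← mul_prod_erase _ _ (mem_univ h),
            ← mul_prod_erase _ (fun i => ((E k) i).choose (I i)) (mem_univ h)]
          have : ∏ x ∈ univ.erase h, (E k x).choose ((I + single h 1 : σ →₀ ℕ) x) =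
              ∏ x ∈ univ.erase h, (E k x).choose (I x) := by
            apply prod_congr rfl
            intro i hi
            have : h ≠ i := (ne_of_mem_erase hi).symm
            simp [single_apply, this]
          rw [this]
          simp only [Finsupp.add_apply, Finsupp.single_eq_same]
          have ea := Nat.choose_succ_right_eq (E k h) (I h)
          rcases le_or_gt (I h) (E k h) with hle | hlt
          · obtain ⟨d, hd⟩ := Nat.exists_eq_add_of_le hle
            rw [hd] at ea ⊢
            rw [Nat.add_sub_cancel_left] at ea
            rw [← mul_assoc, mul_comm (I h + 1), ea]; ring
          · rw [Nat.choose_eq_zero_of_lt hlt, Nat.choose_eq_zero_of_lt (by omega)]; simp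
        have key2 := congrArg (Nat.cast (R := ℚ)) key
        push_cast at key2
        simp only [Pi.add_apply, Pi.smul_apply, smul_eq_mul, hφ]
        push_cast
        linear_combination -key2
      rw [e]
      refine Submodule.add_mem _ (smul_mem _ _ (subset_span ⟨_, ?_, rfl⟩))
        (smul_mem _ _ (subset_span ⟨_, ?_, rfl⟩))
      · have hI' : ∑ h, I h ≤ n := hI
        simp only [Set.mem_setOf_eq, Finsupp.add_apply, sum_add_distrib]
        rw [show ∑ i, (single h 1 : σ →₀ ℕ) i = 1 by simp [single_apply]]
        omega
      · have hI' : ∑ h, I h ≤ n := hI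
        simp only [Set.mem_setOf_eq]; omega
    | zero => simp only [Pi.zero_apply, mul_zero]; exact Submodule.zero_mem (M (n+1))
    | add x y _ _ hx hy =>
      have := Submodule.add_mem _ hx hy
      convert this using 1
      ext k; simp; ring
    | smul a x _ hx =>
      have := smul_mem _ a hx
      convert this using 1
      ext k; simp; ring
  have sep : ∀ (k : Fin r) (T : Finset (Fin r)), k ∉ T → ∃ g ∈ M T.card, g k ≠ 0 ∧ ∀ l ∈ T, g l = 0 := by
    intro k T
    induction T using Finset.induction_on with
    | empty =>
      intro _
      refine ⟨φ 0, subset_span ⟨0, by simp, rfl⟩, by simp [hφ, chs], by simp⟩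
    | insert a T ha ih =>
      intro hk
      obtain ⟨g, hg, hgk, hgl⟩ := ih (fun h => hk (mem_insert_of_mem h))
      have hne : E k ≠ E a := fun h => hk (by rw [hE h]; exact mem_insert_self _ _)
      obtain ⟨h, hh⟩ : ∃ h, E k h ≠ E a h := by
        by_contra hc; push Not at hc; exact hne (Finsupp.ext hc)
      refine ⟨_, by rw [card_insert_of_notMem ha]; exact step _ h (E a h) g hg, ?_, ?_⟩
      · refine mul_ne_zero (sub_ne_zero.2 (mod_cast hh)) hgk
      · intro l hl
        rcases mem_insert.1 hl with rfl | hl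
        · simp
        · simp [hgl l hl]
  have top : M (r - 1) = ⊤ := by
    rw [eq_top_iff]
    intro x _
    have hx : x = ∑ k, x k • (Pi.single k (1 : ℚ) : Fin r → ℚ) := by
      ext l; simp [Finset.sum_apply, Pi.single_apply]
    rw [hx]
    refine Submodule.sum_mem _ fun k _ => smul_mem _ _ ?_
    obtain ⟨g, hg, hgk, hgl⟩ := sep k (univ.erase k) (notMem_erase _ _)
    rw [card_erase_of_mem (mem_univ k), card_univ, Fintype.card_fin] at hg
    have : (Pi.single k (1 : ℚ) : Fin r → ℚ) = (g k)⁻¹ • g := by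
      ext l
      by_cases hl : l = k
      · subst hl; simp [hgk]
      · simp [Pi.single_apply, hl, hgl l (mem_erase.2 ⟨hl, mem_univ _⟩)]
    rw [this]; exact smul_mem _ _ hg
  obtain ⟨κ, a, ha, hspan, hli⟩ := exists_linearIndependent' ℚ
    (fun I : {I : σ →₀ ℕ // ∑ h, I h ≤ r - 1} => φ I)
  have hr : Set.range (fun I : {I : σ →₀ ℕ // ∑ h, I h ≤ r - 1} => φ I) =
      φ '' {I | ∑ h, I h ≤ r - 1} := by
    ext x; simp
  rw [hr] at hspan
  have hs2 : ⊤ ≤ span ℚ (Set.range ((fun I : {I : σ →₀ ℕ // ∑ h, I h ≤ r - 1} => φ I) ∘ a)) := by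
    rw [hspan]; exact top.ge
  let b := Basis.mk hli hs2
  let e : Fin r ≃ κ := (Pi.basisFun ℚ (Fin r)).indexEquiv b
  refine ⟨fun i => (a (e i)).1, fun i => (a (e i)).2, ?_⟩
  have hli2 := hli.comp e e.injective
  have := (Matrix.linearIndependent_rows_iff_isUnit (A := of fun i k => ((chs (E k) ((a (e i)).1) : ℕ) : ℚ))).1 hli2
  exact ((Matrix.isUnit_iff_isUnit_det _).1 this).ne_zero
lemma coeff_prod_top (m : MonomialOrder σ) {α : Type*} (t : Finset α) (P : α → MP σ ℚ)
    (E : α → (σ →₀ ℕ)) (h : ∀ a ∈ t, m.toSyn (m.degree (P a)) ≤ m.toSyn (E a)) :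
    (∏ a ∈ t, P a).coeff (∑ a ∈ t, E a) = ∏ a ∈ t, (P a).coeff (E a) := by
  classical
  have : m.toSyn (m.degree (∏ a ∈ t, P a)) ≤ m.toSyn (∑ a ∈ t, E a) ∧
    (∏ a ∈ t, P a).coeff (∑ a ∈ t, E a) = ∏ a ∈ t, (P a).coeff (E a) := by
    induction t using Finset.induction_on with
    | empty => simp
    | insert a t ha ih =>
      obtain ⟨hw, ea⟩ := ih (fun b hb => h b (mem_insert_of_mem hb))
      have ee := h a (mem_insert_self _ _)
      rw [prod_insert ha, sum_insert ha, prod_insert ha]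
      refine ⟨m.degree_mul_le.trans ?_, ?_⟩
      · rw [map_add, map_add]; exact add_le_add ee hw
      · rw [m.coeff_mul_of_add_of_degree_le ee hw, ea]
  exact this.2
lemma wronsk {r : ℕ} (f : Fin r → MP σ ℚ) (hf : LinearIndependent ℚ f) :
    ∃ I : Fin r → (σ →₀ ℕ), (∀ i, ∑ h, I i h ≤ r - 1) ∧
      (of fun i k => hD (I i) (f k)).det ≠ 0 := by
  classical
  let m : MonomialOrder σ := MonomialOrder.lex
  let V := span ℚ (Set.range f)
  let D : Finset (σ →₀ ℕ) := (univ.biUnion fun k => (f k).support).filter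
    (fun d => ∃ v ∈ V, v ≠ 0 ∧ m.degree v = d)
  have hsupp : ∀ v ∈ V, v.support ⊆ univ.biUnion fun k => (f k).support := by
    intro v hv
    induction hv using span_induction with
    | mem x hx => obtain ⟨k, rfl⟩ := hx; exact subset_biUnion_of_mem (fun k => (f k).support) (mem_univ k)
    | zero => simp
    | add x y _ _ hx hy => exact (support_add).trans (union_subset hx hy)
    | smul a x _ hx => exact (support_smul).trans hx
  let T : V →ₗ[ℚ] (D → ℚ) :=
    { toFun := fun v d => v.1.coeff d.1
      map_add' := by intros; ext; simp
      map_smul' := by intros; ext; simp }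
  have hT : Injective T := by
    rw [injective_iff_map_eq_zero]
    intro v hv
    by_contra hne
    have ac : v.1 ≠ 0 := fun h => hne (Subtype.ext h)
    have hc : v.1.coeff (m.degree v.1) ≠ 0 := m.coeff_degree_ne_zero_iff.2 ac
    have hd : m.degree v.1 ∈ D := by
      refine mem_filter.2 ⟨hsupp v.1 v.2 (mem_support_iff.2 hc), v.1, v.2, ac, rfl⟩
    exact hc (congrFun hv ⟨_, hd⟩)
  have hcard : r ≤ D.card := by
    have hw := LinearMap.finrank_le_finrank_of_injective hT
    rw [finrank_span_eq_card hf] at hw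
    simpa using hw
  obtain ⟨E⟩ : Nonempty (Fin r ↪ D) := by
    rw [Function.Embedding.nonempty_iff_card_le]; simpa using hcard
  have hv : ∀ k, ∃ v ∈ V, v ≠ 0 ∧ m.degree v = (E k).1 := fun k => (mem_filter.1 (E k).2).2
  choose v hvV ac hvd using hv
  obtain ⟨I, hI, hdet⟩ := sep_points (fun k => (E k).1) (fun a b h => E.injective (Subtype.ext h))
  refine ⟨I, hI, ?_⟩
  have hA : ∀ k, ∃ c : Fin r → ℚ, ∑ l, c l • f l = v k := fun k =>
    (Submodule.mem_span_range_iff_exists_fun ℚ).1 (hvV k)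
  choose c hc using hA
  intro eo
  have hw : (of fun i k => hD (I i) (v k)).det = 0 := by
    have : (of fun i k => hD (I i) (v k)) = (of fun i k => hD (I i) (f k)) *
        (of fun l k => (C (c k l) : MP σ ℚ)) := by
      ext1 i k
      simp only [of_apply, Matrix.mul_apply]
      rw [← hc k, hD_sum]
      apply sum_congr rfl; intro l _
      rw [hD_smul, mul_comm, smul_eq_C_mul]
    rw [this, det_mul, eo, zero_mul]
  have ea : (of fun i k => monomial (I i) (1 : ℚ) * hD (I i) (v k)).det = 0 := by
    have := Matrix.det_mul_column (fun i => monomial (I i) (1 : ℚ)) (of fun i k => hD (I i) (v k))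
    simp only [of_apply] at this
    rw [this, hw, mul_zero]
  have hcoef : ∀ i k F, (monomial (I i) (1 : ℚ) * hD (I i) (v k)).coeff F = (chs F (I i) : ℚ) * (v k).coeff F := by
    intro i k F
    rw [coeff_monomial_mul']
    split_ifs with h
    · rw [coeff_hD, one_mul, tsub_add_cancel_of_le h]
    · rw [chs_eq_zero h]; simp
  have hdeg : ∀ i k, m.toSyn (m.degree (monomial (I i) (1 : ℚ) * hD (I i) (v k))) ≤ m.toSyn (E k).1 := by
    intro i k
    rw [m.degree_le_iff]
    intro b hb
    rw [mem_support_iff, hcoef] at hb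
    rw [← hvd k]
    exact m.le_degree (mem_support_iff.2 (right_ne_zero_of_mul hb))
  have ee := congrArg (coeff (∑ k, (E k).1)) ea
  rw [det_apply, coeff_sum, coeff_zero] at ee
  have el : ∀ p : Perm (Fin r), (Perm.sign p • ∏ i, (of fun i k => monomial (I i) (1 : ℚ) * hD (I i) (v k)) (p i) i).coeff (∑ k, (E k).1)
      = Perm.sign p • ((∏ i, (of fun i k => ((chs (E k).1 (I i) : ℕ) : ℚ)) (p i) i) * ∏ k, (v k).coeff (E k).1) := by
    intro p
    rw [← prod_mul_distrib]
    rw [show ∏ i, (of fun i k => ((chs (E k).1 (I i) : ℕ) : ℚ)) (p i) i * (v i).coeff (E i).1 =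
      (∏ i, (of fun i k => monomial (I i) (1 : ℚ) * hD (I i) (v k)) (p i) i).coeff (∑ k, (E k).1) by
        rw [coeff_prod_top m]
        · apply prod_congr rfl; intro i _
          simp [hcoef]
        · intro i _; exact hdeg _ _]
    rcases Int.units_eq_one_or (Perm.sign p) with h | h <;> simp [h]
  simp only [el] at ee
  rw [show ∑ p : Perm (Fin r), Perm.sign p • ((∏ i, (of fun i k => ((chs (E k).1 (I i) : ℕ) : ℚ)) (p i) i) * ∏ k, (v k).coeff (E k).1)
    = (of fun i k => ((chs (E k).1 (I i) : ℕ) : ℚ)).det * ∏ k, (v k).coeff (E k).1 by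
      rw [det_apply, sum_mul]; apply sum_congr rfl; intro p _; rw [smul_mul_assoc]] at ee
  refine mul_ne_zero hdet (prod_ne_zero_iff.2 fun k _ => ?_) ee
  rw [← hvd k]; exact m.coeff_degree_ne_zero_iff.2 (ac k)
end wronsk
end
section
open Polynomial
section uni
variable {K : Type} [Field K]
def un (w : AV K) (r : ℝ) (f : K[X]) : ℝ :=
  ∑ i ∈ f.support, w (f.coeff i) * r ^ i
lemma un_eq (w : AV K) (r : ℝ) (f : K[X]) (t : Finset ℕ) (h : f.support ⊆ t) :
    un w r f = ∑ i ∈ t, w (f.coeff i) * r ^ i := by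
  apply sum_subset h
  intro E _ hE
  rw [Polynomial.notMem_support_iff.1 hE]; simp
lemma un_nonneg (w : AV K) (r : ℝ) (hr : 0 ≤ r) (f : K[X]) : 0 ≤ un w r f :=
  sum_nonneg fun _ _ => mul_nonneg (w.nonneg _) (pow_nonneg hr _)
lemma coeff_le_un (w : AV K) (r : ℝ) (hr : 0 ≤ r) (f : K[X]) (i : ℕ) :
    w (f.coeff i) * r ^ i ≤ un w r f := by
  rw [un_eq w r f (insert i f.support) (subset_insert _ _)]
  exact single_le_sum (f := fun i => w (f.coeff i) * r ^ i)
    (fun _ _ => mul_nonneg (w.nonneg _) (pow_nonneg hr _)) (mem_insert_self _ _)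
lemma un_add (w : AV K) (r : ℝ) (hr : 0 ≤ r) (f g : K[X]) :
    un w r (f + g) ≤ un w r f + un w r g := by
  rw [un_eq w r (f+g) (f.support ∪ g.support) Polynomial.support_add,
    un_eq w r f (f.support ∪ g.support) (subset_union_left),
    un_eq w r g (f.support ∪ g.support) (subset_union_right), ← sum_add_distrib]
  apply sum_le_sum
  intro E _
  rw [← add_mul, coeff_add]
  exact mlr (w.add_le _ _) (pow_nonneg hr _)
lemma un_C_mul (w : AV K) (r : ℝ) (a : K) (f : K[X]) :
    un w r (C a * f) = w a * un w r f := by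
  rw [un_eq w r (C a * f) f.support (by
    intro i hi; rw [Polynomial.mem_support_iff, coeff_C_mul] at hi
    exact Polynomial.mem_support_iff.2 (right_ne_zero_of_mul hi)), un, mul_sum]
  apply sum_congr rfl; intro i _
  rw [coeff_C_mul, map_mul, mul_assoc]
lemma un_neg (w : AV K) (r : ℝ) (f : K[X]) : un w r (-f) = un w r f := by
  have := un_C_mul w r (-1) f
  simpa using this
lemma un_X_mul (w : AV K) (r : ℝ) (f : K[X]) :
    un w r (X * f) = r * un w r f := by
  rw [un_eq w r (X * f) (f.support.map ⟨Nat.succ, Nat.succ_injective⟩) (by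
    intro i hi; rw [Polynomial.mem_support_iff] at hi
    cases i with
    | zero => simp at hi
    | succ i => rw [coeff_X_mul] at hi; simp only [mem_map]; exact ⟨i, Polynomial.mem_support_iff.2 hi, rfl⟩), un, mul_sum, sum_map]
  apply sum_congr rfl; intro i _
  simp only [Function.Embedding.coeFn_mk, Nat.succ_eq_add_one, coeff_X_mul, pow_succ]; ring
lemma un_div (w : AV K) (eu es : K) (Q : K[X]) :
    w eu ≥ w es → w eu * un w 2 Q ≤ un w 2 ((C eu * X - C es) * Q) := by
  intro h
  have hw := un_add w 2 (by norm_num) ((C eu * X - C es) * Q) (C es * Q)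
  rw [show (C eu * X - C es) * Q + C es * Q = C eu * (X * Q) by ring, un_C_mul, un_X_mul,
    un_C_mul] at hw
  have := un_nonneg w 2 (by norm_num) Q
  nlinarith
lemma un_div' (w : AV K) (eu es : K) (Q : K[X]) :
    w eu ≤ w es → w es / 2 * un w (1/2) Q ≤ un w (1/2) ((C eu * X - C es) * Q) := by
  intro h
  have hw := un_add w (1/2) (by norm_num) (-((C eu * X - C es) * Q)) (C eu * (X * Q))
  rw [show -((C eu * X - C es) * Q) + C eu * (X * Q) = C es * Q by ring, un_C_mul, un_neg,
    un_C_mul, un_X_mul] at hw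
  have := un_nonneg w (1/2) (by norm_num) Q
  nlinarith
lemma un_divpow (w : AV K) (eu es : K) (Q : K[X]) (t : ℕ) :
    w es ≤ w eu → w eu ^ t * un w 2 Q ≤ un w 2 ((C eu * X - C es) ^ t * Q) := by
  intro h
  induction t with
  | zero => simp
  | succ t ih =>
    have := un_div w eu es ((C eu * X - C es) ^ t * Q) h
    rw [pow_succ', pow_succ', mul_assoc, mul_assoc]
    exact (mll ih (w.nonneg _)).trans this
lemma un_divpow' (w : AV K) (eu es : K) (Q : K[X]) (t : ℕ) :
    w eu ≤ w es → (w es / 2) ^ t * un w (1/2) Q ≤ un w (1/2) ((C eu * X - C es) ^ t * Q) := by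
  intro h
  induction t with
  | zero => simp
  | succ t ih =>
    have := un_div' w eu es ((C eu * X - C es) ^ t * Q) h
    rw [pow_succ', pow_succ', mul_assoc, mul_assoc]
    exact (mll ih (by have := w.nonneg es; positivity)).trans this
lemma cop_mem (R : Subring K) (eu es u v x : K) (eo : eu ∈ R) (hw : es ∈ R) (hu : u ∈ R) (hv : v ∈ R)
    (huv : u * es + v * eu = 1) (m n : ℕ) (hx0 : eu ^ m * x ∈ R) (hx1 : es ^ n * x ∈ R) : x ∈ R := by
  have hc : IsCoprime (⟨es, hw⟩ : R) ⟨eu, eo⟩ := ⟨⟨u, hu⟩, ⟨v, hv⟩, Subtype.ext huv⟩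
  obtain ⟨a, b, hab⟩ := hc.pow (m := n) (n := m)
  have hab' : (a : K) * es ^ n + b * eu ^ m = 1 := by
    have := congrArg (Subtype.val) hab
    simpa using this
  have : x = a * (es ^ n * x) + b * (eu ^ m * x) := by linear_combination (-x) * hab'
  rw [this]
  exact R.add_mem (R.mul_mem a.2 hx1) (R.mul_mem b.2 hx0)
lemma gauss1 (R : Subring K) (eu es u v : K) (eo : eu ∈ R) (hw : es ∈ R) (hu : u ∈ R) (hv : v ∈ R)
    (huv : u * es + v * eu = 1) (Q : K[X]) (hQ : ∀ i, ((C eu * X - C es) * Q).coeff i ∈ R) (i : ℕ) :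
    Q.coeff i ∈ R := by
  have em : ((C eu * X - C es) * Q).coeff 0 = - (es * Q.coeff 0) := by
    rw [sub_mul, coeff_sub, mul_assoc, coeff_C_mul, coeff_C_mul]; simp
  have cs : ∀ i, ((C eu * X - C es) * Q).coeff (i+1) = eu * Q.coeff i - es * Q.coeff (i+1) := by
    intro i
    rw [sub_mul, coeff_sub, mul_assoc, coeff_C_mul, coeff_C_mul, coeff_X_mul]
  have A : ∀ k i, Q.natDegree < i + k → eu ^ k * Q.coeff i ∈ R := by
    intro k
    induction k with
    | zero => intro i hi; rw [coeff_eq_zero_of_natDegree_lt (by simpa using hi)]; simp [R.zero_mem]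
    | succ k ih =>
      intro i hi
      have := R.add_mem (R.mul_mem (R.pow_mem eo k) (hQ (i+1))) (R.mul_mem hw (ih (i+1) (by omega)))
      rw [cs] at this
      convert this using 1; ring
  have B : ∀ i, es ^ (i+1) * Q.coeff i ∈ R := by
    intro i
    induction i with
    | zero => have := R.neg_mem (hQ 0); rw [em] at this; simpa using this
    | succ i ih =>
      have := R.sub_mem (R.mul_mem eo ih) (R.mul_mem (R.pow_mem hw (i+1)) (hQ (i+1)))
      rw [cs] at this
      convert this using 1; ring
  exact cop_mem R eu es u v _ eo hw hu hv huv (Q.natDegree + 1) (i+1) (A _ i (by omega)) (B i)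
lemma gauss (R : Subring K) (eu es u v : K) (eo : eu ∈ R) (hw : es ∈ R) (hu : u ∈ R) (hv : v ∈ R)
    (huv : u * es + v * eu = 1) (t : ℕ) (Q : K[X])
    (hQ : ∀ i, ((C eu * X - C es) ^ t * Q).coeff i ∈ R) (i : ℕ) :
    Q.coeff i ∈ R := by
  induction t generalizing i with
  | zero => simpa using hQ i
  | succ t ih =>
    apply ih
    intro j
    apply gauss1 R eu es u v eo hw hu hv huv
    intro k
    have := hQ k
    rwa [pow_succ', mul_assoc] at this
lemma uni_main {S : Type} [Fintype S] (Φ : PlaceSys K S) [CharZero K] (G : ℤ[X]) (hG : G ≠ 0) (d : ℕ)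
    (hd : G.natDegree ≤ d) (B : ℝ) (hB : ∑ i ∈ G.support, |(G.coeff i : ℝ)| ≤ B) (eu es u v : K)
    (eo : eu ∈ Φ.R) (hw : es ∈ Φ.R) (hu : u ∈ Φ.R) (hv : v ∈ Φ.R) (huv : u * es + v * eu = 1)
    (bb : eu ≠ 0) (t : ℕ)
    (ht : ∀ e < t, ((G.map (icr K)).comp (X + C (es / eu))).coeff e = 0) :
    (∏ s, max (Φ.w s eu) (Φ.w s es)) ^ t ≤ (4 ^ d * B) ^ fc S := by
  have hinj : Injective (icr K) := Int.cast_injective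
  have hG' : G.map (icr K) ≠ 0 := (Polynomial.map_ne_zero_iff hinj).2 hG
  obtain ⟨Q0, hQ0⟩ := X_sub_C_pow_dvd_iff.2 (X_pow_dvd_iff.2 ht)
  set Q : K[X] := C ((eu⁻¹) ^ t) * Q0 with hQdef
  have hQ : G.map (icr K) = (C eu * X - C es) ^ t * Q := by
    have : (C eu * X - C es) = C eu * (X - C (es / eu)) := by
      rw [mul_sub, ← C_mul, mul_div_cancel₀ _ bb]
    rw [hQ0, this, mul_pow, hQdef, ← C_pow]
    have e : (C (eu ^ t) : K[X]) * C (eu⁻¹ ^ t) = 1 := by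
      rw [← C_mul, ← mul_pow, mul_inv_cancel₀ bb]; simp
    linear_combination (-(X - C (es / eu)) ^ t * Q0) * e
  have htd : t ≤ d := by
    have ea := Polynomial.natDegree_le_of_dvd ⟨Q0, hQ0⟩ hG'
    rw [natDegree_pow, natDegree_X_sub_C, mul_one] at ea
    exact ea.trans ((natDegree_map_le).trans hd)
  have hQ00 : Q ≠ 0 := by rintro h; rw [h, mul_zero] at hQ; exact hG' hQ
  have hQd : Q.natDegree ≤ d := by
    have := Polynomial.natDegree_le_of_dvd (Dvd.intro_left _ hQ.symm) hG'
    exact this.trans ((natDegree_map_le).trans hd)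
  have hQR : ∀ i, Q.coeff i ∈ Φ.R := by
    apply gauss Φ.R eu es u v eo hw hu hv huv t
    intro i
    rw [← hQ, coeff_map]
    exact intCast_mem Φ.R _
  set q := Q.leadingCoeff with hq
  have hq1 := Φ.prod_ge q (hQR _) (leadingCoeff_ne_zero.2 hQ00)
  have hB0 : 0 ≤ B := (sum_nonneg fun _ _ => abs_nonneg _).trans hB
  have hun : ∀ (s : S) (r : ℝ) (c : ℝ), 0 ≤ r → (∀ i ≤ d, r ^ i ≤ c) →
      un (Φ.w s) r (G.map (icr K)) ≤ c * B := by
    intro s r c hr hc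
    rw [un_eq _ r _ G.support (support_map_subset _ _)]
    calc _ ≤ ∑ i ∈ G.support, c * |(G.coeff i : ℝ)| := by
          apply sum_le_sum; intro i hi
          rw [coeff_map, mul_comm]
          apply mul_le_mul (hc i ((le_natDegree_of_mem_supp _ hi).trans hd)) (w_intCast _ _) (by simp)
          exact (pow_nonneg hr i).trans (hc i ((le_natDegree_of_mem_supp _ hi).trans hd))
      _ = c * ∑ i ∈ G.support, |(G.coeff i : ℝ)| := by rw [mul_sum]
      _ ≤ _ := mll hB (by have := hc 0 (by omega); rw [pow_zero] at this; linarith)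
  have key : ∀ s, max (Φ.w s eu) (Φ.w s es) ^ t * Φ.w s q ≤ 4 ^ d * B := by
    intro s
    rcases le_total (Φ.w s es) (Φ.w s eu) with h | h
    · rw [max_eq_left h]
      have ei := un_divpow (Φ.w s) eu es Q t h
      rw [← hQ] at ei
      have et := hun s 2 (4^d) (by norm_num) (fun i hi => by
        calc (2:ℝ)^i ≤ 2^d := pow_le_pow_right₀ (by norm_num) hi
          _ ≤ 4^d := pow_le_pow_left₀ (by norm_num) (by norm_num) _)
      have ed : Φ.w s q ≤ un (Φ.w s) 2 Q := by
        refine le_trans ?_ (coeff_le_un (Φ.w s) 2 (by norm_num) Q Q.natDegree)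
        have : (1:ℝ) ≤ 2 ^ Q.natDegree := one_le_pow₀ (by norm_num)
        exact le_mul_of_one_le_right ((Φ.w s).nonneg _) this
      exact ((mll ed (pow_nonneg ((Φ.w s).nonneg _) _)).trans ei).trans et
    · rw [max_eq_right h]
      have ei := un_divpow' (Φ.w s) eu es Q t h
      rw [← hQ] at ei
      have et := hun s (1/2) 1 (by norm_num) (fun i hi => pow_le_one₀ (by norm_num) (by norm_num))
      have ed : Φ.w s q * (1/2)^d ≤ un (Φ.w s) (1/2) Q := by
        refine le_trans ?_ (coeff_le_un (Φ.w s) (1/2) (by norm_num) Q Q.natDegree)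
        apply mll _ ((Φ.w s).nonneg _)
        exact pow_le_pow_of_le_one (by norm_num) (by norm_num) hQd
      have ev := ((mll ed (pow_nonneg (div_nonneg ((Φ.w s).nonneg es) (by norm_num : (0:ℝ) ≤ 2)) t)).trans ei).trans et
      rw [one_mul] at ev
      have am : (2:ℝ)^t * 2 ^ d ≤ 4 ^ d := by
        calc (2:ℝ)^t * 2 ^ d ≤ 2^d * 2^d := mlr (pow_le_pow_right₀ (by norm_num) htd) (by positivity)
          _ = 4^d := by rw [← mul_pow]; norm_num
      calc Φ.w s es ^ t * Φ.w s q = ((Φ.w s es / 2) ^ t * (Φ.w s q * (1/2)^d)) * (2^t * 2^d) := by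
            rw [div_pow, one_div, inv_pow]; field_simp
        _ ≤ B * (2^t*2^d) := mlr ev (by positivity)
        _ ≤ B * 4^d := mll am hB0
        _ = _ := mul_comm _ _
  calc _ ≤ (∏ s, max (Φ.w s eu) (Φ.w s es)) ^ t * ∏ s, Φ.w s q := by
        apply le_mul_of_one_le_right _ hq1
        exact pow_nonneg (prod_nonneg fun s _ => le_max_of_le_left ((Φ.w s).nonneg _)) _
    _ = ∏ s, (max (Φ.w s eu) (Φ.w s es) ^ t * Φ.w s q) := by
        rw [prod_mul_distrib, prod_pow]
    _ ≤ ∏ s : S, (4 ^ d * B) := prod_le_prod (fun s _ => mul_nonneg (pow_nonneg (le_max_of_le_left ((Φ.w s).nonneg _)) _) ((Φ.w s).nonneg _)) (fun s _ => key s)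
    _ = _ := by simp
end uni
end
section
open MvPolynomial
section emb
variable {A : Type} [CommRing A] {m : ℕ}
def ef (m : ℕ) (A : Type) [CommRing A] : MP (Fin m) A →ₐ[A] MP (Fin (m+1)) A :=
  rename Fin.succ
def eg (m : ℕ) (A : Type) [CommRing A] : MP (Fin 1) A →ₐ[A] MP (Fin (m+1)) A :=
  rename (fun _ => 0)
lemma coeff_ef_eg (f : MP (Fin m) A) (g : MP (Fin 1) A) (E : Fin (m+1) →₀ ℕ) :
    (ef m A f * eg m A g).coeff E = f.coeff E.tail * g.coeff (single 0 (E 0)) := by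
  induction f using MvPolynomial.induction_on' with
  | add p q hp hq => rw [map_add, add_mul, coeff_add, hp, hq, coeff_add, add_mul]
  | monomial I a =>
    induction g using MvPolynomial.induction_on' with
    | add p q hp hq => rw [map_add, mul_add, coeff_add, hp, hq, coeff_add, mul_add]
    | monomial J b =>
      rw [ef, eg, rename_monomial, rename_monomial, monomial_mul, coeff_monomial, coeff_monomial,
        coeff_monomial]
      have hw : Finsupp.mapDomain Fin.succ I + Finsupp.mapDomain (fun _ : Fin 1 => (0 : Fin (m+1))) J
          = Finsupp.cons (J 0) I := by
        ext i
        refine Fin.cases ?_ (fun i => ?_) i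
        · rw [Finsupp.add_apply, mapDomain_notin_range _ _ (by simp)]
          have := mapDomain_apply (f := (fun _ : Fin 1 => (0 : Fin (m+1)))) (Function.injective_of_subsingleton _) J 0
          simp [this]
        · rw [Finsupp.add_apply, mapDomain_apply (Fin.succ_injective m),
            mapDomain_notin_range _ _ (by simp [Fin.succ_ne_zero, eq_comm])]
          simp
      rw [hw]
      have ea : Finsupp.cons (J 0) I = E ↔ I = E.tail ∧ J = single 0 (E 0) := by
        constructor
        · rintro rfl
          refine ⟨by simp, ?_⟩
          refine Finsupp.ext fun i => ?_; rw [Subsingleton.elim i 0]; simp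
        · rintro ⟨rfl, rfl⟩
          simp
      simp only [ea]
      clear hw ea
      by_cases ha : I = E.tail <;> by_cases hb : J = single 0 (E 0) <;> simp [ha, hb]
lemma hD_ef_eg (f : MP (Fin m) A) (g : MP (Fin 1) A) (I : Fin (m+1) →₀ ℕ) :
    hD I (ef m A f * eg m A g) = ef m A (hD I.tail f) * eg m A (hD (single 0 (I 0)) g) := by
  ext E
  rw [coeff_hD, coeff_ef_eg, coeff_ef_eg, coeff_hD, coeff_hD]
  have hw : (E + I).tail = E.tail + I.tail := by ext i; simp [Finsupp.tail_apply]
  have ea : single (0 : Fin 1) ((E + I) 0) = single 0 (E 0) + single 0 (I 0) := by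
    rw [← Finsupp.single_add]; rfl
  have ee : chs (E + I) I = chs (E.tail + I.tail) I.tail *
      chs (single 0 (E 0) + single 0 (I 0)) (single (0 : Fin 1) (I 0)) := by
    unfold chs
    rw [Fin.prod_univ_succ]
    simp [Finsupp.tail_apply, mul_comm]
  rw [hw, ea, ee]; push_cast; ring
lemma hD_map {B : Type} [CommRing B] {σ : Type} [Fintype σ] (φ : A →+* B) (I : σ →₀ ℕ) (f : MP σ A) :
    map φ (hD I f) = hD I (map φ f) := by
  ext E; simp [coeff_hD, coeff_map]
lemma map_ef {B : Type} [CommRing B] (φ : A →+* B) (f : MP (Fin m) A) :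
    map φ (ef m A f) = ef m B (map φ f) := by
  simp [ef, map_rename]
lemma map_eg {B : Type} [CommRing B] (φ : A →+* B) (f : MP (Fin 1) A) :
    map φ (eg m A f) = eg m B (map φ f) := by
  simp [eg, map_rename]
def up (A : Type) [CommRing A] : MP (Fin 1) A →ₐ[A] Polynomial A :=
  aeval (fun _ => Polynomial.X)
lemma coeff_up (f : MP (Fin 1) A) (j : ℕ) :
    (up A f).coeff j = f.coeff (single 0 j) := by
  induction f using MvPolynomial.induction_on' with
  | add p q hp hq => rw [map_add, Polynomial.coeff_add, hp, hq, coeff_add]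
  | monomial I a =>
    rw [up, aeval_monomial, coeff_monomial]
    have : I = single 0 (I 0) := by
      refine Finsupp.ext fun i => ?_; rw [Subsingleton.elim i 0]; simp
    have ea : (I = single 0 j) ↔ j = I 0 := by
      constructor
      · rintro h; rw [h]; simp
      · rintro rfl; exact this
    rw [prod_fintype _ _ (by simp)]
    simp [ea, Polynomial.coeff_X_pow]
end emb
section shifts
variable {K : Type} [Field K] [CharZero K] {m : ℕ}
lemma shift_ef (β : Fin (m+1) → K) (f : MP (Fin m) K) :
    shift β (ef m K f) = ef m K (shift (β ∘ Fin.succ) f) := by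
  have : (shift β).comp (ef m K) = (ef m K).comp (shift (β ∘ Fin.succ)) := by
    ext i; simp [shift, ef]
  exact DFunLike.congr_fun this f
lemma shift_eg (β : Fin (m+1) → K) (f : MP (Fin 1) K) :
    shift β (eg m K f) = eg m K (shift (fun _ => β 0) f) := by
  have : (shift β).comp (eg m K) = (eg m K).comp (shift (fun _ => β 0)) := by
    ext i; simp [shift, eg]
  exact DFunLike.congr_fun this f
lemma up_shift (β : K) (f : MP (Fin 1) K) :
    up K (shift (fun _ => β) f) = (up K f).comp (Polynomial.X + Polynomial.C β) := by
  have : (up K).comp (shift (fun _ => β)) = (Polynomial.aeval (Polynomial.X + Polynomial.C β)).comp (up K) := by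
    ext i; simp [shift, up]
  exact DFunLike.congr_fun this f
end shifts
section nrmbounds
variable {σ : Type} [Fintype σ]
lemma nrm_hD (I : σ →₀ ℕ) (F : MP σ ℤ) (N : ℕ) (hN : ∀ E ∈ F.support, ∑ i, E i ≤ N) :
    nrm absZ 1 (hD I F) ≤ 2 ^ N * nrm absZ 1 F := by
  unfold hD
  refine (nrm_sum _ _ (by simp) _ _).trans ?_
  rw [nrm, mul_sum]
  apply sum_le_sum
  intro E hE
  rw [nrm_monomial, map_mul]
  have : absZ ((chs E I : ℕ) : ℤ) ≤ 2 ^ N := by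
    rw [absZ_apply]
    have hw : chs E I ≤ 2 ^ N := by
      calc chs E I ≤ ∏ i, 2 ^ (E i) := prod_le_prod' fun i _ => Nat.choose_le_two_pow _ _
        _ = 2 ^ ∑ i, E i := by rw [prod_pow_eq_pow_sum]
        _ ≤ 2 ^ N := Nat.pow_le_pow_right (by norm_num) (hN E hE)
    have ea : ((chs E I : ℕ) : ℝ) ≤ 2 ^ N := mod_cast hw
    simpa using ea
  simp only [Pi.one_apply, one_pow, prod_const_one, mul_one]
  rw [mul_comm]
  exact mlr this (absZ.nonneg _)
lemma nrm_det {A : Type} [CommRing A] [IsDomain A] (w : AbsoluteValue A ℝ) {r : ℕ}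
    (M : Matrix (Fin r) (Fin r) (MP σ A)) (b : ℝ)
    (hb : ∀ i j, nrm w 1 (M i j) ≤ b) : nrm w 1 M.det ≤ (r.factorial : ℝ) * b ^ r := by
  rw [det_apply]
  refine (nrm_sum _ _ (by simp) _ _).trans ?_
  calc _ ≤ ∑ p : Perm (Fin r), b ^ r := by
        apply sum_le_sum; intro p _
        have hw : nrm w 1 (Perm.sign p • ∏ i, M (p i) i) ≤ nrm w 1 (∏ i, M (p i) i) := by
          rcases Int.units_eq_one_or (Perm.sign p) with h | h
          · simp [h]
          · rw [h, show ((-1 : ℤˣ) • ∏ i, M (p i) i) = C (-1) * ∏ i, M (p i) i by simp]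
            refine (nrm_mul _ _ (by simp) _ _).trans ?_
            rw [nrm_C, AbsoluteValue.map_neg, AbsoluteValue.map_one, one_mul]
        refine hw.trans ((nrm_prod _ _ (by simp) _ _).trans ?_)
        calc _ ≤ ∏ i : Fin r, b := prod_le_prod (fun i _ => nrm_nonneg _ _ (by simp) _) (fun i _ => hb _ _)
          _ = b ^ r := by simp
    _ = _ := by simp [Fintype.card_perm]
def idx (d : σ → ℕ) (E : σ →₀ ℕ) : ℝ := ∑ h, (E h : ℝ) / d h
lemma idx_add (d : σ → ℕ) (E F : σ →₀ ℕ) : idx d (E + F) = idx d E + idx d F := by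
  simp [idx, add_div, sum_add_distrib]
lemma idx_nonneg (d : σ → ℕ) (E : σ →₀ ℕ) : 0 ≤ idx d E :=
  sum_nonneg fun _ _ => by positivity
lemma idx_prod {A : Type} [CommRing A] (d : σ → ℕ) {α : Type*} (t : Finset α) (P : α → MP σ A)
    (c : α → ℝ) (h : ∀ a ∈ t, ∀ E, (P a).coeff E ≠ 0 → c a ≤ idx d E) (E : σ →₀ ℕ)
    (hE : (∏ a ∈ t, P a).coeff E ≠ 0) : ∑ a ∈ t, c a ≤ idx d E := by
  classical
  induction t using Finset.induction_on generalizing E with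
  | empty => simpa using idx_nonneg d E
  | insert a t ha ih =>
    rw [prod_insert ha] at hE
    have := support_mul _ _ (mem_support_iff.2 hE)
    obtain ⟨x, hx, y, hy, rfl⟩ := mem_add.1 this
    rw [sum_insert ha, idx_add]
    exact add_le_add (h a (mem_insert_self _ _) x (mem_support_iff.1 hx))
      (ih (fun b hb => h b (mem_insert_of_mem hb)) y (mem_support_iff.1 hy))
lemma idx_det {A : Type} [CommRing A] (d : σ → ℕ) {r : ℕ} (M : Matrix (Fin r) (Fin r) (MP σ A))
    (c : Fin r → ℝ) (h : ∀ i j E, (M i j).coeff E ≠ 0 → c j ≤ idx d E) (E : σ →₀ ℕ)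
    (hE : M.det.coeff E ≠ 0) : ∑ j, c j ≤ idx d E := by
  rw [det_apply, coeff_sum] at hE
  obtain ⟨p, _, hp⟩ := exists_ne_zero_of_sum_ne_zero hE
  apply idx_prod d univ (fun i => M (p i) i) c (fun a _ E h' => h _ _ _ h')
  intro eo; apply hp
  rcases Int.units_eq_one_or (Perm.sign p) with h | h <;> simp [h, eo]
lemma supp_prod {A : Type} [CommRing A] (h : σ) {α : Type*} (t : Finset α) (P : α → MP σ A)
    (n : ℕ) (hP : ∀ a ∈ t, ∀ E, (P a).coeff E ≠ 0 → E h ≤ n) (E : σ →₀ ℕ)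
    (hE : (∏ a ∈ t, P a).coeff E ≠ 0) : E h ≤ t.card * n := by
  classical
  induction t using Finset.induction_on generalizing E with
  | empty =>
    simp only [prod_empty, coeff_one, ne_eq, ite_eq_right_iff, Classical.not_imp] at hE
    rw [← hE.1]; simp
  | insert a t ha ih =>
    rw [prod_insert ha] at hE
    have := support_mul _ _ (mem_support_iff.2 hE)
    obtain ⟨x, hx, y, hy, rfl⟩ := mem_add.1 this
    rw [card_insert_of_notMem ha, Finsupp.add_apply]
    have hw := (hP a (mem_insert_self _ _) x (mem_support_iff.1 hx))
    have ea := (ih (fun b hb => hP b (mem_insert_of_mem hb)) y (mem_support_iff.1 hy))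
    linarith
lemma supp_det {A : Type} [CommRing A] (h : σ) {r : ℕ} (M : Matrix (Fin r) (Fin r) (MP σ A))
    (n : ℕ) (hM : ∀ i j E, (M i j).coeff E ≠ 0 → E h ≤ n) (E : σ →₀ ℕ)
    (hE : M.det.coeff E ≠ 0) : E h ≤ r * n := by
  rw [det_apply, coeff_sum] at hE
  obtain ⟨p, _, hp⟩ := exists_ne_zero_of_sum_ne_zero hE
  have := supp_prod h univ (fun i => M (p i) i) n (fun a _ E h' => hM _ _ _ h') E (by
    intro eo; apply hp
    rcases Int.units_eq_one_or (Perm.sign p) with h | h <;> simp [h, eo])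
  simpa using this
end nrmbounds
lemma decomp {m : ℕ} (F : MP (Fin (m+1)) ℚ) (hF : F ≠ 0) (d : ℕ) (hd : ∀ E, F.coeff E ≠ 0 → E 0 ≤ d) :
    ∃ r : ℕ, 1 ≤ r ∧ r ≤ d + 1 ∧ ∃ (f : Fin r → MP (Fin m) ℚ) (g : Fin r → MP (Fin 1) ℚ),
      LinearIndependent ℚ f ∧ LinearIndependent ℚ g ∧ F = ∑ k, ef m ℚ (f k) * eg m ℚ (g k) := by
  classical
  let p : Fin (d+1) → MP (Fin m) ℚ := fun j => (finSuccEquiv ℚ m F).coeff j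
  let V := span ℚ (Set.range p)
  haveI : Module.Finite ℚ V := FiniteDimensional.span_of_finite ℚ (Set.finite_range p)
  let b := Module.finBasis ℚ V
  let r := Module.finrank ℚ V
  have hp : ∀ j, p j ∈ V := fun j => subset_span ⟨j, rfl⟩
  let c : Fin (d+1) → Fin r → ℚ := fun j k => b.repr ⟨p j, hp j⟩ k
  have hc : ∀ j, p j = ∑ k, c j k • (b k : MP (Fin m) ℚ) := by
    intro j
    have := congrArg Subtype.val (b.sum_repr ⟨p j, hp j⟩)
    simp only [Submodule.coe_sum, Submodule.coe_smul] at this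
    exact this.symm
  let g : Fin r → MP (Fin 1) ℚ := fun k => ∑ j : Fin (d+1), monomial (single 0 (j : ℕ)) (c j k)
  have hg : ∀ k n, (g k).coeff (single 0 n) = if h : n < d + 1 then c ⟨n, h⟩ k else 0 := by
    intro k n
    simp only [g, coeff_sum, coeff_monomial]
    split_ifs with h
    · rw [sum_eq_single ⟨n, h⟩]
      · simp
      · intro j _ hj
        rw [if_neg]
        intro h'
        apply hj
        have := single_injective _ h'
        exact Fin.ext this
      · simp
    · apply sum_eq_zero
      intro j _
      rw [if_neg]
      intro h'
      have := single_injective _ h'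
      have := j.2; omega
  have hF' : F = ∑ k, ef m ℚ (b k : MP (Fin m) ℚ) * eg m ℚ (g k) := by
    ext E
    rw [coeff_sum]
    simp only [coeff_ef_eg, hg]
    split_ifs with h
    · have hw : F.coeff E = (p ⟨E 0, h⟩).coeff E.tail := by
        simp only [p, finSuccEquiv_coeff_coeff, Finsupp.cons_tail]
      rw [hw, hc, coeff_sum]
      apply sum_congr rfl; intro k _
      rw [coeff_smul, smul_eq_mul, mul_comm]
    · simp only [mul_zero, sum_const_zero]
      by_contra eo
      have := hd E eo; omega
  refine ⟨r, ?_, ?_, fun k => b k, g, ?_, ?_, hF'⟩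
  · by_contra eo
    apply hF
    rw [hF']
    have : r = 0 := by omega
    apply sum_eq_zero; intro k _
    have := k.2; omega
  · have := finrank_range_le_card (R := ℚ) p
    rw [Fintype.card_fin] at this
    exact this
  · exact b.linearIndependent.map' V.subtype (Submodule.ker_subtype V)
  · rw [Fintype.linearIndependent_iff]
    intro a ha
    let φ : V →ₗ[ℚ] ℚ := b.constr ℚ a
    have hw : ∀ j, φ ⟨p j, hp j⟩ = 0 := by
      intro j
      have ea : φ ⟨p j, hp j⟩ = ∑ k, c j k * a k := by
        conv_lhs => rw [← b.sum_repr ⟨p j, hp j⟩]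
        rw [map_sum]
        apply sum_congr rfl; intro k _
        rw [map_smul, smul_eq_mul, b.constr_basis]
      have ee := congrArg (coeff (single 0 (j : ℕ))) ha
      rw [coeff_sum] at ee
      simp only [coeff_smul, hg, Fin.is_lt, dif_pos, Fin.eta, smul_eq_mul, coeff_zero] at ee
      rw [ea, ← ee]
      apply sum_congr rfl; intro k _; ring
    have el : φ = 0 := by
      ext ⟨x, hx⟩
      simp only [LinearMap.zero_apply]
      induction hx using span_induction with
      | mem x h => obtain ⟨j, rfl⟩ := h; exact hw j
      | zero => exact map_zero φ
      | add x y hx hy hw ea =>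
        have := map_add φ ⟨x, hx⟩ ⟨y, hy⟩
        rw [hw, ea, add_zero] at this; exact this
      | smul t x hx hw =>
        have := map_smul φ t ⟨x, hx⟩
        rw [hw, smul_zero] at this; exact this
    intro k
    have := b.constr_basis ℚ a k
    rw [← this]
    change φ (b k) = 0
    rw [el]; rfl
end
section
open MvPolynomial
section roth
variable {K : Type} [Field K] [CharZero K] {S : Type} [Fintype S]
structure CopFrac (Φ : PlaceSys K S) where
  num : K
  den : K
  u : K
  v : K
  hnum : num ∈ Φ.R
  hden : den ∈ Φ.R
  hu : u ∈ Φ.R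
  hv : v ∈ Φ.R
  hne : den ≠ 0
  hcop : u * num + v * den = 1
def CopFrac.val {Φ : PlaceSys K S} (b : CopFrac Φ) : K := b.num / b.den
def CopFrac.ht {Φ : PlaceSys K S} (b : CopFrac Φ) : ℝ :=
  log (∏ s, max (Φ.w s b.den) (Φ.w s b.num))
lemma CopFrac.one_le {Φ : PlaceSys K S} (b : CopFrac Φ) : 1 ≤ ∏ s, max (Φ.w s b.den) (Φ.w s b.num) :=
  (Φ.prod_ge _ b.hden b.hne).trans (prod_le_prod (fun s _ => (Φ.w s).nonneg _) fun s _ => le_max_left _ _)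
lemma CopFrac.ht_nonneg {Φ : PlaceSys K S} (b : CopFrac Φ) : 0 ≤ b.ht := log_nonneg b.one_le
lemma sum_low (r d : ℕ) (hd : 1 ≤ d) (hr : r ≤ d + 1) (θ : ℝ) (eo : 0 < θ) (hw : θ ≤ 1/2)
    (J : Fin r → ℕ) (hJ : Injective J) (hJr : ∀ j, J j ≤ r - 1) :
    r * θ ^ 2 / 8 ≤ ∑ j, max 0 (θ - J j / d) := by
  classical
  have ei : ∑ j, max 0 (θ - J j / d) = ∑ k ∈ univ.image J, max 0 (θ - (k:ℝ) / d) := by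
    rw [sum_image (fun a _ b _ h => hJ h)]
  have et : univ.image J = range r := by
    apply eq_of_subset_of_card_le
    · intro k hk
      obtain ⟨j, _, rfl⟩ := mem_image.1 hk
      have := hJr j; have := j.2; simp; omega
    · rw [card_image_of_injective _ hJ]; simp
  rw [ei, et]
  set n := ⌈r * θ / 4⌉₊
  have hn : n ≤ r := by
    apply Nat.ceil_le.2
    have : (0:ℝ) ≤ r := by positivity
    nlinarith
  have hn2 : r * θ / 4 ≤ n := Nat.le_ceil _
  have hd' : (1:ℝ) ≤ d := mod_cast hd
  have hr' : (r:ℝ) ≤ 2 * d := by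
    have : (r:ℝ) ≤ d + 1 := mod_cast hr
    linarith
  calc r * θ ^ 2 / 8 ≤ n * (θ / 2) := by nlinarith
    _ = ∑ k ∈ range n, θ / 2 := by simp
    _ ≤ ∑ k ∈ range n, max 0 (θ - (k:ℝ) / d) := by
        apply sum_le_sum
        intro k hk
        apply le_max_of_le_right
        have hk' : (k:ℝ) < r * θ / 4 := Nat.lt_ceil.1 (mem_range.1 hk)
        have : (k:ℝ) / d ≤ θ / 2 := by
          rw [div_le_iff₀ (by linarith)]
          nlinarith
        linarith
    _ ≤ _ := sum_le_sum_of_subset_of_nonneg (by simpa using hn) fun _ _ _ => le_max_left _ _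
lemma nrm_sub {σ τ : Type} [Fintype σ] [Fintype τ] (F : MP σ ℤ) (e : (τ →₀ ℕ) → (σ →₀ ℕ)) (he : Injective e)
    (t : Finset (τ →₀ ℕ)) : ∑ E ∈ t, |((F.coeff (e E) : ℤ) : ℝ)| ≤ nrm absZ 1 F := by
  classical
  rw [nrm_eq _ _ F (F.support ∪ t.image e) subset_union_left]
  calc _ = ∑ E ∈ t.image e, |((F.coeff E : ℤ) : ℝ)| := by rw [sum_image (fun a _ b _ h => he h)]
    _ ≤ ∑ E ∈ F.support ∪ t.image e, |((F.coeff E : ℤ) : ℝ)| :=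
      sum_le_sum_of_subset_of_nonneg subset_union_right fun _ _ _ => abs_nonneg _
    _ = _ := by simp [absZ_apply]
lemma roth_step1 {m : ℕ} (F : MP (Fin (m+1)) ℤ) (hF : F ≠ 0) (d : Fin (m+1) → ℕ)
    (hd : ∀ h, 1 ≤ d h) (hsupp : ∀ E, F.coeff E ≠ 0 → ∀ h, E h ≤ d h)
    (A Dm : ℝ) (hA : 0 ≤ A) (hnF : nrm absZ 1 F ≤ exp A) (hDm : ∀ h, (d h : ℝ) ≤ Dm) :
    ∃ r : ℕ, 1 ≤ r ∧ r ≤ d 0 + 1 ∧ ∃ (I : Fin r → Fin m →₀ ℕ) (J : Fin r → ℕ)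
      (U : MP (Fin m) ℚ) (W : MP (Fin 1) ℚ) (V : MP (Fin (m+1)) ℤ),
      (∀ i, ∑ h, I i h ≤ r - 1) ∧ Injective J ∧ (∀ j, J j ≤ r - 1) ∧ U ≠ 0 ∧ W ≠ 0 ∧
      V = (of fun i j => hD (Finsupp.cons (J j) (I i)) F).det ∧
      map (icr ℚ) V = ef m ℚ U * eg m ℚ W ∧
      nrm absZ 1 V ≤ exp (r * (A + (m+3) * Dm)) ∧
      (∀ E, V.coeff E ≠ 0 → ∀ h, E h ≤ r * d h) := by
  classical
  set Fq := map (icr ℚ) F with hFq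
  have hinj : Injective (icr ℚ) := Int.cast_injective
  have hFq0 : Fq ≠ 0 := by
    intro h; apply hF; apply map_injective _ hinj; rw [← hFq, h, map_zero]
  obtain ⟨r, hr1, hr2, f, g, hf, hg, hFd⟩ := decomp Fq hFq0 (d 0) (by
    intro E hE; apply hsupp E; intro h; apply hE; rw [hFq, coeff_map, h]; simp)
  obtain ⟨I, hI, hU⟩ := wronsk f hf
  obtain ⟨J, hJ, hW⟩ := wronsk g hg
  have hJs : ∀ j, J j = single 0 (J j 0) := fun j => by
    refine Finsupp.ext fun i => ?_; rw [Subsingleton.elim i 0]; simp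
  refine ⟨r, hr1, hr2, I, fun j => J j 0, _, _, _, hI, ?_, ?_, hU, hW, rfl, ?_, ?_, ?_⟩
  · intro a b hab
    by_contra hne
    apply hW
    apply Matrix.det_zero_of_row_eq hne
    ext k : 1
    have : J a = J b := by rw [hJs a, hJs b]; simp only at hab; rw [hab]
    simp [this]
  · intro j; simpa using hJ j
  · rw [RingHom.map_det]
    have ei : (map (icr ℚ)).mapMatrix (of fun i j => hD (Finsupp.cons (J j 0) (I i)) F)
        = ((ef m ℚ).toRingHom.mapMatrix (of fun i k => hD (I i) (f k))) *
          ((eg m ℚ).toRingHom.mapMatrix (of fun i k => hD (J i) (g k))).transpose := by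
      refine Matrix.ext fun i j => ?_
      rw [Matrix.mul_apply]
      simp only [RingHom.mapMatrix_apply, Matrix.map_apply, of_apply, Matrix.transpose_apply]
      rw [hD_map, ← hFq, hFd, hD_sum]
      apply sum_congr rfl; intro k _
      rw [hD_ef_eg, tail_cons, cons_zero, ← hJs]
      rfl
    rw [ei, det_mul, Matrix.det_transpose, ← RingHom.map_det, ← RingHom.map_det]
    rfl
  · have hDm1 : 1 ≤ Dm := le_trans (mod_cast hd 0) (hDm 0)
    have hw : ∀ i j, nrm absZ 1 ((of fun i j => hD (Finsupp.cons (J j 0) (I i)) F) i j)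
        ≤ exp (A + (m+1) * Dm) := by
      intro i j
      refine (nrm_hD _ F (∑ h, d h) ?_).trans ?_
      · intro E hE; exact sum_le_sum fun h _ => hsupp E (mem_support_iff.1 hE) h
      · rw [exp_add, mul_comm]
        have ea : ((∑ h, d h : ℕ) : ℝ) ≤ (m+1) * Dm := by
          push_cast
          calc _ ≤ ∑ h : Fin (m+1), Dm := sum_le_sum fun h _ => hDm h
            _ = _ := by simp
        have ee : (2:ℝ) ^ (∑ h, d h) ≤ exp ((m+1) * Dm) := by
          calc (2:ℝ) ^ (∑ h, d h) ≤ (exp 1) ^ (∑ h, d h) := by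
                gcongr
                have := add_one_le_exp 1; linarith
            _ = exp ((∑ h, d h : ℕ) : ℝ) := by rw [← exp_nat_mul, mul_one]
            _ ≤ _ := exp_le_exp.2 ea
        have := nrm_nonneg absZ 1 (by simp) F
        gcongr
    refine (nrm_det absZ _ _ hw).trans ?_
    have el : ((r.factorial : ℕ) : ℝ) ≤ (exp (2 * Dm)) ^ r := by
      have eb : (r.factorial : ℝ) ≤ (r:ℝ) ^ r := mod_cast Nat.factorial_le_pow r
      refine eb.trans (pow_le_pow_left₀ (by positivity) ?_ r)
      have ew : (r:ℝ) ≤ d 0 + 1 := mod_cast hr2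
      have := hDm 0
      have := add_one_le_exp (2 * Dm); linarith
    calc _ ≤ (exp (2 * Dm)) ^ r * (exp (A + (m+1) * Dm)) ^ r := by gcongr
      _ = _ := by
        rw [← mul_pow, ← exp_add, ← exp_nat_mul]; ring_nf
  · intro E hE h
    refine supp_det h _ (d h) ?_ E hE
    intro i j E' hE'
    simp only [of_apply, coeff_hD] at hE'
    have := hsupp _ (right_ne_zero_of_mul hE') h
    rw [Finsupp.add_apply] at this; omega
set_option maxHeartbeats 2000000 in
lemma roth (Φ : PlaceSys K S) (m : ℕ) : ∀ θ : ℝ, 0 < θ → ∃ σ ap : ℝ, 0 < σ ∧ 0 < ap ∧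
    ∀ (d : Fin m → ℕ) (F : MP (Fin m) ℤ) (A Dm : ℝ) (β : Fin m → CopFrac Φ),
      (∀ h, 1 ≤ d h) → (∀ i j, i < j → (d i : ℝ) ≤ σ * d j) → F ≠ 0 →
      (∀ E, F.coeff E ≠ 0 → ∀ h, E h ≤ d h) → 0 ≤ A → nrm absZ 1 F ≤ exp A →
      (∀ h, (d h : ℝ) ≤ Dm) → (∀ h, ap * (A + Dm) ≤ d h * (β h).ht) →
      ∃ E, (shift (fun h => (β h).val) (map (icr K) F)).coeff E ≠ 0 ∧ idx d E < θ := by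
  classical
  induction m with
  | zero =>
    intro θ hθ
    refine ⟨1, 1, one_pos, one_pos, ?_⟩
    intro d F A Dm β _ _ hF _ _ _ _ _
    refine ⟨0, ?_, by simpa [idx] using hθ⟩
    obtain ⟨a, rfl⟩ := C_surjective (R := ℤ) (Fin 0) F
    have hF0 : a ≠ 0 := by intro h; rw [h] at hF; simp at hF
    rw [map_C, ← algebraMap_eq, AlgHom.commutes, algebraMap_eq, coeff_C, if_pos rfl]
    simpa using hF0
  | succ m ih =>
    intro θ hθ
    set θ1 := min θ 1 / 2 with hθ1
    have hθ1p : 0 < θ1 := by rw [hθ1]; positivity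
    have hθ1a : 2 * θ1 ≤ θ := by have := min_le_left θ 1; linarith
    have hθ1b : θ1 ≤ 1/2 := by have := min_le_right θ 1; linarith
    set θ' := θ1 ^ 2 / 16 with hθ'
    have hθ'p : 0 < θ' := by positivity
    obtain ⟨σ', C0', hσ', hC0', IH⟩ := ih θ' hθ'p
    refine ⟨min σ' θ1, C0' * (m+4) + (fc S * (m+5) + 1) / θ', by positivity, by positivity, ?_⟩
    intro d F A Dm β hd hdσ hF hsupp hA hnF hDm hht
    by_contra hcon
    push Not at hcon
    obtain ⟨r, hr1, hr2, I, J, U, W, V, hI, hJi, hJr, hU, hW, hV, hVm, hVn, hVs⟩ :=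
      roth_step1 F hF d hd hsupp A Dm hA hnF hDm
    have hinjQ : Injective (icr ℚ) := Int.cast_injective
    have hDm1 : 1 ≤ Dm := le_trans (mod_cast hd 0) (hDm 0)
    have hr1' : (1:ℝ) ≤ r := mod_cast hr1
    set q := Rat.castHom K with hq
    have hqZ : (icr K) = q.comp (icr ℚ) := RingHom.ext_int _ _
    set UK := map q U
    set WK := map q W
    have hinjq : Injective q := q.injective
    have hUK : UK ≠ 0 := fun h => hU (map_injective _ hinjq (by rw [map_zero]; exact h))
    have hWK : WK ≠ 0 := fun h => hW (map_injective _ hinjq (by rw [map_zero]; exact h))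
    have hVK : map (icr K) V = ef m K UK * eg m K WK := by
      rw [hqZ, ← MvPolynomial.map_map, hVm, map_mul, map_ef, map_eg]
    set b : Fin (m+1) → K := fun h => (β h).val with hb
    have hVs' : shift b (map (icr K) V) = ef m K (shift (b ∘ Fin.succ) UK) * eg m K (shift (fun _ => b 0) WK) := by
      rw [hVK, map_mul, shift_ef, shift_eg]
    have hcoefV : ∀ E, ((V.coeff E : ℤ) : ℚ) = U.coeff E.tail * W.coeff (single 0 (E 0)) := by
      intro E
      rw [← coeff_ef_eg, ← hVm, coeff_map]; rfl
    obtain ⟨ez, hE1⟩ := ne_zero_iff.1 hU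
    obtain ⟨af, hE2⟩ := ne_zero_iff.1 hW
    have hE2s : af = single 0 (af 0) := by
      refine Finsupp.ext fun i => ?_; rw [Subsingleton.elim i 0]; simp
    set ex := af 0 with hj1
    rw [hE2s] at hE2
    set V1 := (finSuccEquiv ℤ m V).coeff ex with hV1
    have hV1c : ∀ E, V1.coeff E = V.coeff (Finsupp.cons ex E) := fun E => finSuccEquiv_coeff_coeff _ _ _
    have hV1K : map (icr K) V1 = C (q (W.coeff (single 0 ex))) * UK := by
      ext E
      rw [coeff_map, hV1c, coeff_C_mul, coeff_map, ← map_mul]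
      have := hcoefV (Finsupp.cons ex E)
      simp only [tail_cons, cons_zero] at this
      rw [mul_comm, ← this]
      simp
    have hV10 : V1 ≠ 0 := by
      rw [ne_zero_iff]
      refine ⟨ez, ?_⟩
      intro h
      rw [hV1c] at h
      have := hcoefV (Finsupp.cons ex ez)
      simp only [tail_cons, cons_zero, h, Int.cast_zero] at this
      exact mul_ne_zero hE1 hE2 this.symm
    obtain ⟨E', hE', hE'i⟩ := IH (fun h => r * d h.succ) V1 (r * (A + (m+3) * Dm)) (r * Dm) (fun h => β h.succ)
      (fun h => Nat.mul_pos hr1 (hd _)) (by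
        intro i j hij
        have := hdσ i.succ j.succ (Fin.succ_lt_succ_iff.2 hij)
        have ea : (d i.succ : ℝ) ≤ σ' * d j.succ := this.trans (mlr (min_le_left _ _) (by positivity))
        push_cast
        calc (r:ℝ) * d i.succ ≤ r * (σ' * d j.succ) := by gcongr
          _ = _ := by ring) hV10 (by
        intro E hE h
        rw [hV1c] at hE
        have := hVs _ hE h.succ
        simpa using this) (by positivity) (by
        refine le_trans ?_ hVn
        refine le_trans ?_ (nrm_sub V (fun E => Finsupp.cons ex E) (Finsupp.cons_right_injective ex) V1.support)
        simp [nrm, absZ_apply, hV1c]) (by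
        intro h; push_cast; have := hDm h.succ; gcongr) (by
        intro h
        have hw := hht h.succ
        push_cast
        have ea : C0' * (A + (m+4) * Dm) ≤ d h.succ * (β h.succ).ht := by
          refine le_trans ?_ hw
          have ee : 0 ≤ (fc S * (m+5) + 1) / θ' := by positivity
          have el : A + (m+4) * Dm ≤ (m+4) * (A + Dm) := by
            have : (0:ℝ) ≤ m := by positivity
            nlinarith
          calc C0' * (A + (m+4) * Dm) ≤ C0' * ((m+4) * (A + Dm)) := by gcongr
            _ = C0' * (m+4) * (A + Dm) := by ring
            _ ≤ _ := by gcongr; linarith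
        calc C0' * (r * (A + (m+3)*Dm) + r * Dm) = r * (C0' * (A + (m+4)*Dm)) := by ring
          _ ≤ r * (d h.succ * (β h.succ).ht) := by gcongr
          _ = _ := by ring)
    have hE'U : (shift (b ∘ Fin.succ) UK).coeff E' ≠ 0 := by
      rw [hV1K, map_mul] at hE'
      have : shift (fun h : Fin m => (β h.succ).val) (C (q (W.coeff (single 0 ex)))) = C (q (W.coeff (single 0 ex))) := by
        simp [shift]
      rw [this, coeff_C_mul] at hE'
      exact right_ne_zero_of_mul hE'
    set V0 : Polynomial ℤ := up ℤ (∑ j ∈ range (r * d 0 + 1), monomial (single 0 j) (V.coeff (Finsupp.cons j ez))) with hV0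
    have hV0c : ∀ j, V0.coeff j = V.coeff (Finsupp.cons j ez) := by
      intro j
      rw [hV0, coeff_up, coeff_sum]
      simp only [coeff_monomial]
      by_cases hj : j ∈ range (r * d 0 + 1)
      · rw [sum_eq_single j]
        · simp
        · intro k _ hk; rw [if_neg]; intro h; exact hk (single_injective _ h)
        · intro h; exact absurd hj h
      · rw [sum_eq_zero]
        · by_contra h
          have := hVs _ (Ne.symm h) 0
          simp at this hj; omega
        · intro k hk; rw [if_neg]; intro h
          rw [single_injective _ h] at hk; exact hj hk
    have hV0K : V0.map (icr K) = Polynomial.C (q (U.coeff ez)) * up K WK := by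
      ext j
      rw [Polynomial.coeff_map, hV0c, Polynomial.coeff_C_mul, coeff_up, coeff_map, ← map_mul]
      have := hcoefV (Finsupp.cons j ez)
      simp only [tail_cons, cons_zero] at this
      rw [← this]
      simp
    have hV00 : V0 ≠ 0 := by
      intro h
      have hw := hV0c ex
      have := hcoefV (Finsupp.cons ex ez)
      rw [← hw, h] at this
      simp only [tail_cons, cons_zero, Polynomial.coeff_zero, Int.cast_zero] at this
      exact mul_ne_zero hE1 hE2 this.symm
    have hqU : q (U.coeff ez) ≠ 0 := (map_ne_zero q).2 hE1
    set P := (up K WK).comp (Polynomial.X + Polynomial.C (b 0)) with hP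
    have hP0 : P ≠ 0 := by
      intro h
      rw [hP, Polynomial.comp_eq_zero_iff] at h
      rcases h with h | h
      · apply hWK; ext E
        have : E = single 0 (E 0) := by
          refine Finsupp.ext fun i => ?_; rw [Subsingleton.elim i 0]; simp
        rw [this, ← coeff_up, h]; simp
      · have := congrArg Polynomial.natDegree h.2
        simp at this
    set ab := P.natTrailingDegree with he0
    have hPe : P.coeff ab ≠ 0 := by
      have := Polynomial.trailingCoeff_nonzero_iff_nonzero.2 hP0
      exact this
    have hmain := uni_main Φ V0 hV00 (r * d 0) (by
        rw [Polynomial.natDegree_le_iff_coeff_eq_zero]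
        intro N hN
        rw [hV0c]
        by_contra h
        have := hVs _ h 0
        simp at this; omega) (exp (r * (A + (m+3) * Dm))) (by
        refine le_trans ?_ hVn
        refine le_trans ?_ (nrm_sub (τ := Fin 1) V (fun E => Finsupp.cons (E 0) ez) (by
          intro a c hac
          have := DFunLike.congr_fun hac 0
          simp at this
          refine Finsupp.ext fun i => ?_; rw [Subsingleton.elim i 0]; exact this) (V0.support.image (fun j => single 0 j)))
        rw [sum_image (fun a _ c _ h => single_injective _ h)]
        simp [hV0c])
        (β 0).den (β 0).num (β 0).u (β 0).v (β 0).hden (β 0).hnum (β 0).hu (β 0).hv (β 0).hcop (β 0).hne ab (by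
        intro e he
        rw [hV0K, Polynomial.mul_comp, Polynomial.C_comp, Polynomial.coeff_C_mul]
        have : P.coeff e = 0 := Polynomial.coeff_eq_zero_of_lt_natTrailingDegree he
        change _ * P.coeff e = 0
        rw [this, mul_zero])
    have hlog : ab * (β 0).ht ≤ fc S * (r * (A + (m+5) * Dm)) := by
      have hpos : 0 < (∏ s, max (Φ.w s (β 0).den) (Φ.w s (β 0).num)) := lt_of_lt_of_le one_pos (β 0).one_le
      have hw := log_le_log (pow_pos hpos _) hmain
      rw [log_pow, log_pow, log_mul (by positivity) (by positivity), log_pow, log_exp] at hw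
      refine hw.trans ?_
      have ea : log 4 ≤ 2 := by
        have := Real.log_two_lt_d9
        rw [show (4:ℝ) = 2 ^ 2 by norm_num, log_pow]; push_cast; linarith
      have ee : ((r * d 0 : ℕ) : ℝ) * log 4 ≤ r * Dm * 2 := by
        push_cast
        have := hDm 0
        have : 0 ≤ log 4 := log_nonneg (by norm_num)
        gcongr
      have : (fc S : ℝ) ≥ 0 := by positivity
      gcongr
      linarith
    have he0d : (ab:ℝ) / d 0 < r * θ' := by
      have hd0 : (1:ℝ) ≤ d 0 := mod_cast hd 0
      rw [div_lt_iff₀ (by linarith)]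
      by_contra hge
      push Not at hge
      have hw := hht 0
      have ea : (fc S * (m+5) + 1) / θ' * (A + Dm) ≤ d 0 * (β 0).ht := by
        refine le_trans ?_ hw
        have : 0 ≤ C0' * (m+4) := by positivity
        gcongr; linarith
      have hh := (β 0).ht_nonneg
      have ee : r * ((fc S * (m+5) + 1) * (A + Dm)) ≤ ab * (β 0).ht := by
        calc r * ((fc S * (m+5) + 1) * (A + Dm))
            = r * θ' * ((fc S * (m+5) + 1) / θ' * (A + Dm)) := by field_simp
          _ ≤ r * θ' * (d 0 * (β 0).ht) := by gcongr
          _ = (r * θ' * d 0) * (β 0).ht := by ring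
          _ ≤ _ := by gcongr
      have el := ee.trans hlog
      have eb : (fc S:ℝ) * (r * (A + (m+5) * Dm)) ≤ r * ((fc S * (m+5)) * (A + Dm)) := by
        have : A + (m+5) * Dm ≤ (m+5) * (A + Dm) := by
          have : (0:ℝ) ≤ m := by positivity
          nlinarith
        calc _ ≤ (fc S:ℝ) * (r * ((m+5) * (A + Dm))) := by gcongr
          _ = _ := by ring
      have ew : 0 < r * (A + Dm) := by positivity
      nlinarith
    have hE : (shift b (map (icr K) V)).coeff (Finsupp.cons ab E') ≠ 0 := by
      rw [hVs', coeff_ef_eg, tail_cons, cons_zero, ← coeff_up, up_shift]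
      exact mul_ne_zero hE'U hPe
    have hup : idx d (Finsupp.cons ab E') < r * θ' + r * θ' := by
      have hw : idx d (Finsupp.cons ab E') = ab / d 0 + idx (fun h => d h.succ) E' := by
        simp [idx, Fin.sum_univ_succ]
      have ea : idx (fun h => d h.succ) E' = r * idx (fun h => r * d h.succ) E' := by
        simp only [idx, mul_sum]
        apply sum_congr rfl; intro h _
        have : (d h.succ : ℝ) ≠ 0 := by have := hd h.succ; positivity
        push_cast
        field_simp
      rw [hw, ea]
      have : (r:ℝ) * idx (fun h => r * d h.succ) E' < r * θ' := by gcongr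
      linarith
    have hlow : ∑ j, max 0 (θ1 - J j / d 0) ≤ idx d (Finsupp.cons ab E') := by
      have hdet : shift b (map (icr K) V) =
          (of fun i j => shift b (hD (Finsupp.cons (J j) (I i)) (map (icr K) F))).det := by
        rw [hV, RingHom.map_det, ← AlgHom.coe_toRingHom, RingHom.map_det]
        congr 1
        refine Matrix.ext fun i j => ?_
        simp [hD_map]
      rw [hdet] at hE
      refine idx_det d _ (fun j => max 0 (θ1 - J j / d 0)) ?_ _ hE
      intro i j E hE
      simp only [of_apply] at hE
      rw [← hD_shift, coeff_hD] at hE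
      have hw := hcon _ (right_ne_zero_of_mul hE)
      rw [idx_add] at hw
      have ea : idx d (Finsupp.cons (J j) (I i)) = J j / d 0 + idx (fun h => d h.succ) (I i) := by
        simp [idx, Fin.sum_univ_succ]
      have ee : idx (fun h => d h.succ) (I i) ≤ θ1 := by
        have hd0 : (1:ℝ) ≤ d 0 := mod_cast hd 0
        have el : ∀ h : Fin m, (I i h : ℝ) / d h.succ ≤ θ1 / d 0 * I i h := by
          intro h
          have eb : (1:ℝ) ≤ d h.succ := mod_cast hd h.succ
          have ew : (d 0 : ℝ) ≤ θ1 * d h.succ := (hdσ 0 h.succ (Fin.succ_pos h)).trans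
            (mlr (min_le_right _ _) (by positivity))
          rw [div_le_iff₀ (by linarith), div_mul_eq_mul_div, div_mul_eq_mul_div, le_div_iff₀ (by linarith)]
          have : (0:ℝ) ≤ I i h := by positivity
          nlinarith
        calc idx (fun h => d h.succ) (I i) ≤ ∑ h, θ1 / d 0 * I i h := sum_le_sum fun h _ => el h
          _ = θ1 / d 0 * ((∑ h, I i h : ℕ) : ℝ) := by rw [← mul_sum]; push_cast; rfl
          _ ≤ θ1 / d 0 * d 0 := by
            have aa : ∑ h, I i h ≤ d 0 := by have := hI i; omega
            have : ((∑ h, I i h : ℕ) : ℝ) ≤ d 0 := mod_cast aa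
            gcongr
          _ = θ1 := by field_simp
      apply max_le (idx_nonneg d E)
      linarith
    have := sum_low r (d 0) (hd 0) hr2 θ1 hθ1p hθ1b J hJi hJr
    have : (r:ℝ) * θ1 ^ 2 / 8 = r * θ' + r * θ' := by rw [hθ']; ring
    linarith
end roth
end
section
open MvPolynomial
section LB
variable {A : Type} [CommRing A] {σ τ : Type} [Fintype σ] [Fintype τ]
def wt (a : σ → ℝ) (E : σ →₀ ℕ) : ℝ := ∑ i, a i * E i
lemma wt_add (a : σ → ℝ) (E F : σ →₀ ℕ) : wt a (E + F) = wt a E + wt a F := by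
  simp [wt, mul_add, sum_add_distrib]
lemma wt_zero (a : σ → ℝ) : wt a 0 = 0 := by simp [wt]
lemma wt_single [DecidableEq σ] (a : σ → ℝ) (i : σ) (n : ℕ) : wt a (single i n) = a i * n := by
  rw [wt, sum_eq_single i]
  · simp
  · intro j _ hj; rw [Finsupp.single_eq_of_ne hj]; simp
  · simp
def LB (a : σ → ℝ) (f : MP σ A) (c : ℝ) : Prop := ∀ E, f.coeff E ≠ 0 → c ≤ wt a E
lemma LB.mono {a : σ → ℝ} {f : MP σ A} {c c' : ℝ} (h : LB a f c) (hc : c' ≤ c) : LB a f c' :=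
  fun E hE => hc.trans (h E hE)
lemma LB.add {a : σ → ℝ} {f g : MP σ A} {c : ℝ} (h : LB a f c) (h' : LB a g c) : LB a (f + g) c := by
  intro E hE
  by_cases hw : f.coeff E = 0
  · apply h' E; rw [coeff_add, hw, zero_add] at hE; exact hE
  · exact h E hw
lemma LB.neg {a : σ → ℝ} {f : MP σ A} {c : ℝ} (h : LB a f c) : LB a (-f) c :=
  fun E hE => h E (by simpa using hE)
lemma LB.sub {a : σ → ℝ} {f g : MP σ A} {c : ℝ} (h : LB a f c) (h' : LB a g c) : LB a (f - g) c := by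
  rw [sub_eq_add_neg]; exact h.add h'.neg
lemma LB_zero (a : σ → ℝ) (c : ℝ) : LB a (0 : MP σ A) c := fun E hE => by simp at hE
lemma LB_sum (a : σ → ℝ) {α : Type*} (t : Finset α) (f : α → MP σ A) (c : ℝ)
    (h : ∀ x ∈ t, LB a (f x) c) : LB a (∑ x ∈ t, f x) c := by
  classical
  induction t using Finset.induction_on with
  | empty => simpa using LB_zero a c
  | insert x t hx ih =>
    rw [sum_insert hx]
    exact (h x (mem_insert_self _ _)).add (ih fun y hy => h y (mem_insert_of_mem hy))
lemma LB_monomial (a : σ → ℝ) (E : σ →₀ ℕ) (x : A) : LB a (monomial E x) (wt a E) := by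
  classical
  intro F hF
  rw [coeff_monomial] at hF
  by_cases h : E = F
  · rw [h]
  · simp [h] at hF
lemma LB_C (a : σ → ℝ) (x : A) : LB a (C x) 0 := by
  have := LB_monomial a 0 x; rwa [wt_zero] at this
lemma LB_one (a : σ → ℝ) : LB a (1 : MP σ A) 0 := by
  have := LB_C a (1 : A); rwa [map_one] at this
lemma LB_X (a : σ → ℝ) (i : σ) : LB a (X i : MP σ A) (a i) := by
  classical
  have := LB_monomial a (single i 1) (1 : A)
  rw [wt_single, Nat.cast_one, mul_one] at this; exact this
lemma LB.mul {a : σ → ℝ} {f g : MP σ A} {c c' : ℝ} (h : LB a f c) (h' : LB a g c') :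
    LB a (f * g) (c + c') := by
  classical
  intro E hE
  obtain ⟨x, hx, y, hy, rfl⟩ := mem_add.1 (support_mul _ _ (mem_support_iff.2 hE))
  rw [wt_add]
  exact add_le_add (h x (mem_support_iff.1 hx)) (h' y (mem_support_iff.1 hy))
lemma LB.C_mul {a : σ → ℝ} {f : MP σ A} {c : ℝ} (x : A) (h : LB a f c) : LB a (C x * f) c := by
  have := (LB_C a x).mul h; rwa [zero_add] at this
def Ap (a : σ → ℝ) (f ae : MP σ A) (c : ℝ) : Prop := LB a f c ∧ LB a (f - ae) (c + 1)
lemma Ap.mul {a : σ → ℝ} {f g ae aw : MP σ A} {c c' : ℝ} (h : Ap a f ae c) (h' : Ap a g aw c') :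
    Ap a (f * g) (ae * aw) (c + c') := by
  refine ⟨h.1.mul h'.1, ?_⟩
  have eo : LB a ae c := by
    have := h.1.sub (h.2.mono (by linarith)); rwa [sub_sub_cancel] at this
  have e : f * g - ae * aw = (f - ae) * g + ae * (g - aw) := by ring
  rw [e]
  exact ((h.2.mul h'.1).mono (by linarith)).add ((eo.mul h'.2).mono (by linarith))
lemma Ap_one (a : σ → ℝ) : Ap a (1 : MP σ A) 1 0 := ⟨LB_one a, by rw [sub_self]; exact LB_zero a _⟩
lemma Ap.pow {a : σ → ℝ} {f ae : MP σ A} {c : ℝ} (h : Ap a f ae c) (n : ℕ) :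
    Ap a (f ^ n) (ae ^ n) (c * n) := by
  induction n with
  | zero => simpa using Ap_one a
  | succ n ih =>
    rw [pow_succ, pow_succ]
    have := ih.mul h
    push_cast
    rwa [mul_add, mul_one]
lemma Ap_prod (a : σ → ℝ) {α : Type*} (t : Finset α) (f ae : α → MP σ A) (c : α → ℝ)
    (h : ∀ x ∈ t, Ap a (f x) (ae x) (c x)) : Ap a (∏ x ∈ t, f x) (∏ x ∈ t, ae x) (∑ x ∈ t, c x) := by
  classical
  induction t using Finset.induction_on with
  | empty => simpa using Ap_one a
  | insert x t hx ih =>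
    rw [prod_insert hx, prod_insert hx, sum_insert hx]
    exact (h x (mem_insert_self _ _)).mul (ih fun y hy => h y (mem_insert_of_mem hy))
lemma aeval_eq_sum (g : σ → MP τ A) (f : MP σ A) :
    aeval g f = ∑ E ∈ f.support, C (f.coeff E) * ∏ i, g i ^ E i := by
  rw [aeval_def, eval₂_eq']; rfl
lemma LB_aeval (a : τ → ℝ) (b : σ → ℝ) (g : σ → MP τ A) (f : MP σ A) (c : ℝ)
    (hf : LB b f c) (hg : ∀ i, LB a (g i) (b i)) : LB a (aeval g f) c := by
  rw [aeval_eq_sum]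
  apply LB_sum
  intro E hE
  have hw := Ap_prod a univ (fun i => g i ^ E i) (fun i => g i ^ E i) (fun i => b i * E i)
    (fun i _ => Ap.pow ⟨hg i, by rw [sub_self]; exact LB_zero a _⟩ _)
  exact (hw.1.C_mul _).mono (hf E (mem_support_iff.1 hE))
lemma coeff_aeval_eq (a : τ → ℝ) (b : σ → ℝ) (g aw : σ → MP τ A) (f : MP σ A) (J : τ →₀ ℕ)
    (hg : ∀ i, Ap a (g i) (aw i) (b i)) (hJ : ∀ E, f.coeff E ≠ 0 → wt a J < wt b E + 1) :
    (aeval g f).coeff J = (aeval aw f).coeff J := by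
  rw [aeval_eq_sum, aeval_eq_sum, coeff_sum, coeff_sum]
  apply sum_congr rfl
  intro E hE
  rw [coeff_C_mul, coeff_C_mul]
  congr 1
  have hw := (Ap_prod a univ (fun i => g i ^ E i) (fun i => aw i ^ E i) (fun i => b i * E i)
    (fun i _ => (hg i).pow _)).2
  by_contra hne
  have := hw J (by rw [coeff_sub]; exact sub_ne_zero.2 hne)
  have ea := hJ E (mem_support_iff.1 hE)
  exact absurd ea (not_lt.2 this)
end LB
section lsub
variable {A : Type} [CommRing A] {m : ℕ} {ι : Type} [Fintype ι] [DecidableEq ι]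
def lsub (M : Fin m → Matrix ι ι A) : MP (Fin m × ι) A →ₐ[A] MP (Fin m × ι) A :=
  aeval (fun p => ∑ k, C (M p.1 p.2 k) * X (p.1, k))
lemma lsub_X (M : Fin m → Matrix ι ι A) (p : Fin m × ι) : lsub M (X p) = ∑ k, C (M p.1 p.2 k) * X (p.1, k) := by
  simp [lsub]
lemma lsub_lsub (M N : Fin m → Matrix ι ι A) (f : MP (Fin m × ι) A) :
    lsub N (lsub M f) = lsub (fun h => M h * N h) f := by
  have : (lsub N).comp (lsub M) = lsub (fun h => M h * N h) := by
    apply algHom_ext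
    intro p
    rw [AlgHom.comp_apply, lsub_X, lsub_X, map_sum]
    simp only [map_mul, ← algebraMap_eq, AlgHom.commutes, lsub_X, Matrix.mul_apply, map_sum,
      mul_sum, sum_mul]
    rw [sum_comm]
    simp only [mul_assoc]
  exact DFunLike.congr_fun this f
lemma lsub_one (f : MP (Fin m × ι) A) : lsub (fun _ => (1 : Matrix ι ι A)) f = f := by
  have : lsub (fun _ => (1 : Matrix ι ι A)) = AlgHom.id A (MP (Fin m × ι) A) := by
    apply algHom_ext
    intro p
    rw [lsub_X, sum_eq_single p.2]
    · simp
    · intro k _ hk; rw [Matrix.one_apply_ne hk.symm]; simp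
    · simp
  rw [this]; rfl
def MH (d : Fin m → ℕ) (f : MP (Fin m × ι) A) : Prop :=
  ∀ E, f.coeff E ≠ 0 → ∀ h, ∑ k, E (h, k) = d h
lemma MH_lsub (d : Fin m → ℕ) (f : MP (Fin m × ι) A) (hf : MH d f) (M : Fin m → Matrix ι ι A) :
    MH d (lsub M f) := by
  classical
  intro E hE h
  have key : ∀ ε : ℝ, ε * d h ≤ wt (fun p : Fin m × ι => if p.1 = h then ε else 0) E := by
    intro ε
    refine LB_aeval _ (fun p : Fin m × ι => if p.1 = h then ε else 0) _ f _ ?_ ?_ E hE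
    · intro E' hE'
      rw [wt, sum_prod_type, sum_eq_single h]
      · simp [← hf E' hE' h, mul_sum]
      · intro b _ hb; simp [hb]
      · simp
    · intro p
      apply LB_sum
      intro k _
      have := LB_X (A := A) (fun p : Fin m × ι => if p.1 = h then ε else 0) (p.1, k)
      exact this.C_mul _
  have e : ∀ ε : ℝ, wt (fun p : Fin m × ι => if p.1 = h then ε else 0) E = ε * ((∑ k, E (h, k) : ℕ) : ℝ) := by
    intro ε
    rw [wt, sum_prod_type, sum_eq_single h]
    · simp [mul_sum]
    · intro b _ hb; simp [hb]
    · simp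
  have hw := key 1
  have ea := key (-1)
  rw [e] at hw ea
  have : ((∑ k, E (h, k) : ℕ) : ℝ) = d h := by linarith
  exact_mod_cast this
lemma lsub_mem {K : Type} [Field K] (R : Subring K) (P : MP (Fin m × ι) ℤ) (M : Fin m → Matrix ι ι K)
    (hM : ∀ h i j, M h i j ∈ R) (E) : (lsub M (map (icr K) P)).coeff E ∈ R := by
  let M' : Fin m → Matrix ι ι R := fun h i j => ⟨M h i j, hM h i j⟩
  have : lsub M (map (icr K) P) = map R.subtype (lsub M' (map (icr R) P)) := by
    induction P using induction_on with
    | C a => simp only [map_C, ← algebraMap_eq, AlgHom.commutes]; simp [algebraMap_eq]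
    | add p q hp hq => simp only [map_add, hp, hq]
    | mul_X p i hp =>
      simp only [map_mul, hp, map_X, lsub_X, map_sum]
      simp [M']
  rw [this, coeff_map]
  exact (Subtype.property _)
end lsub
end
section
open MvPolynomial
section cheb
variable {ι : Type} [Fintype ι] [DecidableEq ι] {m : ℕ}
lemma mean0 (n : ℕ) (hn : 1 ≤ n) (k : ι) :
    ∑ j ∈ piAntidiag (univ : Finset ι) n, ((j k : ℝ) / n - 1 / fc ι) = 0 := by
  have hsym : ∀ k' : ι, ∑ j ∈ piAntidiag (univ : Finset ι) n, (j k' : ℝ) = ∑ j ∈ piAntidiag (univ : Finset ι) n, (j k : ℝ) := by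
    intro k'
    have hm : ∀ j ∈ piAntidiag (univ : Finset ι) n, j ∘ Equiv.swap k k' ∈ piAntidiag (univ : Finset ι) n := by
      intro j hj
      rw [mem_piAntidiag] at hj ⊢
      refine ⟨?_, by simp⟩
      rw [← hj.1]
      exact Equiv.sum_comp (Equiv.swap k k') j
    refine sum_bij' (fun j _ => j ∘ Equiv.swap k k') (fun j _ => j ∘ Equiv.swap k k') hm hm ?_ ?_ ?_
    · intro j _; ext i; simp
    · intro j _; ext i; simp
    · intro j _; simp
  have hM : (fc ι : ℝ) ≠ 0 := by
    have : Nonempty ι := ⟨k⟩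
    exact_mod_cast Fintype.card_ne_zero
  have hn' : (n : ℝ) ≠ 0 := by positivity
  have hw : (fc ι : ℝ) * ∑ j ∈ piAntidiag (univ : Finset ι) n, (j k : ℝ) = n * (piAntidiag (univ : Finset ι) n).card := by
    calc _ = ∑ k' : ι, ∑ j ∈ piAntidiag (univ : Finset ι) n, (j k' : ℝ) := by
          rw [sum_congr rfl fun k' _ => hsym k']; simp
      _ = ∑ j ∈ piAntidiag (univ : Finset ι) n, ∑ k' : ι, (j k' : ℝ) := sum_comm
      _ = ∑ j ∈ piAntidiag (univ : Finset ι) n, (n:ℝ) := by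
          apply sum_congr rfl; intro j hj
          rw [mem_piAntidiag] at hj
          rw [← hj.1]; push_cast; rfl
      _ = _ := by simp [mul_comm]
  rw [sum_sub_distrib, ← sum_div, sum_const, nsmul_eq_mul]
  field_simp
  linarith
def JJ (ι : Type) [Fintype ι] [DecidableEq ι] {m : ℕ} (d : Fin m → ℕ) : Finset (Fin m → ι → ℕ) :=
  piFinset (fun h => piAntidiag univ (d h))
lemma mem_JJ (d : Fin m → ℕ) (J : Fin m → ι → ℕ) : J ∈ JJ ι d ↔ ∀ h, ∑ k, J h k = d h := by
  simp [JJ, mem_piAntidiag]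
lemma cheb (d : Fin m → ℕ) (hd : ∀ h, 1 ≤ d h) (k : ι) (ε : ℝ) (hε : 0 < ε) :
    (((JJ ι d).filter fun J => ¬ |∑ h, (J h k : ℝ) / d h - m / fc ι| ≤ ε * m).card : ℝ) * (ε ^ 2 * m)
      ≤ (JJ ι d).card := by
  rcases Nat.eq_zero_or_pos m with rfl | hm
  · simp
  have hm' : (0:ℝ) < m := mod_cast hm
  let x : Fin m → (ι → ℕ) → ℝ := fun h j => (j k : ℝ) / d h - 1 / fc ι
  have hM : (1:ℝ) ≤ fc ι := by
    have : Nonempty ι := ⟨k⟩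
    exact_mod_cast Fintype.card_pos
  have hx1 : ∀ h, ∀ J ∈ JJ ι d, x h (J h) * x h (J h) ≤ 1 := by
    intro h J hJ
    rw [mem_JJ] at hJ
    have hw : J h k ≤ d h := by rw [← hJ h]; exact single_le_sum (f := J h) (by simp) (mem_univ k)
    have hd' : (1:ℝ) ≤ d h := mod_cast hd h
    have ea : (J h k : ℝ) / d h ≤ 1 := by rw [div_le_one (by linarith)]; exact_mod_cast hw
    have ee : 0 ≤ (J h k : ℝ) / d h := by positivity
    have el : 1 / (fc ι : ℝ) ≤ 1 := by rw [div_le_one (by linarith)]; exact hM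
    have eb : 0 ≤ 1 / (fc ι : ℝ) := by positivity
    simp only [x]
    nlinarith
  have hcross : ∀ h h', h ≠ h' → ∑ J ∈ JJ ι d, x h (J h) * x h' (J h') = 0 := by
    intro h h' hne
    let f : Fin m → (ι → ℕ) → ℝ := fun i j => if i = h then x h j else if i = h' then x h' j else 1
    have e : ∀ J : Fin m → ι → ℕ, x h (J h) * x h' (J h') = ∏ i, f i (J i) := by
      intro J
      rw [Fintype.prod_eq_mul h h' hne]
      · simp [f, hne.symm]
      · intro i hi; simp [f, hi.1, hi.2]
    simp_rw [e]
    rw [JJ, ← prod_univ_sum]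
    apply prod_eq_zero (mem_univ h)
    simp only [f, if_true]
    exact mean0 (d h) (hd h) k
  have hsq : ∑ J ∈ JJ ι d, (∑ h, x h (J h)) ^ 2 ≤ m * (JJ ι d).card := by
    calc _ = ∑ J ∈ JJ ι d, ∑ h, ∑ h', x h (J h) * x h' (J h') := by
          apply sum_congr rfl; intro J _; rw [sq, sum_mul_sum]
      _ = ∑ h, ∑ h', ∑ J ∈ JJ ι d, x h (J h) * x h' (J h') := by
          rw [sum_comm]
          apply sum_congr rfl; intro h _; rw [sum_comm]
      _ = ∑ h, ∑ J ∈ JJ ι d, x h (J h) * x h (J h) := by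
          apply sum_congr rfl; intro h _
          rw [sum_eq_single h]
          · intro h' _ hne; exact hcross h h' hne.symm
          · simp
      _ ≤ ∑ h : Fin m, ∑ J ∈ JJ ι d, (1:ℝ) := sum_le_sum fun h _ => sum_le_sum fun J hJ => hx1 h J hJ
      _ = _ := by simp
  have hxs : ∀ J : Fin m → ι → ℕ, ∑ h, x h (J h) = ∑ h, (J h k : ℝ) / d h - m / fc ι := by
    intro J; simp [x, sum_sub_distrib, div_eq_mul_inv]
  set bad := (JJ ι d).filter fun J => ¬ |∑ h, (J h k : ℝ) / d h - m / fc ι| ≤ ε * m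
  have ea : (bad.card : ℝ) * (ε * m) ^ 2 ≤ m * (JJ ι d).card := by
    refine le_trans ?_ hsq
    calc (bad.card : ℝ) * (ε * m) ^ 2 = ∑ J ∈ bad, (ε * m) ^ 2 := by simp
      _ ≤ ∑ J ∈ bad, (∑ h, x h (J h)) ^ 2 := by
          apply sum_le_sum; intro J hJ
          have := (mem_filter.1 hJ).2
          push Not at this
          rw [hxs, ← sq_abs (∑ h, (J h k : ℝ) / d h - m / fc ι)]
          exact pow_le_pow_left₀ (by positivity) this.le 2
      _ ≤ _ := sum_le_sum_of_subset_of_nonneg (filter_subset _ _) fun _ _ _ => sq_nonneg _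
  have : (bad.card : ℝ) * (ε ^ 2 * m) * m ≤ (JJ ι d).card * m := by nlinarith
  exact le_of_mul_le_mul_right this hm'
end cheb
section aux
variable {K : Type} [Field K] [CharZero K] {S : Type} [Fintype S] {ι : Type} [Fintype ι] [DecidableEq ι]
lemma fin_count (Φ : PlaceSys K S) : ∃ C : ℝ, ∃ κ : ℕ, 1 ≤ C ∧ ∀ B : ℝ, 1 ≤ B → ∃ T : Finset K,
    (∀ x, x ∈ T ↔ x ∈ Φ.R ∧ ∀ s, Φ.w s x ≤ B) ∧ (T.card : ℝ) ≤ C * B ^ κ := by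
  obtain ⟨C, κ, hC, h⟩ := Φ.count
  refine ⟨C, κ, hC, fun B hB => ?_⟩
  have hfin : {x : K | x ∈ Φ.R ∧ ∀ s, Φ.w s x ≤ B}.Finite := by
    by_contra hinf
    obtain ⟨t, ht, hc⟩ := Set.Infinite.exists_subset_card_eq hinf (⌈C * B ^ κ⌉₊ + 1)
    have hw := h B hB t (fun x hx => ht hx)
    have ea := Nat.le_ceil (C * B ^ κ)
    rw [hc] at hw; push_cast at hw; linarith
  refine ⟨hfin.toFinset, fun x => by simp, h B hB _ (fun x hx => by simpa using hx)⟩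
lemma nrm_MH {A : Type} [CommRing A] [IsDomain A] (w : AbsoluteValue A ℝ) {m : ℕ} (d : Fin m → ℕ) (c : ℝ) (f : MP (Fin m × ι) A) (hf : MH d f) :
    nrm w (fun _ => c) f = c ^ (∑ h, d h) * nrm w 1 f := by
  rw [nrm, nrm, mul_sum]
  apply sum_congr rfl
  intro E hE
  have : ∑ h, d h = ∑ p, E p := by
    rw [sum_prod_type]
    exact sum_congr rfl fun h _ => (hf E (mem_support_iff.1 hE) h).symm
  rw [prod_pow_eq_pow_sum, this]; simp; ring
def exf {m : ℕ} (J : Fin m → ι → ℕ) : Fin m × ι →₀ ℕ :=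
  Finsupp.equivFunOnFinite.symm (fun p => J p.1 p.2)
lemma exf_apply {m : ℕ} (J : Fin m → ι → ℕ) (h k) : exf J (h, k) = J h k := rfl
lemma exf_inj {m : ℕ} : Injective (exf : (Fin m → ι → ℕ) → _) := by
  intro a b hab; funext h k; exact DFunLike.congr_fun hab (h, k)
lemma exf_surj {m : ℕ} (E : Fin m × ι →₀ ℕ) : exf (fun h k => E (h, k)) = E := by
  ext ⟨h, k⟩; rfl
lemma aux_num (C N H c : ℝ) (κ : ℕ) (hC : 1 ≤ C) (hN : 1 ≤ N) (hc : 1 ≤ c) (hH : 2 * C * N * c ≤ H) :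
    C * (N * H * c) ^ κ ≤ H ^ (2 * κ + 1) := by
  have hw : 1 ≤ N * c := one_le_mul_of_one_le_of_one_le hN hc
  have ea : C ≤ C * (N * c) := le_mul_of_one_le_right (by linarith) hw
  have ee : N * c ≤ C * (N * c) := le_mul_of_one_le_left (by linarith) hC
  have et : C ≤ H := by linarith
  have ed : N * c ≤ H := by linarith
  have ev : 0 ≤ H := by linarith
  calc C * (N * H * c) ^ κ = C * ((N * c) * H) ^ κ := by ring
    _ ≤ H * (H * H) ^ κ := by gcongr
    _ = _ := by ring
lemma aux_num2 (C N H c : ℝ) (D M : ℕ) (hC : 1 ≤ C) (hc : 1 ≤ c) (hD : 1 ≤ D) (ax : 0 ≤ N) (hN : N ≤ (2 ^ M) ^ D)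
    (hH : H ≤ 3 * C * N * c ^ D) : N * H ≤ (3 * C * (2 ^ M * 2 ^ M) * c) ^ D := by
  have h3C : 3 * C ≤ (3 * C) ^ D := le_self_pow₀ (by linarith) (by omega)
  calc N * H ≤ N * (3 * C * N * c ^ D) := by gcongr
    _ = (3 * C) * (N * N) * c ^ D := by ring
    _ ≤ (3 * C) ^ D * ((2 ^ M) ^ D * (2 ^ M) ^ D) * c ^ D := by gcongr
    _ = _ := by rw [← mul_pow, ← mul_pow, ← mul_pow]
set_option maxHeartbeats 2000000 in
lemma aux_poly [Nonempty ι] (Φ : PlaceSys K S) (𝓘 : S → Matrix ι ι K) (hI : ∀ s i j, 𝓘 s i j ∈ Φ.R) (ε : ℝ) (hε : 0 < ε) :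
    ∃ m : ℕ, 1 ≤ m ∧ ∃ ec : ℝ, 1 ≤ ec ∧ ∀ d : Fin m → ℕ, (∀ h, 1 ≤ d h) →
      ∃ P : MP (Fin m × ι) ℤ, P ≠ 0 ∧ MH d P ∧ nrm absZ 1 P ≤ ec ^ (∑ h, d h) ∧
        ∀ s J, (lsub (fun _ => 𝓘 s) (map (icr K) P)).coeff J ≠ 0 →
          ∀ k, |∑ h, (J (h, k) : ℝ) / d h - m / fc ι| ≤ ε * m := by
  classical
  obtain ⟨C, κ, hC, hcount⟩ := fin_count Φ
  set M := fc ι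
  set m := ⌈(fc S * M * (2 * κ + 2) : ℕ) / ε ^ 2⌉₊ + 1 with hm
  have hmε : ((fc S * M * (2 * κ + 2) : ℕ) : ℝ) ≤ ε ^ 2 * m := by
    have := Nat.le_ceil (((fc S * M * (2 * κ + 2) : ℕ) : ℝ) / ε ^ 2)
    rw [div_le_iff₀ (by positivity)] at this
    rw [hm]; push_cast at this ⊢; nlinarith [sq_nonneg ε]
  have hm1 : 1 ≤ m := by omega
  clear_value m
  set em : ℝ := 1 + ∑ s', ∑ s, ∑ i, ∑ j, Φ.w s' (𝓘 s i j) with bi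
  have hc01 : 1 ≤ em := by
    have : 0 ≤ ∑ s', ∑ s, ∑ i, ∑ j, Φ.w s' (𝓘 s i j) :=
      sum_nonneg fun _ _ => sum_nonneg fun _ _ => sum_nonneg fun _ _ => sum_nonneg fun _ _ => (Φ.w _).nonneg _
    linarith
  have hc0s : ∀ s' s i, ∑ j, Φ.w s' (𝓘 s i j) ≤ em := by
    intro s' s i
    have hw : ∑ j, Φ.w s' (𝓘 s i j) ≤ ∑ i, ∑ j, Φ.w s' (𝓘 s i j) :=
      single_le_sum (f := fun i => ∑ j, Φ.w s' (𝓘 s i j)) (fun _ _ => sum_nonneg fun _ _ => (Φ.w _).nonneg _) (mem_univ i)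
    have ea : ∑ i, ∑ j, Φ.w s' (𝓘 s i j) ≤ ∑ s, ∑ i, ∑ j, Φ.w s' (𝓘 s i j) :=
      single_le_sum (f := fun s => ∑ i, ∑ j, Φ.w s' (𝓘 s i j)) (fun _ _ => sum_nonneg fun _ _ => sum_nonneg fun _ _ => (Φ.w _).nonneg _) (mem_univ s)
    have ee : ∑ s, ∑ i, ∑ j, Φ.w s' (𝓘 s i j) ≤ ∑ s', ∑ s, ∑ i, ∑ j, Φ.w s' (𝓘 s i j) :=
      single_le_sum (f := fun s' => ∑ s, ∑ i, ∑ j, Φ.w s' (𝓘 s i j)) (fun _ _ => sum_nonneg fun _ _ => sum_nonneg fun _ _ => sum_nonneg fun _ _ => (Φ.w _).nonneg _) (mem_univ s')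
    linarith
  clear_value em
  refine ⟨m, hm1, 3 * C * (2 ^ M * 2 ^ M) * em, ?_, ?_⟩
  · have ea : (1:ℝ) ≤ 2 ^ M := one_le_pow₀ (by norm_num)
    have ee : (1:ℝ) ≤ 2 ^ M * 2 ^ M := one_le_mul_of_one_le_of_one_le ea ea
    exact one_le_mul_of_one_le_of_one_le (one_le_mul_of_one_le_of_one_le (by linarith) ee) hc01
  intro d hd
  set Dt := ∑ h, d h with hDt
  have hDt1 : 1 ≤ Dt := by
    refine (hd ⟨0, by omega⟩).trans (single_le_sum (f := d) (by simp) (mem_univ _))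
  set N := (JJ ι d).card with hN
  have hNup : N ≤ 2 ^ (M * Dt) := by
    rw [hN, JJ, card_piFinset, hDt, mul_sum, ← prod_pow_eq_pow_sum]
    apply prod_le_prod' ; intro h _
    have : piAntidiag (univ : Finset ι) (d h) ⊆ piFinset (fun _ => range (d h + 1)) := by
      intro j hj
      rw [mem_piAntidiag] at hj
      rw [Fintype.mem_piFinset]; intro k
      rw [mem_range, ← hj.1]
      have := single_le_sum (f := j) (by simp) (mem_univ k)
      simp at this ⊢; omega
    refine (card_le_card this).trans ?_
    rw [card_piFinset]; simp only [card_range, prod_const, card_univ]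
    rw [mul_comm M, pow_mul]
    exact Nat.pow_le_pow_left (Nat.lt_two_pow_self) _
  have hN1 : 1 ≤ N := by
    rw [hN, one_le_card]
    let en : ι := Classical.arbitrary ι
    exact ⟨fun h => Pi.single en (d h), by rw [mem_JJ]; intro h; simp⟩
  have hN1' : (1:ℝ) ≤ N := mod_cast hN1
  have hc0D : 1 ≤ em ^ Dt := one_le_pow₀ hc01
  set H := ⌈2 * C * N * em ^ Dt⌉₊ with hH
  have bo : 2 * C * N * em ^ Dt ≤ H := Nat.le_ceil _
  have hCN : 1 ≤ C * N * em ^ Dt := one_le_mul_of_one_le_of_one_le (one_le_mul_of_one_le_of_one_le hC hN1') hc0D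
  have hH2 : (H:ℝ) ≤ 3 * C * N * em ^ Dt := by
    have := (Nat.ceil_lt_add_one (a := 2 * C * N * em ^ Dt) (by linarith)).le
    linarith
  have hHgt : (1:ℝ) < H := by linarith
  clear_value H
  let good : (Fin m → ι → ℕ) → Prop := fun J => ∀ k, |∑ h, (J h k : ℝ) / d h - m / fc ι| ≤ ε * m
  let bad := (JJ ι d).filter fun J => ¬ good J
  have hbad : fc S * bad.card * (2 * κ + 2) ≤ N := by
    have hw : bad.card ≤ ∑ k : ι, ((JJ ι d).filter fun J => ¬ |∑ h, (J h k : ℝ) / d h - m / fc ι| ≤ ε * m).card := by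
      refine le_trans (card_le_card ?_) card_biUnion_le
      intro J hJ
      obtain ⟨hw, ea⟩ := mem_filter.1 hJ
      simp only [good, not_forall] at ea
      obtain ⟨k, hk⟩ := ea
      exact mem_biUnion.2 ⟨k, mem_univ _, mem_filter.2 ⟨hw, hk⟩⟩
    have ea : (bad.card : ℝ) * (ε ^ 2 * m) ≤ M * N := by
      calc _ ≤ ((∑ k : ι, ((JJ ι d).filter fun J => ¬ |∑ h, (J h k : ℝ) / d h - m / fc ι| ≤ ε * m).card : ℕ) : ℝ) * (ε ^ 2 * m) :=
            mlr (mod_cast hw) (by positivity)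
        _ = ∑ k : ι, (((JJ ι d).filter fun J => ¬ |∑ h, (J h k : ℝ) / d h - m / fc ι| ≤ ε * m).card : ℝ) * (ε ^ 2 * m) := by
            push_cast; rw [sum_mul]
        _ ≤ ∑ k : ι, (N : ℝ) := sum_le_sum fun k _ => cheb d hd k ε hε
        _ = _ := by simp [M]
    have ee : (bad.card : ℝ) * ((fc S * M * (2 * κ + 2) : ℕ) : ℝ) ≤ M * N :=
      (mll (by assumption) (Nat.cast_nonneg _)).trans ea
    have hM : 0 < M := Fintype.card_pos
    have el : bad.card * (fc S * M * (2 * κ + 2)) ≤ M * N := mod_cast ee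
    apply Nat.le_of_mul_le_mul_left _ hM
    linarith
  set b := fc S * bad.card with hb
  clear_value b N Dt
  let Po : (↥(JJ ι d) → ℤ) → MP (Fin m × ι) ℤ := fun p => ∑ J, monomial (exf J.1) (p J)
  have hPoc : ∀ p (J : ↥(JJ ι d)), (Po p).coeff (exf J.1) = p J := by
    intro p J
    simp only [Po, coeff_sum, coeff_monomial]
    rw [sum_eq_single J]
    · simp
    · intro J' _ hne; rw [if_neg]; intro h; exact hne (Subtype.ext (exf_inj h))
    · simp
  have hPoMH : ∀ p, MH d (Po p) := by
    intro p E hE h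
    simp only [Po, coeff_sum, coeff_monomial] at hE
    obtain ⟨J, _, hJ⟩ := exists_ne_zero_of_sum_ne_zero hE
    have : exf J.1 = E := by by_contra h'; simp [h'] at hJ
    rw [← this]
    exact (mem_JJ d J.1).1 J.2 h
  have hPon : ∀ p, (∀ J, |(p J : ℝ)| ≤ H) → nrm absZ 1 (Po p) ≤ N * H := by
    intro p hp
    refine (nrm_sum _ _ (fun _ => zero_le_one) _ _).trans ?_
    calc _ ≤ ∑ J : ↥(JJ ι d), (H:ℝ) := by
          apply sum_le_sum; intro J _
          rw [nrm_monomial]; simpa [absZ_apply] using hp J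
      _ = _ := by simp [hN]
  have hMHK : ∀ p s, MH d (lsub (fun _ => 𝓘 s) (map (icr K) (Po p))) := by
    intro p s
    apply MH_lsub
    intro E hE
    apply hPoMH p E
    intro eo; apply hE; rw [coeff_map, eo, map_zero]
  set B : ℝ := N * H * em ^ Dt with hB
  have hB1 : 1 ≤ B := one_le_mul_of_one_le_of_one_le (one_le_mul_of_one_le_of_one_le hN1' hHgt.le) hc0D
  obtain ⟨T, hT, hTc⟩ := hcount B hB1
  have hval : ∀ p, (∀ J, |(p J : ℝ)| ≤ H) → ∀ s E, (lsub (fun _ => 𝓘 s) (map (icr K) (Po p))).coeff E ∈ T := by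
    intro p hp s E
    rw [hT]
    refine ⟨lsub_mem Φ.R (Po p) _ (fun h i j => hI s i j) E, fun s' => ?_⟩
    have hw := coeff_le_nrm (Φ.w s') 1 (fun _ => zero_le_one) (lsub (fun _ => 𝓘 s) (map (icr K) (Po p))) E
    simp only [Pi.one_apply, one_pow, prod_const_one, mul_one] at hw
    refine hw.trans ?_
    have ea := nrm_aeval (Φ.w s') 1 (fun _ => zero_le_one) (fun _ : Fin m × ι => em) (fun p : Fin m × ι => ∑ k, MvPolynomial.C (𝓘 s p.2 k) * X (p.1, k)) (by
      intro p
      refine (nrm_sum _ _ (fun _ => zero_le_one) _ _).trans ?_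
      refine le_trans ?_ (hc0s s' s p.2)
      apply sum_le_sum; intro k _
      refine (nrm_mul _ _ (fun _ => zero_le_one) _ _).trans ?_
      rw [nrm_C, nrm_X]; simp) (map (icr K) (Po p))
    refine ea.trans ((nrm_map_int _ _ (by intro i; linarith) _).trans ?_)
    rw [nrm_MH absZ d em _ (hPoMH p), hB, ← hDt, mul_comm (em ^ Dt)]
    exact mlr (hPon p hp) (by positivity)
  let f : (↥(JJ ι d) → Fin H) → (S × ↥bad → ↥T) := fun p x =>
    ⟨(lsub (fun _ => 𝓘 x.1) (map (icr K) (Po fun J => ((p J : ℕ) : ℤ)))).coeff (exf x.2.1),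
      hval _ (fun J => by
        have := (p J).2
        have ea : ((p J : ℕ) : ℝ) ≤ H := mod_cast this.le
        simpa using ea) _ _⟩
  have hcard : fc (S × ↥bad → ↥T) < fc (↥(JJ ι d) → Fin H) := by
    rw [card_fun, card_fun, card_prod, card_coe, card_coe, card_coe,
      Fintype.card_fin, ← hb, ← hN]
    have hw : (T.card : ℝ) ≤ (H:ℝ) ^ (2 * κ + 1) := hTc.trans (aux_num C N H _ κ hC hN1' hc0D bo)
    have ea : (T.card : ℝ) ^ b ≤ (H:ℝ) ^ ((2 * κ + 1) * b) := by
      rw [pow_mul]; exact pow_le_pow_left₀ (Nat.cast_nonneg _) hw _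
    have ee : (H:ℝ) ^ ((2 * κ + 1) * b) < (H:ℝ) ^ N := by
      apply pow_lt_pow_right₀ hHgt
      rcases Nat.eq_zero_or_pos b with eo | eo
      · rw [eo]; omega
      · have : (2 * κ + 1) * b < b * (2 * κ + 2) := by linarith only [eo]
        omega
    have el := ea.trans_lt ee
    exact_mod_cast el
  obtain ⟨p, q, hpq, hfpq⟩ := Fintype.exists_ne_map_eq_of_card_lt f hcard
  set P := Po (fun J => ((p J : ℕ) : ℤ) - ((q J : ℕ) : ℤ)) with hP
  have hPsub : P = Po (fun J => ((p J : ℕ) : ℤ)) - Po (fun J => ((q J : ℕ) : ℤ)) := by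
    simp only [hP, Po, ← sum_sub_distrib, map_sub]
  refine ⟨P, ?_, hPoMH _, ?_, ?_⟩
  · intro eo
    apply hpq; funext J
    have := hPoc (fun J => ((p J : ℕ) : ℤ) - ((q J : ℕ) : ℤ)) J
    rw [← hP, eo, coeff_zero] at this
    apply Fin.ext; omega
  · refine (hPon _ ?_).trans ?_
    · intro J
      have hw : ((p J : ℕ) : ℝ) ≤ H := mod_cast (p J).2.le
      have ea : ((q J : ℕ) : ℝ) ≤ H := mod_cast (q J).2.le
      have ee : (0:ℝ) ≤ ((p J : ℕ) : ℝ) := Nat.cast_nonneg _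
      have el : (0:ℝ) ≤ ((q J : ℕ) : ℝ) := Nat.cast_nonneg _
      push_cast; exact abs_sub_le_of_nonneg_of_le ee hw el ea
    · exact aux_num2 C N H em Dt M hC hc01 hDt1 (Nat.cast_nonneg _) (by rw [← pow_mul]; exact_mod_cast hNup) hH2
  · intro s J hJ
    by_contra hng
    have hmem : (fun h k => J (h, k)) ∈ JJ ι d := by
      rw [mem_JJ]; exact hMHK _ s J hJ
    have hb' : (fun h k => J (h, k)) ∈ bad := mem_filter.2 ⟨hmem, hng⟩
    have := congrFun hfpq (s, ⟨_, hb'⟩)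
    have ea := congrArg Subtype.val this
    simp only [f, exf_surj] at ea
    apply hJ
    rw [hPsub, map_sub, map_sub, coeff_sub, ea, sub_self]
end aux
end
section
open MvPolynomial
section thmA
variable {K : Type} [Field K] [CharZero K] {S : Type} [Fintype S] {ι : Type} [Fintype ι] [DecidableEq ι] {m : ℕ}
def od (d : Fin m → ℕ) (o : ι) : Fin m × ι → ℝ := fun p => if p.2 = o then 1 / (d p.1 : ℝ) else 0
lemma wt_od (d : Fin m → ℕ) (o : ι) (J : Fin m × ι →₀ ℕ) : wt (od d o) J = ∑ h, (J (h, o) : ℝ) / d h := by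
  unfold wt od
  rw [sum_prod_type]
  apply sum_congr rfl; intro h _
  rw [sum_eq_single o]
  · simp; ring
  · intro b _ hb; simp [hb]
  · simp
lemma unip_coeff (ω : ι → ℕ) (o : ι) (U : Fin m → Matrix ι ι K) (ai : ∀ h i, U h i i = 1)
    (hU : ∀ h k i, k ≠ i → U h k i ≠ 0 → ω k < ω i) (ho : ∀ i, ω i ≤ ω o) (d : Fin m → ℕ)
    (f : MP (Fin m × ι) K) (θ : ℝ) (J : Fin m × ι →₀ ℕ) (hJ : wt (od d o) J < θ)
    (hmin : ∀ E, f.coeff E ≠ 0 → wt (od d o) E < θ → wt (fun p : Fin m × ι => (ω p.2 : ℝ)) J ≤ wt (fun p => (ω p.2 : ℝ)) E) :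
    (lsub U f).coeff J = f.coeff J := by
  classical
  set ar := ∑ E ∈ f.support with wt (od d o) E < θ, monomial E (f.coeff E) with ad
  set an := ∑ E ∈ f.support with ¬ wt (od d o) E < θ, monomial E (f.coeff E) with ag
  have hf : f = ar + an := by
    rw [ad, ag, sum_filter_add_sum_filter_not]; exact f.as_sum
  have hterm : ∀ h k i, U h k i ≠ 0 → ω k + (if i = k then 0 else 1) ≤ ω i := by
    intro h k i hne
    split_ifs with hik
    · rw [hik]; simp
    · exact hU h k i (Ne.symm hik) hne
  have ea : LB (od d o) an θ := by
    apply LB_sum; intro E hE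
    exact (LB_monomial _ _ _).mono (not_lt.1 (mem_filter.1 hE).2)
  have h2' : LB (od d o) (lsub U an) θ := by
    refine LB_aeval _ (od d o) _ an θ ea ?_
    rintro ⟨h, k⟩
    apply LB_sum; intro i _
    by_cases eo : U h k i = 0
    · simp only [eo, map_zero, zero_mul]; exact LB_zero _ _
    refine ((LB_X _ _).C_mul _).mono ?_
    have := hterm h k i eo
    have ee := ho i
    unfold od
    by_cases hk : k = o
    · have : i = o := by
        by_contra hi; rw [if_neg (by rw [hk]; exact hi), hk] at this; omega
      simp [hk, this]
    · simp only [hk, if_false]; split_ifs <;> positivity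
  have h2J : ∀ g : MP (Fin m × ι) K, LB (od d o) g θ → g.coeff J = 0 := by
    intro g hg; by_contra eo; exact absurd (hg J eo) (not_le.2 hJ)
  rw [hf, map_add, coeff_add, coeff_add, h2J _ h2', h2J _ ea]
  congr 1
  have hw : ∀ E, ar.coeff E ≠ 0 → f.coeff E ≠ 0 ∧ wt (od d o) E < θ := by
    intro E hE
    rw [ad, coeff_sum] at hE
    obtain ⟨E', hE', h⟩ := exists_ne_zero_of_sum_ne_zero hE
    rw [coeff_monomial] at h
    have : E' = E := by by_contra h'; simp [h'] at h
    rw [← this]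
    have := mem_filter.1 hE'
    exact ⟨mem_support_iff.1 this.1, this.2⟩
  have := coeff_aeval_eq (fun p : Fin m × ι => (ω p.2 : ℝ)) (fun p : Fin m × ι => (ω p.2 : ℝ))
    (fun p => ∑ k, C (U p.1 p.2 k) * X (p.1, k)) X ar J ?_ ?_
  · rw [lsub, this, aeval_X_left_apply]
  · rintro ⟨h, k⟩
    refine ⟨?_, ?_⟩
    · apply LB_sum; intro i _
      by_cases eo : U h k i = 0
      · simp only [eo, map_zero, zero_mul]; exact LB_zero _ _
      refine ((LB_X _ _).C_mul _).mono ?_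
      have := hterm h k i eo
      exact_mod_cast (by omega : ω k ≤ ω i)
    · rw [← add_sum_erase _ _ (mem_univ k)]
      simp only [ai, map_one, one_mul, add_sub_cancel_left]
      apply LB_sum; intro i hi
      by_cases eo : U h k i = 0
      · simp only [eo, map_zero, zero_mul]; exact LB_zero _ _
      refine ((LB_X _ _).C_mul _).mono ?_
      have := hterm h k i eo
      rw [if_neg (ne_of_mem_erase hi)] at this
      exact_mod_cast this
  · intro E hE
    have := hmin E (hw E hE).1 (hw E hE).2
    linarith
lemma loc_bound (w : AV K) (d : Fin m → ℕ) (P : MP (Fin m × ι) ℤ) (hP : MH d P)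
    (𝓘 : Matrix ι ι K) (N : Fin m → Matrix ι ι K) (c : ι → ℝ) (X' : Fin m → ℝ) (μ : Fin m → ι → ℝ)
    (hμ : ∀ h i, 0 < μ h i) (C' A em T : ℝ) (hC : 0 ≤ C') (hc00 : 0 ≤ em)
    (hN : ∀ h k i, w (N h k i) ≤ C' * exp (X' h * c k) * μ h i) (hA : nrm absZ 1 P ≤ A)
    (bi : ∀ i, ∑ j, w (𝓘 i j) ≤ em)
    (hT : ∀ J, (lsub (fun _ => 𝓘) (map (icr K) P)).coeff J ≠ 0 → ∑ p : Fin m × ι, X' p.1 * c p.2 * J p ≤ T)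
    (J : Fin m × ι →₀ ℕ) :
    w ((lsub N (lsub (fun _ => 𝓘) (map (icr K) P))).coeff J) ≤
      A * (em * (fc ι * C')) ^ (∑ h, d h) * exp T * ∏ p : Fin m × ι, μ p.1 p.2 ^ J p := by
  set Q := lsub (fun _ => 𝓘) (map (icr K) P) with hQ
  have hMP : MH d (map (icr K) P) := by
    intro E hE; apply hP E; intro eo; apply hE; rw [coeff_map, eo, map_zero]
  have hMQ : MH d Q := MH_lsub d _ hMP _
  set Mc : ℝ := fc ι * C' with hMc
  have hMc0 : 0 ≤ Mc := by positivity
  have hw : nrm w 1 Q ≤ A * em ^ (∑ h, d h) := by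
    have ea := nrm_aeval w 1 (by simp) (fun _ : Fin m × ι => em) (fun p : Fin m × ι => ∑ k, C (𝓘 p.2 k) * X (p.1, k)) (by
      intro p
      refine (nrm_sum _ _ (by simp) _ _).trans ((sum_le_sum fun k _ => ?_).trans (bi p.2))
      refine (nrm_mul _ _ (by simp) _ _).trans ?_
      rw [nrm_C, nrm_X]; simp) (map (icr K) P)
    refine ea.trans ((nrm_map_int _ _ (fun _ => hc00) _).trans ?_)
    rw [nrm_MH absZ d em _ hP, mul_comm]
    exact mlr hA (by positivity)
  have ee : nrm w (fun p : Fin m × ι => Mc * exp (X' p.1 * c p.2)) Q ≤ nrm w 1 Q * (Mc ^ (∑ h, d h) * exp T) := by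
    unfold nrm
    rw [sum_mul]
    apply sum_le_sum; intro E hE
    have hE' := mem_support_iff.1 hE
    simp only [Pi.one_apply, one_pow, prod_const_one, mul_one]
    refine mll ?_ (w.nonneg _)
    simp only [mul_pow, prod_mul_distrib, prod_pow_eq_pow_sum]
    have ei : ∑ p : Fin m × ι, E p = ∑ h, d h := by
      rw [sum_prod_type]; exact sum_congr rfl fun h _ => hMQ E hE' h
    rw [ei]
    refine mll ?_ (by positivity)
    have et : ∏ p : Fin m × ι, exp (X' p.1 * c p.2) ^ E p = exp (∑ p : Fin m × ι, X' p.1 * c p.2 * E p) := by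
      rw [exp_sum]; apply prod_congr rfl; intro p _
      rw [← exp_nat_mul]; ring_nf
    rw [et]; exact exp_le_exp.2 (hT E hE')
  have hr : ∀ p : Fin m × ι, 0 ≤ (fun p : Fin m × ι => (μ p.1 p.2)⁻¹) p := fun p => (inv_pos.2 (hμ _ _)).le
  have el := nrm_aeval w (fun p : Fin m × ι => (μ p.1 p.2)⁻¹) hr (fun p : Fin m × ι => Mc * exp (X' p.1 * c p.2))
    (fun p : Fin m × ι => ∑ k, C (N p.1 p.2 k) * X (p.1, k)) (by
      intro p
      refine (nrm_sum _ _ hr _ _).trans ?_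
      refine (sum_le_sum (g := fun _ => C' * exp (X' p.1 * c p.2)) fun k _ => ?_).trans ?_
      · refine (nrm_mul _ _ hr _ _).trans ?_
        rw [nrm_C, nrm_X]
        have := hN p.1 p.2 k
        rw [← div_eq_mul_inv, div_le_iff₀ (hμ _ _)]; exact this
      · simp [hMc, mul_assoc]) Q
  have eb := coeff_le_nrm w (fun p : Fin m × ι => (μ p.1 p.2)⁻¹) hr (lsub N Q) J
  have ew := eb.trans (el.trans ee)
  have hpos : 0 < ∏ p : Fin m × ι, μ p.1 p.2 ^ J p := prod_pos fun p _ => pow_pos (hμ _ _) _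
  simp only [inv_pow, prod_inv_distrib] at ew
  rw [← div_eq_mul_inv, div_le_iff₀ hpos] at ew
  refine ew.trans (mlr ?_ hpos.le)
  rw [mul_pow em Mc]
  calc _ ≤ A * em ^ (∑ h, d h) * (Mc ^ (∑ h, d h) * exp T) := mlr hw (by positivity)
    _ = _ := by ring
lemma expo (d : Fin m → ℕ) (hd : ∀ h, 1 ≤ d h) (X' : Fin m → ℝ) (D ε B : ℝ) (hD : 0 ≤ D) (hε : 0 ≤ ε) (c : ι → ℝ) (hc : ∀ k, |c k| ≤ B)
    (hX : ∀ h, X' h * d h ≤ D) (hX2 : ∀ h, D - X' h * d h ≤ ε * D) (J : Fin m × ι →₀ ℕ) (hJ : ∀ h, ∑ k, J (h, k) = d h)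
    (M : ℝ) (hJ2 : ∀ k, |∑ h, (J (h, k) : ℝ) / d h - m / M| ≤ ε * m) :
    ∑ p : Fin m × ι, X' p.1 * c p.2 * J p ≤ D * (m / M) * ∑ k, c k + 2 * ε * m * D * fc ι * B := by
  have key : ∀ k, |∑ h, X' h * J (h, k) - D * (m / M)| ≤ 2 * ε * m * D := by
    intro k
    have ei : ∑ h, X' h * J (h, k) - D * (m / M) = D * (∑ h, (J (h, k) : ℝ) / d h - m / M) - ∑ h, (D - X' h * d h) * (J (h, k) / d h) := by
      have : ∀ h, X' h * J (h, k) = D * (J (h, k) / d h) - (D - X' h * d h) * (J (h, k) / d h) := by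
        intro h
        have : (d h : ℝ) ≠ 0 := by have := hd h; positivity
        field_simp; ring
      simp only [this, sum_sub_distrib, ← mul_sum]; ring
    have et : |∑ h, (D - X' h * d h) * ((J (h, k) : ℝ) / d h)| ≤ ε * D * m := by
      refine (abs_sum_le_sum_abs _ _).trans ((sum_le_sum (g := fun _ => ε * D) fun h _ => ?_).trans (by simp; linarith))
      have hw : (J (h, k) : ℝ) / d h ≤ 1 := by
        apply div_le_one_of_le₀ _ (by positivity)
        have := single_le_sum (f := fun k => J (h, k)) (by simp) (mem_univ k)
        rw [hJ h] at this; exact_mod_cast this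
      have eo : 0 ≤ (J (h, k) : ℝ) / d h := by positivity
      rw [abs_of_nonneg (mul_nonneg (by linarith [hX h]) eo)]
      exact (mul_le_of_le_one_right (by linarith [hX h]) hw).trans (hX2 h)
    rw [ei]
    refine (abs_sub _ _).trans ?_
    rw [abs_mul, abs_of_nonneg hD]
    have := mll (hJ2 k) hD
    linarith
  have ed : ∑ p : Fin m × ι, X' p.1 * c p.2 * J p = D * (m / M) * ∑ k, c k + ∑ k, c k * (∑ h, X' h * J (h, k) - D * (m / M)) := by
    rw [Fintype.sum_prod_type_right]
    simp only [mul_sub]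
    rw [sum_sub_distrib, ← sum_mul, mul_comm (D * (m / M)), add_sub_cancel]
    apply sum_congr rfl; intro k _; rw [mul_sum]; apply sum_congr rfl; intro h _; ring
  rw [ed]
  have : ∑ k, c k * (∑ h, X' h * J (h, k) - D * (m / M)) ≤ ∑ k : ι, B * (2 * ε * m * D) := by
    apply sum_le_sum; intro k _
    refine (le_abs_self _).trans ?_
    rw [abs_mul]
    exact mul_le_mul (hc k) (key k) (abs_nonneg _) ((abs_nonneg _).trans (hc k))
  simp at this
  linarith
set_option maxHeartbeats 1000000 in
lemma idx_lower (Φ : PlaceSys K S) (ω : ι → ℕ) (o : ι) (ho : ∀ i, ω i ≤ ω o) (d : Fin m → ℕ) (hd : ∀ h, 1 ≤ d h)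
    (P : MP (Fin m × ι) ℤ) (hP : MH d P) (𝓘 𝓛 : S → Matrix ι ι K) (hIL : ∀ s, 𝓘 s * 𝓛 s = 1)
    (Z : Fin m → Matrix ι ι K) (hZ : ∀ h i j, Z h i j ∈ Φ.R) (U : Fin m → S → Matrix ι ι K) (ai : ∀ h s i, U h s i i = 1)
    (hU : ∀ h s k i, k ≠ i → U h s k i ≠ 0 → ω k < ω i) (μ : Fin m → S → ι → ℝ) (hμ : ∀ h s i, 0 < μ h s i)
    (c : S → ι → ℝ) (X' : Fin m → ℝ) (C' ec em ε B g D θ : ℝ) (hC : 1 ≤ C') (bu : 0 ≤ ec) (hc00 : 0 ≤ em) (hε : 0 ≤ ε) (hB : 0 ≤ B)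
    (hD : 0 ≤ D) (hX0 : ∀ h, 0 ≤ X' h)
    (hN : ∀ h s k i, Φ.w s ((𝓛 s * Z h * U h s) k i) ≤ C' * exp (X' h * c s k) * μ h s i)
    (hA : nrm absZ 1 P ≤ ec ^ (∑ h, d h)) (bi : ∀ s i, ∑ j, Φ.w s (𝓘 s i j) ≤ em)
    (hQ : ∀ s J, (lsub (fun _ => 𝓘 s) (map (icr K) P)).coeff J ≠ 0 →
          ∀ k, |∑ h, (J (h, k) : ℝ) / d h - m / fc ι| ≤ ε * m)
    (hX : ∀ h, X' h * d h ≤ D) (hX2 : ∀ h, D - X' h * d h ≤ ε * D) (hc : ∀ s k, |c s k| ≤ B) (hg : ∑ s, ∑ k, c s k ≤ - g)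
    (hμ1 : ∀ h i, i ≠ o → ∏ s, μ h s i ≤ C') (hμo : ∀ h, ∏ s, μ h s o ≤ C' * exp (B * X' h))
    (hfin : ((ec * (em * (fc ι * C'))) ^ fc S * C') ^ (∑ h, d h) *
      exp (D * (- (m / fc ι * g) + 2 * ε * m * fc ι * B * fc S + B * θ)) < 1)
    (J : Fin m × ι →₀ ℕ) (hJ : (lsub Z (map (icr K) P)).coeff J ≠ 0) : θ ≤ wt (od d o) J := by
  classical
  by_contra hlt
  rw [not_le] at hlt
  set f := lsub Z (map (icr K) P) with hf
  obtain ⟨J, hJm, hmin⟩ := exists_min_image (f.support.filter fun J => wt (od d o) J < θ)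
    (fun J => wt (fun p : Fin m × ι => (ω p.2 : ℝ)) J) ⟨J, mem_filter.2 ⟨mem_support_iff.2 hJ, hlt⟩⟩
  obtain ⟨hJs, hJθ⟩ := mem_filter.1 hJm
  have hJs' := mem_support_iff.1 hJs
  have hMP : MH d (map (icr K) P) := by
    intro E hE; apply hP E; intro eo; apply hE; rw [coeff_map, eo, map_zero]
  have hw := Φ.prod_ge _ (lsub_mem Φ.R P Z hZ J) hJs'
  have hloc : ∀ s, Φ.w s (f.coeff J) ≤ ec ^ (∑ h, d h) * (em * (fc ι * C')) ^ (∑ h, d h) *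
      exp (D * (m / fc ι) * ∑ k, c s k + 2 * ε * m * D * fc ι * B) * ∏ p : Fin m × ι, μ p.1 s p.2 ^ J p := by
    intro s
    have ei := unip_coeff ω o (fun h => U h s) (fun h => ai h s) (fun h => hU h s) ho d f θ J hJθ
      (fun E hE hEθ => hmin E (mem_filter.2 ⟨mem_support_iff.2 hE, hEθ⟩))
    have et : lsub (fun h => U h s) f = lsub (fun h => 𝓛 s * Z h * U h s) (lsub (fun _ => 𝓘 s) (map (icr K) P)) := by
      rw [hf, lsub_lsub, lsub_lsub]
      congr 2; funext h
      rw [← mul_assoc, ← mul_assoc, hIL, one_mul]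
    rw [← ei, et]
    refine loc_bound (Φ.w s) d P hP (𝓘 s) _ (c s) X' (fun h i => μ h s i) (fun h i => hμ h s i) C' _ em _ (by linarith) hc00
      (fun h => hN h s) hA (bi s) ?_ J
    intro E hE
    exact expo d hd X' D ε B hD hε (c s) (hc s) hX hX2 E (MH_lsub d _ hMP _ E hE) _ (hQ s E hE)
  have hJd := MH_lsub d _ hMP Z J hJs'
  have hmu : ∏ s, ∏ p : Fin m × ι, μ p.1 s p.2 ^ J p ≤ C' ^ (∑ h, d h) * exp (D * (B * θ)) := by
    rw [prod_comm]
    have ei : ∀ p : Fin m × ι, ∏ s, μ p.1 s p.2 ^ J p ≤ C' ^ J p * exp (if p.2 = o then B * (X' p.1 * J p) else 0) := by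
      intro p
      rw [prod_pow]
      split_ifs with hp
      · have : exp (B * (X' p.1 * J p)) = exp (B * X' p.1) ^ J p := by rw [← exp_nat_mul]; ring_nf
        rw [this, ← mul_pow, hp]
        exact pow_le_pow_left₀ (prod_nonneg fun s _ => (hμ _ _ _).le) (hμo p.1) _
      · rw [Real.exp_zero, mul_one]
        exact pow_le_pow_left₀ (prod_nonneg fun s _ => (hμ _ _ _).le) (hμ1 p.1 p.2 hp) _
    refine (prod_le_prod (fun p _ => prod_nonneg fun s _ => pow_nonneg (hμ _ _ _).le _) fun p _ => ei p).trans ?_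
    rw [prod_mul_distrib, prod_pow_eq_pow_sum, ← exp_sum]
    have et : ∑ p : Fin m × ι, J p = ∑ h, d h := by
      rw [sum_prod_type]; exact sum_congr rfl fun h _ => hJd h
    rw [et]
    refine mll (exp_le_exp.2 ?_) (by positivity)
    have ed : ∑ p : Fin m × ι, (if p.2 = o then B * (X' p.1 * J p) else 0) = B * ∑ h, X' h * J (h, o) := by
      rw [sum_prod_type, mul_sum]
      apply sum_congr rfl; intro h _; simp
    rw [ed]
    have ev : ∑ h, X' h * J (h, o) ≤ D * θ := by
      rw [wt_od] at hJθ
      refine le_trans ?_ (mll hJθ.le hD)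
      rw [mul_sum]
      apply sum_le_sum; intro h _
      have hdp : (0:ℝ) < d h := by have := hd h; positivity
      rw [← mul_div_assoc, le_div_iff₀ hdp]
      nlinarith [mlr (hX h) (Nat.cast_nonneg (α := ℝ) (J (h, o)))]
    nlinarith [mll ev hB]
  have ea := hw.trans (prod_le_prod (fun s _ => (Φ.w s).nonneg _) fun s _ => hloc s)
  rw [prod_mul_distrib, prod_mul_distrib, prod_const, ← exp_sum] at ea
  have ee : (1:ℝ) ≤ (ec ^ (∑ h, d h) * (em * (fc ι * C')) ^ (∑ h, d h)) ^ (fc S) *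
      exp (D * (m / fc ι) * (-g) + 2 * ε * m * D * fc ι * B * fc S) *
      (C' ^ (∑ h, d h) * exp (D * (B * θ))) := by
    refine ea.trans (mul_le_mul (mll (exp_le_exp.2 ?_) (by positivity)) hmu
      (prod_nonneg fun s _ => prod_nonneg fun p _ => pow_nonneg (hμ _ _ _).le _) (by positivity))
    rw [sum_add_distrib, ← mul_sum]
    simp only [sum_const, card_univ, nsmul_eq_mul]
    have : 0 ≤ D * ((m:ℝ) / fc ι) := by positivity
    have := mll hg this
    linarith
  refine absurd hfin (not_lt.2 (ee.trans (le_of_eq ?_)))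
  rw [mul_pow _ C', ← pow_mul, mul_comm (fc S), pow_mul, ← mul_pow ec]
  rw [show D * (-((m:ℝ) / fc ι * g) + 2 * ε * m * fc ι * B * fc S + B * θ) =
    (D * (m / fc ι) * (-g) + 2 * ε * m * D * fc ι * B * fc S) + D * (B * θ) by ring, exp_add _ (D * (B * θ))]
  ring
end thmA
end
section
open MvPolynomial
section thmA
variable {K : Type} [Field K] [CharZero K] {S : Type} [Fintype S] {ι : Type} [Fintype ι] [DecidableEq ι] {m : ℕ}
lemma exists_copFrac (Φ : PlaceSys K S) (x : K) : ∃ β : CopFrac Φ, β.val = x := by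
  obtain ⟨a, ha, b, hb, bb, hx, u, hu, v, hv, h⟩ := Φ.cop x
  exact ⟨⟨a, b, u, v, ha, hb, hu, hv, bb, h⟩, hx.symm⟩
lemma heights (Φ : PlaceSys K S) (Z : Matrix ι ι K) (hZ : ∀ i j, Z i j ∈ Φ.R) (o : ι) (ℓ : ι → K) (κ : K)
    (hκ : κ ≠ 0) (hℓZ : vecMul ℓ Z = κ • Pi.single o 1) (C' Y : ℝ) (hC : 1 ≤ C') (hκC : ∏ s, Φ.w s κ ≤ C')
    (hY : exp Y ≤ ∏ s, ∑ i, Φ.w s (ℓ i)) (hYC : log (C' * fc ι ^ fc S) < Y) :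
    ∃ en ep, en ≠ ep ∧ ℓ en ≠ 0 ∧ ∃ β : CopFrac Φ, β.val = - ℓ ep / ℓ en ∧
      Y - log (C' * fc ι ^ fc S) ≤ fc ι * β.ht := by
  classical
  haveI : Nonempty ι := ⟨o⟩
  have hex : ∃ en, ℓ en ≠ 0 := by
    by_contra hno; push Not at hno
    have : ℓ = 0 := funext hno
    rw [this, zero_vecMul] at hℓZ
    have := congrFun hℓZ o; simp at this; exact hκ this.symm
  obtain ⟨en, ay⟩ := hex
  have eo : ∀ k, ∃ β : CopFrac Φ, β.val = - ℓ k / ℓ en ∧ (k = en → β.ht = 0) := by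
    intro k
    by_cases hk : k = en
    · refine ⟨⟨-1, 1, 0, 1, Φ.R.neg_mem Φ.R.one_mem, Φ.R.one_mem, Φ.R.zero_mem, Φ.R.one_mem, one_ne_zero, by simp⟩, ?_, ?_⟩
      · simp [CopFrac.val, hk]; field_simp
      · intro _; simp [CopFrac.ht]
    · obtain ⟨β, hβ⟩ := exists_copFrac Φ (- ℓ k / ℓ en)
      exact ⟨β, hβ, fun h => absurd h hk⟩
  choose β hβ hβ0 using eo
  set b := ∏ k, (β k).den with hb
  have hbn : b ≠ 0 := prod_ne_zero_iff.2 fun k _ => (β k).hne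
  have hbl : ∀ k, b / ℓ en * ℓ k = - (β k).num * ∏ j ∈ univ.erase k, (β j).den := by
    intro k
    rw [hb, ← mul_prod_erase _ _ (mem_univ k)]
    have hw := hβ k
    rw [CopFrac.val, div_eq_div_iff (β k).hne ay] at hw
    field_simp
    linear_combination (∏ j ∈ univ.erase k, (β j).den) * hw
  have hmem : b / ℓ en * κ ∈ Φ.R := by
    have hw := congrFun hℓZ o
    simp only [vecMul, dotProduct, Pi.smul_apply, Pi.single_eq_same, smul_eq_mul, mul_one] at hw
    rw [← hw, mul_sum]
    apply Subring.sum_mem; intro k _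
    rw [← mul_assoc, hbl]
    exact Φ.R.mul_mem (Φ.R.mul_mem (Φ.R.neg_mem (β k).hnum) (Subring.prod_mem _ fun j _ => (β j).hden)) (hZ _ _)
  have hw := Φ.prod_ge _ hmem (mul_ne_zero (div_ne_zero hbn ay) hκ)
  set mx : S → ι → ℝ := fun s k => max (Φ.w s (β k).den) (Φ.w s (β k).num) with hmx
  have hmxp : ∀ s k, 0 < mx s k := fun s k => lt_max_of_lt_left ((Φ.w s).pos (β k).hne)
  have ea : ∀ s, Φ.w s (b / ℓ en) * ∑ i, Φ.w s (ℓ i) ≤ fc ι * ∏ k, mx s k := by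
    intro s
    rw [mul_sum]
    refine (sum_le_sum (g := fun _ => ∏ k, mx s k) fun k _ => ?_).trans (by simp)
    rw [← map_mul, hbl, map_mul, map_prod, AbsoluteValue.map_neg, ← mul_prod_erase _ _ (mem_univ k)]
    exact mul_le_mul (le_max_right _ _) (prod_le_prod (fun j _ => (Φ.w s).nonneg _) fun j _ => le_max_left _ _)
      (prod_nonneg fun j _ => (Φ.w s).nonneg _) (hmxp s k).le
  have ee : exp Y ≤ C' * (fc ι ^ fc S * ∏ k, ∏ s, mx s k) := by
    have ei := prod_le_prod (fun s _ => mul_nonneg ((Φ.w s).nonneg _) (sum_nonneg fun i _ => (Φ.w s).nonneg _)) (fun s (_ : s ∈ univ) => ea s)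
    rw [prod_mul_distrib, prod_mul_distrib, prod_comm, prod_const, card_univ] at ei
    simp only [map_mul, prod_mul_distrib] at hw
    have et : 0 ≤ ∏ s, Φ.w s (b / ℓ en) := prod_nonneg fun s _ => (Φ.w s).nonneg _
    have ed : 0 ≤ ∏ s, ∑ i, Φ.w s (ℓ i) := (exp_pos _).le.trans hY
    have ev : 1 ≤ (∏ s, Φ.w s (b / ℓ en)) * C' := hw.trans (mll hκC et)
    nlinarith [mlr ev ed]
  have hpk : ∀ k, 0 < ∏ s, mx s k := fun k => prod_pos fun s _ => hmxp s k
  have el : Y ≤ log (C' * fc ι ^ fc S) + ∑ k, (β k).ht := by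
    have hM : (0:ℝ) < fc ι := mod_cast Fintype.card_pos
    rw [← mul_assoc] at ee
    have := log_le_log (exp_pos _) ee
    rw [log_exp, log_mul (by positivity) (prod_pos fun k _ => hpk k).ne', log_prod (fun k _ => (hpk k).ne')] at this
    exact this
  obtain ⟨ep, _, bt⟩ := exists_max_image univ (fun k => (β k).ht) ⟨en, mem_univ _⟩
  have eb : ∑ k, (β k).ht ≤ fc ι * (β ep).ht := by
    refine (sum_le_sum (g := fun _ => (β ep).ht) fun k hk => bt k hk).trans (by simp)
  refine ⟨en, ep, ?_, ay, β ep, hβ ep, by linarith⟩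
  intro he
  rw [hβ0 ep he.symm] at eb; linarith
lemma coeff_sum_prod {σ τ : Type} (f : MP σ K) (e e' : τ →₀ ℕ) (E : σ →₀ ℕ) [Decidable (e' = e)] :
    (rename Sum.inl f * monomial (e'.mapDomain Sum.inr) (1:K) : MP (σ ⊕ τ) K).coeff (E.mapDomain Sum.inl + e.mapDomain Sum.inr) =
      if e' = e then f.coeff E else 0 := by
  classical
  rw [coeff_mul_monomial', mul_one]
  have hr : ∀ (g : σ →₀ ℕ) x, (g.mapDomain Sum.inl : σ ⊕ τ →₀ ℕ) (Sum.inr x) = 0 := fun g x =>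
    mapDomain_notin_range _ _ (by simp)
  have hl : ∀ (g : τ →₀ ℕ) x, (g.mapDomain Sum.inr : σ ⊕ τ →₀ ℕ) (Sum.inr x) = g x := fun g x =>
    mapDomain_apply Sum.inr_injective _ _
  split_ifs with hw ea ea
  · rw [ea, add_tsub_cancel_right, coeff_rename_mapDomain _ Sum.inl_injective]
  · apply coeff_rename_eq_zero
    intro u hu
    exfalso; apply ea
    ext x
    have ei := hw (Sum.inr x)
    have et := DFunLike.congr_fun hu (Sum.inr x)
    rw [Finsupp.coe_tsub, Pi.sub_apply] at et
    rw [Finsupp.add_apply] at ei et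
    rw [hr, hl, hl] at et
    rw [hr, hl, hl] at ei
    rw [hr] at et
    omega
  · exfalso; apply hw; rw [ea]; exact le_add_self
  · rfl
lemma LB_nonneg {σ : Type} [Fintype σ] (a : σ → ℝ) (ha : ∀ i, 0 ≤ a i) (f : MP σ K) : LB a f 0 :=
  fun E _ => sum_nonneg fun i _ => mul_nonneg (ha i) (Nat.cast_nonneg _)
set_option maxHeartbeats 1000000 in
lemma roth_use (d : Fin m → ℕ) (P : MP (Fin m × ι) ℤ) (hP0 : P ≠ 0) (hP : MH d P)
    (Z : Fin m → Matrix ι ι K) (hZ : ∀ h, (Z h).det ≠ 0) (o : ι) (ℓ : Fin m → ι → K) (κ : Fin m → K) (hκ : ∀ h, κ h ≠ 0)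
    (hℓ : ∀ h, vecMul (ℓ h) (Z h) = κ h • Pi.single o 1) (en ep : Fin m → ι) (hk : ∀ h, en h ≠ ep h)
    (ay : ∀ h, ℓ h (en h) ≠ 0) (β : Fin m → K) (hβ : ∀ h, β h = - ℓ h (ep h) / ℓ h (en h)) (θ : ℝ)
    (hidx : ∀ J, (lsub Z (map (icr K) P)).coeff J ≠ 0 → θ ≤ wt (od d o) J) :
    ∃ F : MP (Fin m) ℤ, F ≠ 0 ∧ (∀ E, F.coeff E ≠ 0 → ∀ h, E h ≤ d h) ∧ nrm absZ 1 F ≤ nrm absZ 1 P ∧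
      ∀ E, (shift β (map (icr K) F)).coeff E ≠ 0 → θ ≤ idx d E := by
  classical
  let isr : Fin m × ι → Prop := fun p => p.2 ≠ en p.1 ∧ p.2 ≠ ep p.1
  let rest : (Fin m × ι →₀ ℕ) → (Fin m × ι →₀ ℕ) := fun J => J.filter isr
  let pk : (Fin m × ι →₀ ℕ) → (Fin m →₀ ℕ) := fun J => Finsupp.equivFunOnFinite.symm fun h => J (h, en h)
  have hpk : ∀ J h, pk J h = J (h, en h) := fun J h => rfl
  let b : Fin m × ι → ℝ := fun p => if isr p then 1 else 0
  have hinj : ∀ J J', P.coeff J ≠ 0 → P.coeff J' ≠ 0 → rest J = rest J' → pk J = pk J' → J = J' := by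
    intro J J' hJ hJ' hr hp
    have hA : ∀ h k, k ≠ ep h → J (h, k) = J' (h, k) := by
      intro h k hkk
      by_cases hkk0 : k = en h
      · rw [hkk0]; exact DFunLike.congr_fun hp h
      · have := DFunLike.congr_fun hr (h, k)
        simpa only [rest, filter_apply, isr, hkk0, hkk, ne_eq, not_false_eq_true, and_self, if_true] using this
    ext ⟨h, k⟩
    by_cases hkk : k = ep h
    · have ei := (hP J hJ h).trans (hP J' hJ' h).symm
      rw [← add_sum_erase _ _ (mem_univ (ep h)), ← add_sum_erase _ _ (mem_univ (ep h)),
        sum_congr rfl fun k hk' => hA h k (ne_of_mem_erase hk')] at ei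
      rw [hkk]; omega
    · exact hA h k hkk
  obtain ⟨br, hJ0, hmin⟩ := exists_min_image P.support (fun J => wt b J) (support_nonempty.2 hP0)
  set e := rest br with he
  set t := P.support.filter fun J => rest J = e with ht
  set F : MP (Fin m) ℤ := ∑ J ∈ t, monomial (pk J) (P.coeff J) with hF
  have hFc : ∀ E, F.coeff E ≠ 0 → ∃ J ∈ t, pk J = E := by
    intro E hE
    rw [hF, coeff_sum] at hE
    obtain ⟨J, hJ, h⟩ := exists_ne_zero_of_sum_ne_zero hE
    rw [coeff_monomial] at h
    exact ⟨J, hJ, by by_contra h'; simp [h'] at h⟩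
  refine ⟨F, ?_, ?_, ?_, ?_⟩
  · intro eo
    have hw : F.coeff (pk br) = P.coeff br := by
      rw [hF, coeff_sum, sum_eq_single br]
      · rw [coeff_monomial, if_pos rfl]
      · intro J hJ hne
        rw [coeff_monomial, if_neg]
        intro hp; obtain ⟨hJ1, hJ2⟩ := mem_filter.1 hJ
        exact hne (hinj J br (mem_support_iff.1 hJ1) (mem_support_iff.1 hJ0) hJ2 hp)
      · intro h; exact absurd (show br ∈ t from mem_filter.2 ⟨hJ0, rfl⟩) h
    rw [eo, coeff_zero] at hw
    exact mem_support_iff.1 hJ0 hw.symm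
  · intro E hE h
    obtain ⟨J, hJ, rfl⟩ := hFc E hE
    rw [hpk, ← hP J (mem_support_iff.1 (mem_filter.1 hJ).1) h]
    exact single_le_sum (f := fun k => J (h, k)) (by simp) (mem_univ _)
  · refine (nrm_sum _ _ (by simp) _ _).trans ?_
    simp only [nrm_monomial, Pi.one_apply, one_pow, prod_const_one, mul_one]
    rw [nrm]
    simp only [Pi.one_apply, one_pow, prod_const_one, mul_one]
    exact sum_le_sum_of_subset_of_nonneg (filter_subset _ _) fun J _ _ => absZ.nonneg _
  intro E hE
  set PK := map (icr K) P with hPK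
  let lin : Fin m → MP (Fin m ⊕ (Fin m × ι)) K := fun h =>
    ∑ k, C (if isr (h, k) then ℓ h k / ℓ h (en h) else 0) * X (Sum.inr (h, k))
  let ψ : Fin m × ι → MP (Fin m ⊕ (Fin m × ι)) K := fun p =>
    if p.2 = en p.1 then X (Sum.inl p.1) + C (β p.1) - lin p.1 else if p.2 = ep p.1 then 1 else X (Sum.inr p)
  let ψ' : Fin m × ι → MP (Fin m ⊕ (Fin m × ι)) K := fun p =>
    if p.2 = en p.1 then X (Sum.inl p.1) + C (β p.1) else if p.2 = ep p.1 then 1 else X (Sum.inr p)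
  let tot : Fin m ⊕ (Fin m × ι) →₀ ℕ := E.mapDomain Sum.inl + e.mapDomain Sum.inr
  have htl : ∀ h, tot (Sum.inl h) = E h := fun h => by
    simp only [tot, Finsupp.add_apply]
    rw [mapDomain_apply Sum.inl_injective, mapDomain_notin_range _ _ (by simp), add_zero]
  have htr : ∀ p, tot (Sum.inr p) = e p := fun h => by
    simp only [tot, Finsupp.add_apply]
    rw [mapDomain_apply Sum.inr_injective, mapDomain_notin_range _ _ (by simp), zero_add]
  have bf : (aeval ψ PK).coeff tot = (aeval ψ' PK).coeff tot := by
    apply coeff_aeval_eq (Sum.elim (fun _ => 0) (fun _ => 1)) b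
    · have hnn : ∀ i : Fin m ⊕ (Fin m × ι), (0:ℝ) ≤ Sum.elim (fun _ => (0:ℝ)) (fun _ => 1) i := by
        rintro (i | i) <;> simp
      rintro ⟨h, k⟩
      by_cases hkk : k = en h
      · have hb : b (h, k) = 0 := by simp [b, isr, hkk]
        rw [hb]
        refine ⟨LB_nonneg _ hnn _, ?_⟩
        simp only [ψ, ψ', hkk, if_true]
        rw [sub_sub_cancel_left]
        apply LB.neg; apply LB_sum; intro k' _
        refine ((LB_X _ _).C_mul _).mono ?_
        simp
      by_cases az : k = ep h
      · have hb : b (h, k) = 0 := by simp [b, isr, az]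
        rw [hb]
        refine ⟨LB_nonneg _ hnn _, ?_⟩
        simp only [ψ, ψ', hkk, az, if_true, (hk h).symm, if_false, sub_self]
        exact LB_zero _ _
      · have hb : b (h, k) = 1 := by simp [b, isr, az, hkk]
        rw [hb]
        simp only [ψ, ψ', hkk, az, if_false]
        refine ⟨(LB_X _ _).mono (by simp), ?_⟩
        rw [sub_self]; exact LB_zero _ _
    · intro J hJ
      have hw : wt (Sum.elim (fun _ => (0:ℝ)) (fun _ => 1)) tot = wt b br := by
        unfold wt
        rw [Fintype.sum_sum_type]
        simp only [Sum.elim_inl, Sum.elim_inr, zero_mul, sum_const_zero, zero_add, one_mul, htr]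
        apply sum_congr rfl; intro p _
        simp only [he, rest, filter_apply, b]
        split_ifs <;> simp
      rw [hw]
      have := hmin J (mem_support_iff.2 fun eo => hJ (by rw [hPK, coeff_map, eo, map_zero]))
      linarith
  have hprod : ∀ J : Fin m × ι →₀ ℕ, ∏ p, ψ' p ^ J p =
      rename Sum.inl (shift β (monomial (pk J) 1)) * monomial ((rest J).mapDomain Sum.inr) (1:K) := by
    intro J
    have ei : rename Sum.inl (shift β (monomial (pk J) (1:K))) = (∏ h, (X (Sum.inl h) + C (β h)) ^ J (h, en h) : MP (Fin m ⊕ (Fin m × ι)) K) := by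
      rw [shift, aeval_monomial, map_one, one_mul, prod_fintype _ _ (by simp), map_prod]
      simp [hpk]
    have et : monomial ((rest J).mapDomain Sum.inr) (1:K) = (∏ p, X (Sum.inr p) ^ (rest J p) : MP (Fin m ⊕ (Fin m × ι)) K) := by
      rw [← rename_monomial, monomial_eq, map_one, one_mul, prod_fintype _ _ (by simp), map_prod]
      simp
    rw [ei, et, prod_prod_type, prod_prod_type, ← prod_mul_distrib]
    apply prod_congr rfl; intro h _
    rw [← mul_prod_erase univ (fun k => ψ' (h, k) ^ J (h, k)) (mem_univ (en h)),
      ← mul_prod_erase univ (fun k => X (Sum.inr (h, k)) ^ (rest J (h, k))) (mem_univ (en h))]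
    have ed : rest J (h, en h) = 0 := by simp [rest, filter_apply, isr]
    rw [ed, pow_zero, one_mul]
    congr 1
    · simp [ψ']
    · apply prod_congr rfl; intro k hk'
      have hk0' := ne_of_mem_erase hk'
      by_cases az : k = ep h
      · simp only [ψ', rest, filter_apply, isr, az, (hk h).symm, if_false, if_true, one_pow]; simp
      · simp only [ψ', rest, filter_apply, isr, az, hk0', if_false]; simp [az, hk0']
  have c2 : (aeval ψ' PK).coeff tot = (shift β (map (icr K) F)).coeff E := by
    have hs : aeval ψ' PK = ∑ J ∈ P.support, C ((P.coeff J : ℤ) : K) * ∏ p, ψ' p ^ J p := by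
      rw [aeval_eq_sum]
      refine (sum_subset (support_map_subset _ _) ?_).trans ?_
      · intro J _ hJ; rw [notMem_support_iff.1 hJ]; simp
      · apply sum_congr rfl; intro J _; rw [hPK, coeff_map]; rfl
    rw [hs, coeff_sum, hF, map_sum, map_sum, coeff_sum, ht, sum_filter]
    apply sum_congr rfl; intro J _
    rw [coeff_C_mul, hprod, coeff_sum_prod]
    split_ifs with hr
    · rw [map_monomial, ← mul_one ((icr K) (coeff J P)), ← C_mul_monomial, map_mul, ← algebraMap_eq,
        AlgHom.commutes, algebraMap_eq, coeff_C_mul]; rfl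
    · simp
  have hLB : LB (Sum.elim (fun h => 1 / (d h : ℝ)) (fun _ => 0)) (aeval ψ PK) θ := by
    have hf : PK = lsub (fun h => (Z h)⁻¹) (lsub Z PK) := by
      rw [lsub_lsub]
      have : (fun h => Z h * (Z h)⁻¹) = fun _ => 1 := funext fun h => mul_nonsing_inv _ (hZ h).isUnit
      rw [this, lsub_one]
    have hcomp : aeval ψ PK = aeval (fun p : Fin m × ι => ∑ k, C ((Z p.1)⁻¹ p.2 k) * ψ (p.1, k)) (lsub Z PK) := by
      conv_lhs => rw [hf]
      have : (aeval ψ).comp (lsub fun h => (Z h)⁻¹) = aeval (fun p : Fin m × ι => ∑ k, C ((Z p.1)⁻¹ p.2 k) * ψ (p.1, k)) := by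
        apply algHom_ext; intro p
        rw [AlgHom.comp_apply, lsub_X, map_sum, aeval_X]
        apply sum_congr rfl; intro k _
        rw [map_mul, aeval_X, ← algebraMap_eq, AlgHom.commutes]; rfl
      rw [← this]; rfl
    rw [hcomp]
    have hnn : ∀ i : Fin m ⊕ (Fin m × ι), (0:ℝ) ≤ Sum.elim (fun h => 1 / (d h : ℝ)) (fun _ => 0) i := by
      rintro (i | i) <;> simp
    refine LB_aeval _ (od d o) _ _ θ hidx ?_
    rintro ⟨h, i⟩
    by_cases hi : i = o
    · have hzi : ∀ k, (Z h)⁻¹ o k = ℓ h k / κ h := by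
        intro k
        have hw := congrArg (fun v => vecMul v (Z h)⁻¹) (hℓ h)
        simp only [vecMul_vecMul, mul_nonsing_inv _ (hZ h).isUnit, Matrix.vecMul_one, Matrix.smul_vecMul, Matrix.single_one_vecMul] at hw
        have ea := congrFun hw k
        simp at ea
        rw [ea]; field_simp [hκ h]
      have hsum : ∑ k, C ((Z h)⁻¹ i k) * ψ (h, k) = C (ℓ h (en h) / κ h) * X (Sum.inl h) := by
        have ei : ∀ k, C ((Z h)⁻¹ i k) * ψ (h, k) = C (1 / κ h) * (C (ℓ h k) * ψ (h, k)) := by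
          intro k; rw [hi, hzi, ← mul_assoc, ← C_mul]; congr 2; ring
        simp only [ei, ← mul_sum]
        rw [← add_sum_erase _ _ (mem_univ (en h)), ← add_sum_erase _ _ (mem_erase.2 ⟨(hk h).symm, mem_univ (ep h)⟩)]
        have et : lin h = ∑ k ∈ (univ.erase (en h)).erase (ep h), C (ℓ h k / ℓ h (en h)) * X (Sum.inr (h, k)) := by
          simp only [lin]
          symm
          refine (sum_congr rfl fun k hk' => ?_).trans (sum_subset (subset_univ _) fun k _ hk' => ?_)
          · simp only [mem_erase] at hk'; rw [if_pos ⟨hk'.2.1, hk'.1⟩]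
          · have : ¬ isr (h, k) := fun hh => hk' (by simp [hh.1, hh.2])
            rw [if_neg this]; simp
        have ed : ∑ k ∈ (univ.erase (en h)).erase (ep h), C (ℓ h k) * ψ (h, k) = C (ℓ h (en h)) * lin h := by
          rw [et, mul_sum]
          apply sum_congr rfl; intro k hk'
          simp only [mem_erase] at hk'
          simp only [ψ, hk'.1, hk'.2.1, if_false]
          rw [← mul_assoc, ← C_mul, mul_div_cancel₀ _ (ay h)]
        have ev : ψ (h, en h) = X (Sum.inl h) + C (β h) - lin h := by simp [ψ]
        have am : ψ (h, ep h) = 1 := by simp [ψ, (hk h).symm]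
        rw [ed, ev, am]
        have ak : (C (ℓ h (en h)) : MP (Fin m ⊕ (Fin m × ι)) K) * C (β h) = - C (ℓ h (ep h)) := by
          rw [← C_mul, ← C_neg, hβ, mul_div_cancel₀ _ (ay h)]
        have bn : (C (ℓ h (en h) / κ h) : MP (Fin m ⊕ (Fin m × ι)) K) = C (1 / κ h) * C (ℓ h (en h)) := by
          rw [← C_mul]; congr 1; ring
        rw [bn]; linear_combination C (1 / κ h) * ak
      show LB _ (∑ k, C ((Z h)⁻¹ i k) * ψ (h, k)) _
      rw [hsum]
      refine ((LB_X _ _).C_mul _).mono ?_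
      simp [od, hi]
    · refine (LB_nonneg _ hnn _).mono ?_
      simp [od, hi]
  have := hLB tot (by rw [bf, c2]; exact hE)
  refine this.trans (le_of_eq ?_)
  unfold wt idx
  rw [Fintype.sum_sum_type]
  simp only [Sum.elim_inl, Sum.elim_inr, zero_mul, sum_const_zero, add_zero, htl]
  apply sum_congr rfl; intro h _; ring
end thmA
end
section
open MvPolynomial
section thmA
variable {K : Type} [Field K] [CharZero K] {S : Type} [Fintype S] {ι : Type} [Fintype ι] [DecidableEq ι]
lemma common_den (Φ : PlaceSys K S) {α : Type*} [Fintype α] (x : α → K) : ∃ r ∈ Φ.R, r ≠ 0 ∧ ∀ a, r * x a ∈ Φ.R := by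
  classical
  choose β hβ using fun a => exists_copFrac Φ (x a)
  refine ⟨∏ a, (β a).den, Subring.prod_mem _ fun a _ => (β a).hden, prod_ne_zero_iff.2 fun a _ => (β a).hne, fun a => ?_⟩
  rw [← mul_prod_erase _ _ (mem_univ a), mul_right_comm, ← hβ a, CopFrac.val, mul_div_cancel₀ _ (β a).hne]
  exact Φ.R.mul_mem (β a).hnum (Subring.prod_mem _ fun a _ => (β a).hden)
lemma seq_choice (Pr : ℝ → Prop) (h : ∀ ao, ∃ X ≥ ao, Pr X) (σ : ℝ) (hσ : 0 < σ) (Xm : ℝ) (hXm : 0 ≤ Xm) (m : ℕ) :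
    ∃ X : Fin m → ℝ, (∀ i, Xm ≤ X i ∧ Pr (X i)) ∧ ∀ i j, i < j → 2 * X j ≤ σ * X i := by
  induction m with
  | zero => exact ⟨Fin.elim0, fun i => i.elim0, fun i => i.elim0⟩
  | succ m ih =>
    obtain ⟨X, hw, ea⟩ := ih
    obtain ⟨Y, hY, hP⟩ := h (max Xm (2 / σ * ∑ j, X j))
    refine ⟨Fin.cons Y X, ?_, ?_⟩
    · intro i; refine Fin.cases ?_ (fun i => ?_) i
      · exact ⟨(le_max_left _ _).trans hY, hP⟩
      · simpa using hw i
    · intro i j; refine Fin.cases ?_ (fun i => ?_) i <;> refine Fin.cases ?_ (fun j => ?_) j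
      · intro h; exact absurd h (lt_irrefl _)
      · intro _
        simp only [Fin.cons_succ, Fin.cons_zero]
        have ei := (le_max_right _ _).trans hY
        have et := single_le_sum (f := X) (fun j _ => hXm.trans (hw j).1) (mem_univ j)
        have ed : 2 / σ * X j ≤ Y := (mll et (by positivity)).trans ei
        rw [div_mul_eq_mul_div, div_le_iff₀ hσ] at ed; linarith
      · intro h; simp at h
      · intro h; simpa using ea i j (by simpa using h)
def Dat (Φ : PlaceSys K S) (𝓛 : S → Matrix ι ι K) (ω : ι → ℕ) (o : ι) (C B η X : ℝ) (c : S → ι → ℝ) : Prop :=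
  ∃ (Z : Matrix ι ι K) (U : S → Matrix ι ι K) (μ : S → ι → ℝ) (ℓ : ι → K) (κ : K),
    (∀ i j, Z i j ∈ Φ.R) ∧ Z.det ≠ 0 ∧ (∀ s i, U s i i = 1) ∧ (∀ s k i, k ≠ i → U s k i ≠ 0 → ω k < ω i) ∧
    (∀ s i, 0 < μ s i) ∧ (∀ s k i, Φ.w s ((𝓛 s * Z * U s) k i) ≤ C * exp (X * c s k) * μ s i) ∧
    (∀ i, i ≠ o → ∏ s, μ s i ≤ C) ∧ ∏ s, μ s o ≤ C * exp (B * X) ∧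
    vecMul ℓ Z = κ • Pi.single o 1 ∧ κ ≠ 0 ∧ ∏ s, Φ.w s κ ≤ C ∧ exp (η * X) ≤ ∏ s, ∑ i, Φ.w s (ℓ i)
lemma num_fin (Kc D g' M m Xm Dd ε B' Sn θ0 : ℝ) (hK : 1 ≤ Kc) (hD : 0 < D) (hM : 1 ≤ M) (hm : 1 ≤ m) (hXm : 0 < Xm) (hB : 1 ≤ B')
    (hSn : 0 ≤ Sn) (hg : 0 < g') (hDd : Dd * Xm ≤ m * D) (hXK : 4 * M * log Kc < g' * Xm)
    (hε : ε * (8 * M ^ 2 * B' * (Sn + 1)) ≤ g') (hε0 : 0 ≤ ε) (hθ : θ0 = g' / (4 * M * B')) :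
    Dd * log Kc + D * (- (m / M * g') + 2 * ε * m * M * B' * Sn + B' * (θ0 * m)) < 0 := by
  have hw : B' * (θ0 * m) = m * (g' / M) / 4 := by rw [hθ]; field_simp
  have ea : 2 * ε * m * M * B' * Sn ≤ m * (g' / M) / 4 := by
    have : 8 * ε * M ^ 2 * B' * Sn ≤ g' := by nlinarith [mul_nonneg hε0 (mul_nonneg (sq_nonneg M) (by linarith : 0 ≤ B'))]
    have : 8 * ε * M * B' * Sn ≤ g' / M := by rw [le_div_iff₀ (by linarith)]; nlinarith
    nlinarith
  have ee : m / M * g' = m * (g' / M) := by ring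
  have el : Dd * log Kc ≤ m * D / Xm * log Kc := by
    apply mlr _ (log_nonneg hK)
    rw [le_div_iff₀ hXm]; exact hDd
  have eb : log Kc / Xm < g' / M / 4 := by
    rw [div_div, div_lt_div_iff₀ hXm (by linarith)]; linarith
  have ew : m * D / Xm * log Kc = m * D * (log Kc / Xm) := by ring
  have aa : 0 < m * D := by positivity
  have bl := mul_lt_mul_of_pos_left eb aa
  have bg : 0 < g' / M := by positivity
  rw [hw, ee]
  have h10 := mll ea hD.le
  nlinarith
set_option maxHeartbeats 1000000 in
lemma thmA_core (Φ : PlaceSys K S) (𝓛 : S → Matrix ι ι K) (hL : ∀ s, (𝓛 s).det ≠ 0) (ω : ι → ℕ) (o : ι) (ho : ∀ i, ω i ≤ ω o)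
    (C' B η g' : ℝ) (hC : 1 ≤ C') (hB : 1 ≤ B) (hη : 0 < η) (hg : 0 < g') :
    ∃ ε : ℝ, 0 < ε ∧ ∀ cc : S → ι → ℝ, (∀ s k, |cc s k| ≤ B) → ∑ s, ∑ k, cc s k ≤ -g' →
      ¬ ∀ ao, ∃ X ≥ ao, Dat Φ 𝓛 ω o C' B η X cc := by
  classical
  haveI : Nonempty ι := ⟨o⟩
  set M : ℝ := (fc ι : ℝ) with hM
  have bk : 1 ≤ M := by rw [hM]; exact_mod_cast Fintype.card_pos
  set Sn : ℝ := (fc S : ℝ) with hSn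
  have hSn0 : 0 ≤ Sn := by rw [hSn]; positivity
  set ε : ℝ := min (1/2) (g' / (8 * M ^ 2 * B * (Sn + 1))) with hε
  have hεp : 0 < ε := by rw [hε]; positivity
  have hε2 : ε ≤ 1/2 := min_le_left _ _
  have hε3 : ε * (8 * M ^ 2 * B * (Sn + 1)) ≤ g' := by
    rw [← le_div_iff₀ (by positivity)]; exact min_le_right _ _
  clear_value ε
  refine ⟨ε, hεp, fun cc hcc hccg hdat => ?_⟩
  obtain ⟨r, hrR, hr0, hr⟩ := common_den Φ (fun p : S × ι × ι => (𝓛 p.1)⁻¹ p.2.1 p.2.2)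
  set 𝓘 : S → Matrix ι ι K := fun s => r • (𝓛 s)⁻¹ with h𝓘
  set 𝓜 : S → Matrix ι ι K := fun s => r⁻¹ • 𝓛 s with h𝓜
  have hIM : ∀ s, 𝓘 s * 𝓜 s = 1 := by
    intro s; simp only [h𝓘, h𝓜, smul_mul, Matrix.mul_smul, smul_smul, inv_mul_cancel₀ hr0, mul_inv_cancel₀ hr0, one_smul]
    exact nonsing_inv_mul _ (hL s).isUnit
  obtain ⟨m, hm, ec, bu, hP⟩ := aux_poly Φ 𝓘 (fun s i j => hr (s, i, j)) ε hεp
  set θ0 := g' / (4 * M * B) with hθ0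
  have hm' : (1:ℝ) ≤ m := mod_cast hm
  obtain ⟨σ, ap, hσ, hC0, hroth⟩ := roth Φ m (θ0 * m) (by positivity)
  set ek : ℝ := C' * (1 + ∑ s, Φ.w s r⁻¹) with hC2
  have hws : 0 ≤ ∑ s, Φ.w s r⁻¹ := sum_nonneg fun s _ => (Φ.w s).nonneg _
  have hC21 : C' ≤ ek := le_mul_of_one_le_right (by linarith) (by linarith)
  set em : ℝ := 1 + ∑ s, ∑ i, ∑ j, Φ.w s (𝓘 s i j) with bi
  have hc00 : 1 ≤ em := by
    have : 0 ≤ ∑ s, ∑ i, ∑ j, Φ.w s (𝓘 s i j) := sum_nonneg fun _ _ => sum_nonneg fun _ _ => sum_nonneg fun _ _ => (Φ.w _).nonneg _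
    linarith
  have hc0s : ∀ s i, ∑ j, Φ.w s (𝓘 s i j) ≤ em := by
    intro s i
    have hw := single_le_sum (f := fun i => ∑ j, Φ.w s (𝓘 s i j)) (fun _ _ => sum_nonneg fun _ _ => (Φ.w _).nonneg _) (mem_univ i)
    have ea := single_le_sum (f := fun s => ∑ i, ∑ j, Φ.w s (𝓘 s i j)) (fun _ _ => sum_nonneg fun _ _ => sum_nonneg fun _ _ => (Φ.w _).nonneg _) (mem_univ s)
    linarith
  clear_value em
  set Kc : ℝ := (ec * (em * (M * ek))) ^ fc S * ek with hKc
  have hKc1 : 1 ≤ Kc := by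
    refine one_le_mul_of_one_le_of_one_le (one_le_pow₀ (one_le_mul_of_one_le_of_one_le bu (one_le_mul_of_one_le_of_one_le hc00
      (one_le_mul_of_one_le_of_one_le bk ?_)))) ?_ <;> linarith
  set LC := log (C' * fc ι ^ fc S) with hLC
  have hlC1 : 0 ≤ log ec := log_nonneg bu
  set Xm : ℝ := 1 + 4 * M * log Kc / g' + 2 * |LC| / η + 4 * M * ap * (log ec + 1) * m / η with hXm
  have hlK := log_nonneg hKc1
  have t1 : 0 ≤ 4 * M * log Kc / g' := by positivity
  have t2 : 0 ≤ 2 * |LC| / η := by positivity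
  have t3 : 0 ≤ 4 * M * ap * (log ec + 1) * m / η := by positivity
  have hXm1 : 1 ≤ Xm := by linarith
  have hXK : 4 * M * log Kc < g' * Xm := by
    have : 4 * M * log Kc / g' < Xm := by linarith
    rw [div_lt_iff₀ hg] at this; linarith
  have hXL : 2 * |LC| < η * Xm := by
    have : 2 * |LC| / η < Xm := by linarith
    rw [div_lt_iff₀ hη] at this; linarith
  have hXC : 4 * M * ap * (log ec + 1) * m ≤ η * Xm := by
    have : 4 * M * ap * (log ec + 1) * m / η ≤ Xm := by linarith
    rw [div_le_iff₀ hη] at this; linarith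
  clear_value Xm
  obtain ⟨X', bm, hX2⟩ := seq_choice _ hdat σ hσ Xm (by linarith) m
  have hX1' : ∀ h, 1 ≤ X' h := fun h => hXm1.trans (bm h).1
  choose Z U μ ℓ κ hZ hZd ai hU hμ hN hμ1 hμo hℓ hκ hκC hH using fun h => (bm h).2
  have hht : ∀ h, ∃ en ep, en ≠ ep ∧ ℓ h en ≠ 0 ∧ ∃ β : CopFrac Φ, β.val = - ℓ h ep / ℓ h en ∧ η * X' h - LC ≤ M * β.ht := by
    intro h
    refine heights Φ (Z h) (hZ h) o (ℓ h) (κ h) (hκ h) (hℓ h) C' (η * X' h) hC (hκC h) (hH h) ?_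
    have ei := le_abs_self LC
    have et := mll (bm h).1 hη.le
    have ed := abs_nonneg LC
    linarith
  choose en ep hk ay β hβ hβh using hht
  set D : ℝ := (∑ h, X' h) / ε with hD
  have hXs : ∀ h, X' h ≤ ∑ h, X' h := fun h => single_le_sum (f := X') (fun j _ => (zero_le_one.trans (hX1' j))) (mem_univ h)
  have hXD : ∀ h, X' h ≤ ε * D := fun h => by rw [hD, mul_div_cancel₀ _ hεp.ne']; exact hXs h
  have hDp : 0 < D := by
    have := hXD ⟨0, by omega⟩; have := hX1' ⟨0, by omega⟩
    by_contra hn; nlinarith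
  clear_value D
  set d : Fin m → ℕ := fun h => ⌊D / X' h⌋₊ with hd
  have hXp : ∀ h, 0 < X' h := fun h => zero_lt_one.trans_le (hX1' h)
  have hd1 : ∀ h, X' h * d h ≤ D := by
    intro h
    have := Nat.floor_le (a := D / X' h) (div_nonneg hDp.le (hXp h).le)
    rw [le_div_iff₀ (hXp h)] at this; rw [mul_comm]; exact this
  have hd2 : ∀ h, D - X' h * d h ≤ ε * D := by
    intro h
    have := Nat.lt_floor_add_one (D / X' h)
    rw [div_lt_iff₀ (hXp h)] at this
    have := hXD h
    simp only [hd]; linarith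
  have hd0 : ∀ h, 1 ≤ d h := by
    intro h
    apply Nat.le_floor
    rw [Nat.cast_one, le_div_iff₀ (hXp h)]
    have := hXD h; nlinarith
  have hd3 : ∀ h, D / 2 ≤ X' h * d h := by intro h; have := hd2 h; nlinarith
  clear_value d
  obtain ⟨P, hP0, hPM, hPn, hPc⟩ := hP d hd0
  set Dt : ℕ := ∑ h, d h with hDt
  have hDtX : (Dt : ℝ) * Xm ≤ m * D := by
    rw [hDt]; push_cast; rw [sum_mul]
    refine (sum_le_sum (g := fun _ => D) fun h _ => ?_).trans (by simp)
    refine le_trans ?_ (hd1 h)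
    rw [mul_comm]; exact mlr (bm h).1 (Nat.cast_nonneg _)
  have hidx : ∀ J, (lsub Z (map (icr K) P)).coeff J ≠ 0 → θ0 * m ≤ wt (od d o) J := by
    refine idx_lower Φ ω o ho d hd0 P hPM 𝓘 𝓜 hIM Z hZ U ai hU μ hμ cc X' ek ec em ε B g' D (θ0 * m) (by linarith) (by linarith)
      (by linarith) hεp.le (by linarith) hDp.le (fun h => (hXp h).le) ?_ hPn hc0s hPc hd1 hd2 hcc hccg
      (fun h i hi => (hμ1 h i hi).trans hC21) (fun h => (hμo h).trans (mlr hC21 (exp_pos _).le)) ?_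
    · intro h s k i
      have ei : (𝓜 s * Z h * U h s) k i = r⁻¹ * (𝓛 s * Z h * U h s) k i := by
        simp only [h𝓜, smul_mul, Matrix.smul_apply, smul_eq_mul]
      rw [ei, map_mul]
      have et : Φ.w s r⁻¹ ≤ 1 + ∑ s, Φ.w s r⁻¹ := by
        have := single_le_sum (f := fun s => Φ.w s r⁻¹) (fun s _ => (Φ.w s).nonneg _) (mem_univ s)
        linarith
      have ed := mul_le_mul et (hN h s k i) ((Φ.w s).nonneg _) (by linarith)
      refine ed.trans (le_of_eq ?_); rw [hC2]; ring
    · have := num_fin Kc D g' M m Xm Dt ε B Sn θ0 hKc1 hDp bk hm' (by linarith) hB hSn0 hg hDtX hXK hε3 hεp.le hθ0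
      have ei : Kc ^ Dt = exp (Dt * log Kc) := by
        rw [exp_nat_mul, exp_log (by linarith)]
      rw [← hDt]
      change Kc ^ Dt * _ < 1
      rw [ei, ← exp_add, Real.exp_lt_one_iff]; exact this
  obtain ⟨F, hF0, hFd, hFn, hFi⟩ := roth_use d P hP0 hPM Z hZd o ℓ κ hκ hℓ en ep hk ay (fun h => (β h).val) hβ _ hidx
  refine Exists.elim (hroth d F (Dt * log ec) Dt β hd0 ?_ hF0 hFd (by positivity) ?_ ?_ ?_)
    (fun E hE => absurd (hFi E hE.1) (not_le.2 hE.2))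
  · intro i j hij
    have ei := hX2 i j hij
    have et := hd1 i
    have ed := hd3 j
    have : (d i : ℝ) * X' i ≤ σ * d j * X' i := by
      have : σ * X' i * d j ≥ 2 * X' j * d j := mlr ei (Nat.cast_nonneg _)
      linarith
    exact le_of_mul_le_mul_right this (hXp i)
  · refine hFn.trans (hPn.trans (le_of_eq ?_))
    rw [exp_nat_mul, exp_log (by linarith)]
  · intro h
    exact_mod_cast single_le_sum (f := d) (by simp) (mem_univ h)
  · intro h
    have ei := hβh h
    have et : η * X' h / 2 ≤ M * (β h).ht := by
      have := le_abs_self LC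
      have := mll (bm h).1 hη.le
      linarith
    have ed : η * D / 4 ≤ M * (d h * (β h).ht) := by
      have := mlr et (Nat.cast_nonneg (α := ℝ) (d h))
      have := mll (hd3 h) hη.le
      linarith
    have ev : ap * (Dt * log ec + Dt) * M * Xm ≤ η * D / 4 * Xm := by
      have q1 : 0 ≤ ap * (log ec + 1) * M := by positivity
      have q2 := mll hDtX q1
      have q3 := mlr hXC hDp.le
      linarith
    have am := le_of_mul_le_mul_right ev (by linarith)
    have ak : M * (ap * (Dt * log ec + Dt)) ≤ M * (d h * (β h).ht) := by linarith
    exact le_of_mul_le_mul_left ak (by linarith)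
lemma Dat.mono {Φ : PlaceSys K S} {𝓛 : S → Matrix ι ι K} {ω : ι → ℕ} {o : ι} {C B B' η X : ℝ} {c c' : S → ι → ℝ}
    (h : Dat Φ 𝓛 ω o C B η X c) (hC : 0 ≤ C) (hX : 0 ≤ X) (hB : B ≤ B') (hc : ∀ s k, c s k ≤ c' s k) : Dat Φ 𝓛 ω o C B' η X c' := by
  obtain ⟨Z, U, μ, ℓ, κ, hw, ea, ee, el, eb, ew, aa, bl, bg⟩ := h
  refine ⟨Z, U, μ, ℓ, κ, hw, ea, ee, el, eb, fun s k i => (ew s k i).trans ?_, aa, bl.trans ?_, bg⟩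
  · have := eb s i; have := hc s k; gcongr
  · gcongr
theorem thmA (Φ : PlaceSys K S) (𝓛 : S → Matrix ι ι K) (hL : ∀ s, (𝓛 s).det ≠ 0) (ω : ι → ℕ) (o : ι) (ho : ∀ i, ω i ≤ ω o)
    (C' B η g : ℝ) (hC : 1 ≤ C') (hB : 0 ≤ B) (hη : 0 < η) (hg : 0 < g) :
    ∃ ao, ∀ X ≥ ao, ∀ c : S → ι → ℝ, (∀ s k, |c s k| ≤ B) → ∑ s, ∑ k, c s k ≤ -g → ¬ Dat Φ 𝓛 ω o C' B η X c := by
  by_contra hno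
  push Not at hno
  obtain ⟨_, _, hcore⟩ := thmA_core Φ 𝓛 hL ω o ho C' (B + 1) η (g / 2) hC (by linarith) hη (by linarith)
  choose X hX c hc hcg hD using fun n : ℕ => hno n
  obtain ⟨a, _, φ, hφ, hlim⟩ := tendsto_subseq_of_bounded (x := c) (s := Metric.closedBall 0 B) Metric.isBounded_closedBall (by
    intro n; rw [mem_closedBall_zero_iff, pi_norm_le_iff_of_nonneg hB]; intro s
    rw [pi_norm_le_iff_of_nonneg hB]; intro k; exact hc n s k)
  set δ : ℝ := min (1/2) (g / (4 * (fc S * fc ι + 1))) with hδ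
  have hδp : 0 < δ := by rw [hδ]; positivity
  have hδ2 : δ ≤ 1 / 2 := min_le_left _ _
  have hδ3 : δ * (4 * (fc S * fc ι + 1)) ≤ g := by
    rw [← le_div_iff₀ (by positivity)]; exact min_le_right _ _
  obtain ⟨N, hN⟩ := Metric.tendsto_atTop.1 hlim δ hδp
  have hN' : ∀ n ≥ N, ∀ s k, |c (φ n) s k - a s k| ≤ δ := by
    intro n hn s k
    have hw := (hN n hn).le
    rw [dist_pi_le_iff hδp.le] at hw
    have ea := hw s
    rw [dist_pi_le_iff hδp.le] at ea
    exact ea k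
  refine hcore (fun s k => a s k + δ) ?_ ?_ ?_
  · intro s k
    have hw := abs_le.1 (hN' N le_rfl s k); have ea := abs_le.1 (hc (φ N) s k)
    rw [abs_le]; constructor <;> linarith
  · have hw : ∑ s, ∑ k, (a s k + δ) ≤ ∑ s, ∑ k, (c (φ N) s k + 2 * δ) := by
      refine sum_le_sum fun s _ => sum_le_sum fun k _ => ?_
      have hw := abs_le.1 (hN' N le_rfl s k); linarith
    refine hw.trans ?_
    simp only [sum_add_distrib, sum_const, card_univ, nsmul_eq_mul]
    have := hcg (φ N)
    linarith
  · intro ao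
    obtain ⟨n, hn⟩ := exists_nat_ge (max ao 0)
    have hw : n ≤ φ (max n N) := (le_max_left _ _).trans hφ.le_apply
    have ea : (n : ℝ) ≤ X (φ (max n N)) := le_trans (mod_cast hw) (hX _)
    refine ⟨X (φ (max n N)), (le_max_left _ _).trans (hn.trans ea), ?_⟩
    refine (hD _).mono (by linarith) ((le_max_right _ _).trans (hn.trans ea)) (by linarith) fun s k => ?_
    have hw := abs_le.1 (hN' _ (le_max_right n N) s k); linarith
end thmA
end
section
open MvPolynomial
section cmpd
variable {K : Type} [Field K] {n q : ℕ}
instance ftE : Fintype (Fin q ↪o Fin n) := Fintype.ofInjective (fun f => (f : Fin q → Fin n)) DFunLike.coe_injective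
def cm (q : ℕ) (A : Mx n K) : Matrix (Fin q ↪o Fin n) (Fin q ↪o Fin n) K :=
  of fun I J => (A.submatrix I J).det
lemma cm_eq (A : Mx n K) : cm q A =
    (LinearMap.toMatrix ((Pi.basisFun K (Fin n)).exteriorPower q) ((Pi.basisFun K (Fin n)).exteriorPower q)
      (exteriorPower.map q (Matrix.toLin' A))).submatrix Set.powersetCard.ofFinEmbEquiv Set.powersetCard.ofFinEmbEquiv := by
  ext I J
  rw [Matrix.submatrix_apply, LinearMap.toMatrix_apply, exteriorPower.basis_apply, exteriorPower.map_apply_ιMulti_family,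
    exteriorPower.basis_repr_apply, exteriorPower.ιMulti_family, exteriorPower.ιMultiDual_apply_ιMulti, cm, of_apply, ← Matrix.det_transpose]
  congr 1
  ext i j
  simp
lemma cm_mul (A B : Mx n K) : cm q (A * B) = cm q A * cm q B := by
  classical
  rw [cm_eq, cm_eq, cm_eq, Matrix.toLin'_mul, exteriorPower.map_comp,
    LinearMap.toMatrix_comp _ ((Pi.basisFun K (Fin n)).exteriorPower q), Matrix.submatrix_mul_equiv]
lemma cm_one_one : cm q (1 : Mx n K) = 1 := by
  classical
  rw [cm_eq, Matrix.toLin'_one, exteriorPower.map_id, LinearMap.toMatrix_id, Matrix.submatrix_one_equiv]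
lemma cm_smul (c : K) (A : Mx n K) : cm q (c • A) = c ^ q • cm q A := by
  ext I J
  simp [cm, Matrix.submatrix_smul, Matrix.det_smul]
lemma cm_mem (R : Subring K) (A : Mx n K) (h : ∀ i j, A i j ∈ R) (I J) : cm q A I J ∈ R := by
  rw [cm, of_apply, det_apply]
  exact Subring.sum_mem _ fun π _ => by
    rw [Units.smul_def, zsmul_eq_mul]
    exact R.mul_mem (intCast_mem _ _) (Subring.prod_mem _ fun i _ => h _ _)
lemma w_det_le (w : AV K) (A : Matrix (Fin q) (Fin q) K) (a b : Fin q → ℝ)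
    (h : ∀ i j, w (A i j) ≤ a i * b j) : w A.det ≤ q.factorial * ((∏ i, a i) * ∏ i, b i) := by
  rw [det_apply]
  refine (w.sum_le _ _).trans ((sum_le_card_nsmul _ _ ((∏ i, a i) * ∏ i, b i) fun π _ => ?_).trans (by simp [Fintype.card_perm]))
  rw [Units.smul_def, zsmul_eq_mul, map_mul, AbsoluteValue.map_units_intCast, one_mul, map_prod, ← Equiv.prod_comp π a, ← prod_mul_distrib]
  exact prod_le_prod (fun i _ => w.nonneg _) fun i _ => h _ _
lemma cm_bound (w : AV K) (A : Mx n K) (a b : Fin n → ℝ)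
    (h : ∀ i j, w (A i j) ≤ a i * b j) (I J) : w (cm q A I J) ≤ q.factorial * ((∏ i, a (I i)) * ∏ i, b (J i)) :=
  w_det_le w _ (fun i => a (I i)) (fun i => b (J i)) fun i j => h _ _
def om (J : Fin q ↪o Fin n) : ℕ := ∑ i, (J i : ℕ)
lemma emb_eq (I J : Fin q ↪o Fin n) (π : Perm (Fin q)) (h : ∀ i, I (π i) = J i) : I = J := by
  have hw : Set.range I = Set.range J := by
    have : (J : Fin q → Fin n) = I ∘ π := funext fun i => (h i).symm
    rw [this, π.surjective.range_comp]
  exact (OrderEmbedding.range_inj).1 hw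
lemma cm_upper (U : Mx n K) (hw : ∀ i, U i i = 1) (ea : ∀ k i, U k i ≠ 0 → k ≤ i) :
    (∀ J, cm q U J J = 1) ∧ ∀ I J, I ≠ J → cm q U I J ≠ 0 → om I < om J := by
  constructor
  · intro J
    rw [cm, of_apply, Matrix.det_of_upperTriangular]
    · exact prod_eq_one fun i _ => hw _
    · intro i j hij
      by_contra hne
      exact absurd (ea _ _ hne) (not_le.2 (J.lt_iff_lt.2 hij))
  · intro I J hIJ hne
    rw [cm, of_apply, det_apply] at hne
    obtain ⟨π, _, hπ⟩ := exists_ne_zero_of_sum_ne_zero hne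
    have ee : ∀ i, I (π i) ≤ J i := fun i => ea _ _ fun eo => hπ (by
      rw [prod_eq_zero (mem_univ i) (by exact eo), smul_zero])
    rw [om, om, ← Equiv.sum_comp π (fun i => (I i : ℕ))]
    refine sum_lt_sum (fun i _ => ee i) ?_
    by_contra hno
    push Not at hno
    exact hIJ (emb_eq I J π fun i => le_antisymm (ee i) (Fin.le_def.2 (hno i (mem_univ i))))
def top (p q n : ℕ) (h : p + q = n) : Fin q ↪o Fin n := (Fin.natAddOrderEmb p).trans (Fin.castOrderIso h).toOrderEmbedding
lemma top_val (p q n : ℕ) (h : p + q = n) (i : Fin q) : (top p q n h i : ℕ) = p + i := by simp [top]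
lemma emb_le_top (p q n : ℕ) (h : p + q = n) (J : Fin q ↪o Fin n) (i : Fin q) : J i ≤ top p q n h i := by
  have hw : ∀ k : ℕ, ∀ i : Fin q, (i : ℕ) + k + 1 = q → (J i : ℕ) + k + 1 ≤ n := by
    intro k
    induction k with
    | zero => intro i _; have := (J i).2; omega
    | succ k ih =>
      intro i hi
      have ea := ih ⟨i + 1, by omega⟩ (by simp; omega)
      have ee : J i < J ⟨i + 1, by omega⟩ := J.lt_iff_lt.2 (by simp [Fin.lt_def])
      rw [Fin.lt_def] at ee; omega
  rw [Fin.le_def, top_val]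
  have := hw (q - 1 - i) i (by have := i.2; omega)
  have := i.2; omega
lemma om_top (p q n : ℕ) (h : p + q = n) (J : Fin q ↪o Fin n) (hJ : J ≠ top p q n h) : om J < om (top p q n h) := by
  refine sum_lt_sum (fun i _ => emb_le_top p q n h J i) ?_
  by_contra hno
  push Not at hno
  exact hJ (by ext i; exact le_antisymm (Fin.le_def.1 (emb_le_top p q n h J i)) (hno i (mem_univ i)))
lemma ne_top_low (p q n : ℕ) (h : p + q = n) (J : Fin q ↪o Fin n) (hJ : J ≠ top p q n h) : ∃ i, (J i : ℕ) < p := by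
  by_contra hno
  push Not at hno
  apply hJ
  ext i
  refine le_antisymm (Fin.le_def.1 (emb_le_top p q n h J i)) ?_
  rw [top_val]
  have : ∀ k : ℕ, ∀ hk : k < q, p + k ≤ J ⟨k, hk⟩ := by
    intro k
    induction k with
    | zero => intro hk; simpa using hno ⟨0, hk⟩
    | succ k ih =>
      intro hk
      have ee : J ⟨k, by omega⟩ < J ⟨k + 1, hk⟩ := J.lt_iff_lt.2 (by simp [Fin.lt_def])
      have := ih (by omega)
      rw [Fin.lt_def] at ee; omega
  exact this i i.2
lemma minors_zero (p q n : ℕ) (h : p + q = n) (M : Matrix (Fin q) (Fin n) K)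
    (eo : ∀ J : Fin q ↪o Fin n, J ≠ top p q n h → (M.submatrix id J).det = 0)
    (hw : (M.submatrix id (top p q n h)).det ≠ 0) (l : Fin n) (hl : (l : ℕ) < p) (i : Fin q) : M i l = 0 := by
  classical
  set T := M.submatrix id (top p q n h) with hT
  have ea := Matrix.mulVec_cramer T (fun i => M i l)
  have ee : Matrix.cramer T (fun i => M i l) = 0 := by
    ext j
    rw [Matrix.cramer_apply, Pi.zero_apply]
    set f : Fin q → Fin n := Function.update (top p q n h) j l with hf
    have ei : T.updateCol j (fun i => M i l) = M.submatrix id f := by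
      ext a b
      by_cases hb : b = j
      · subst hb; simp [hf]
      · simp [hf, hb, hT]
    have finj : Injective f := by
      have hne : ∀ c, top p q n h c ≠ l := fun c hc => by
        have := top_val p q n h c; rw [hc] at this; omega
      intro a b hab
      by_cases ha : a = j <;> by_cases hb : b = j
      · rw [ha, hb]
      · subst ha; simp only [hf, update_self, update_of_ne hb] at hab; exact absurd hab.symm (hne _)
      · subst hb; simp only [hf, update_self, update_of_ne ha] at hab; exact absurd hab (hne _)
      · simp only [hf, update_of_ne ha, update_of_ne hb] at hab; exact (top p q n h).injective hab
    set π := Tuple.sort f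
    have hm : StrictMono (f ∘ π) := (Tuple.monotone_sort f).strictMono_of_injective (finj.comp π.injective)
    have et := eo (OrderEmbedding.ofStrictMono _ hm) (by
      intro hc
      have : f (π (π.symm j)) = top p q n h (π.symm j) := DFunLike.congr_fun hc (π.symm j)
      have eb := top_val p q n h (π.symm j)
      rw [← this, Equiv.apply_symm_apply, hf, update_self] at eb; omega)
    have ed : M.submatrix id (OrderEmbedding.ofStrictMono _ hm) = (M.submatrix id f).submatrix id π := by ext; rfl
    rw [ed, Matrix.det_permute'] at et
    rw [ei]
    rcases mul_eq_zero.1 et with ew | ew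
    · rcases Int.units_eq_one_or (Perm.sign π) with aa | aa <;> rw [aa] at ew <;> norm_num at ew
    · exact ew
  rw [ee, mulVec_zero] at ea
  have := congrFun ea i
  simp only [Pi.zero_apply, Pi.smul_apply, smul_eq_mul] at this
  exact (mul_eq_zero.1 this.symm).resolve_left hw
end cmpd
end
section
open MvPolynomial
section red
variable {K : Type} [Field K] {n : ℕ}
lemma nearmin (R : Subring K) (H : (Fin n → K) → ℝ) (c : ℝ) (hc : 0 < c) (hH : ∀ y, (∀ i, y i ∈ R) → y ≠ 0 → c ≤ H y) :
    ∃ Z : Mx n K, (∀ i j, Z i j ∈ R) ∧ Z.det ≠ 0 ∧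
      ∀ a, (∀ i, Z.mulVec a i ∈ R) → ∀ k l, k ≤ l → a l ≠ 0 → H (fun r => Z r k) ≤ 2 * H (Z.mulVec a) := by
  classical
  have step : ∀ T : Submodule K (Fin n → K), T ≠ ⊤ → ∃ z : Fin n → K, (∀ i, z i ∈ R) ∧ z ∉ T ∧
      ∀ y : Fin n → K, (∀ i, y i ∈ R) → y ∉ T → H z ≤ 2 * H y := by
    intro T hT
    set A : Set ℝ := H '' {y | (∀ i, y i ∈ R) ∧ y ∉ T}
    have hA : A.Nonempty := by
      by_contra hno
      apply hT
      rw [eq_top_iff, ← (Pi.basisFun K (Fin n)).span_eq, Submodule.span_le]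
      rintro _ ⟨i, rfl⟩
      by_contra hi
      refine hno ⟨_, _, ⟨fun j => ?_, hi⟩, rfl⟩
      rw [Pi.basisFun_apply, Pi.single_apply]; split_ifs; exacts [R.one_mem, R.zero_mem]
    have hAc : ∀ x ∈ A, c ≤ x := by
      rintro _ ⟨y, ⟨hw, ea⟩, rfl⟩
      exact hH y hw fun eo => ea (eo ▸ T.zero_mem)
    have hi : c ≤ sInf A := le_csInf hA hAc
    obtain ⟨_, ⟨z, ⟨hz1, hz2⟩, rfl⟩, hz⟩ := exists_lt_of_csInf_lt hA (show sInf A < 2 * sInf A by linarith)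
    refine ⟨z, hz1, hz2, fun y hw ea => ?_⟩
    have := csInf_le ⟨c, hAc⟩ (show H y ∈ A from ⟨y, ⟨hw, ea⟩, rfl⟩)
    linarith
  choose! f ad ag hf3 using step
  set g : ℕ → Submodule K (Fin n → K) := fun i => Nat.rec ⊥ (fun _ T => T ⊔ span K {f T}) i with hg
  have gs : ∀ i, g (i + 1) = g i ⊔ span K {f (g i)} := fun i => rfl
  have gm : Monotone g := monotone_nat_of_le_succ fun i => by rw [gs]; exact le_sup_left
  have gr : ∀ i, Module.finrank K (g i) ≤ i := by
    intro i
    induction i with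
    | zero => exact (finrank_bot K (Fin n → K)).le
    | succ i ih =>
      rw [gs]
      have hw := Submodule.finrank_add_le_finrank_add_finrank (g i) (span K {f (g i)})
      have ea := finrank_span_le_card (R := K) ({f (g i)} : Set (Fin n → K))
      simp at ea; omega
  have gt : ∀ i : Fin n, g i ≠ ⊤ := fun i h => by
    have := gr i; rw [h, finrank_top, Module.finrank_fin_fun] at this; omega
  have key : ∀ a : Fin n → K, ∀ k l : Fin n, k ≤ l → a l ≠ 0 → (of fun r i => f (g (i : Fin n)) r).mulVec a ∉ g k := by
    intro a k l hkl hl hy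
    obtain ⟨m, hm, hmax⟩ := exists_max_image (univ.filter fun i => a i ≠ 0) id ⟨l, by simpa using hl⟩
    simp only [mem_filter, mem_univ, true_and, id] at hm hmax
    apply ag (g m) (gt m)
    have ei : (of fun r (i : Fin n) => f (g i) r).mulVec a = ∑ i, a i • f (g i) := by
      ext r; simp [mulVec, dotProduct, mul_comm]
    rw [ei, ← add_sum_erase _ _ (mem_univ m)] at hy
    have et : ∑ i ∈ univ.erase m, a i • f (g i) ∈ g m := by
      refine Submodule.sum_mem _ fun i hi => ?_
      by_cases hai : a i = 0
      · rw [hai, zero_smul]; exact Submodule.zero_mem _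
      · have ee : i < m := lt_of_le_of_ne (hmax i hai) (ne_of_mem_erase hi)
        refine smul_mem _ _ (gm (show (i : ℕ) + 1 ≤ m from ee) ?_)
        rw [gs]; exact le_sup_right (a := g i) (Submodule.mem_span_singleton_self _)
    have ed := (Submodule.add_mem_iff_left _ et).1 (gm (show (k : ℕ) ≤ m from hkl.trans (hmax l hl)) hy)
    exact (Submodule.smul_mem_iff _ hm).1 ed
  refine ⟨of fun r i => f (g i) r, fun i j => ad _ (gt j) i, ?_, ?_⟩
  · intro hd
    obtain ⟨v, hv, ac⟩ := Matrix.exists_mulVec_eq_zero_iff.2 hd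
    obtain ⟨l, hl⟩ := ne_iff.1 hv
    apply key v l l le_rfl hl
    rw [ac]; exact Submodule.zero_mem _
  · intro a ha k l hkl hl
    exact hf3 (g k) (gt k) _ ha (key a k l hkl hl)
lemma uni_det (U : Mx n K) (hw : ∀ i, U i i = 1) (ea : ∀ k i, U k i ≠ 0 → k ≤ i) : U.det = 1 := by
  rw [Matrix.det_of_upperTriangular]
  · exact prod_eq_one fun i _ => hw i
  · intro i j hij; by_contra hne; exact absurd (ea _ _ hne) (not_le.2 hij)
lemma uni_top (U : Mx n K) (hw : ∀ i, U i i = 1) (ea : ∀ k i, U k i ≠ 0 → k ≤ i) (a : Fin n → K) (ha : a ≠ 0) :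
    ∃ k, a k ≠ 0 ∧ (∀ l, k < l → a l = 0) ∧ U.mulVec a k = a k := by
  classical
  obtain ⟨l, hl⟩ := ne_iff.1 ha
  obtain ⟨m, hm, hmax⟩ := exists_max_image (univ.filter fun i => a i ≠ 0) id ⟨l, by simpa using hl⟩
  simp only [mem_filter, mem_univ, true_and, id] at hm hmax
  have ee : ∀ l, m < l → a l = 0 := fun l hl => by by_contra h; exact absurd (hmax l h) (not_le.2 hl)
  refine ⟨m, hm, ee, ?_⟩
  rw [mulVec, dotProduct, sum_eq_single m]
  · rw [hw, one_mul]
  · intro b _ hb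
    rcases lt_or_gt_of_ne hb with h | h
    · rw [show U m b = 0 by by_contra hne; exact absurd (ea _ _ hne) (not_le.2 h), zero_mul]
    · rw [ee b h, mul_zero]
  · simp
lemma pivot (w : AV K) (G : Mx n K) (hG : G.det ≠ 0) (s : Fin n → ℝ) (hs : ∀ i, 0 < s i) :
    ∃ U : Mx n K, (∀ i, U i i = 1) ∧ (∀ k i, U k i ≠ 0 → k ≤ i) ∧ ∃ σ : Perm (Fin n),
      (∀ k i, k < i → (G * U) (σ k) i = 0) ∧ (∀ i k, w ((G * U) k i) * s k ≤ w ((G * U) (σ i) i) * s (σ i)) ∧ ∀ i, (G * U) (σ i) i ≠ 0 := by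
  classical
  have key : ∀ m : ℕ, ∃ U : Mx n K, (∀ i, U i i = 1) ∧ (∀ k i, U k i ≠ 0 → k ≤ i) ∧ ∃ σ : Fin n → Fin n,
      (∀ k i : Fin n, k < i → (k : ℕ) < m → (G * U) (σ k) i = 0) ∧
      ∀ i : Fin n, (i : ℕ) < m → (∀ k, w ((G * U) k i) * s k ≤ w ((G * U) (σ i) i) * s (σ i)) ∧ (G * U) (σ i) i ≠ 0 := by
    intro m
    induction m with
    | zero => exact ⟨1, by simp, fun k i h => by by_contra hne; exact h (Matrix.one_apply_ne fun e => hne e.le), id, by simp, by simp⟩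
    | succ m ih =>
      obtain ⟨U, hw, ea, σ, ee, el⟩ := ih
      by_cases hmn : m < n
      swap
      · exact ⟨U, hw, ea, σ, fun k i hk _ => ee k i hk (by omega), fun i _ => el i (by omega)⟩
      set μ : Fin n := ⟨m, hmn⟩ with hμ
      set Γ := G * U with hΓ
      obtain ⟨κ, _, hκ⟩ := exists_max_image univ (fun k => w (Γ k μ) * s k) ⟨μ, mem_univ _⟩
      have hp : Γ κ μ ≠ 0 := by
        intro eo
        have : Γ.det = 0 := Matrix.det_eq_zero_of_column_eq_zero μ fun k => by
          have := hκ k (mem_univ k)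
          rw [eo, map_zero, zero_mul] at this
          by_contra hne
          exact absurd this (not_le.2 (mul_pos (w.pos hne) (hs k)))
        rw [hΓ, det_mul, uni_det U hw ea, mul_one] at this
        exact hG this
      set v : Fin n → K := fun i => if μ < i then Γ κ i / Γ κ μ else 0 with hv
      have ac : ∀ i, i ≤ μ → v i = 0 := fun i hi => if_neg (not_lt.2 hi)
      have hU0 : ∀ k i, i < k → U k i = 0 := fun k i h => by by_contra hne; exact absurd (ea _ _ hne) (not_le.2 h)
      have hG' : ∀ k i, (G * of fun k i => U k i - U k μ * v i) k i = Γ k i - Γ k μ * v i := by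
        intro k i
        simp only [Matrix.mul_apply, of_apply, mul_sub, sum_sub_distrib, hΓ, sum_mul, mul_assoc]
      refine ⟨of fun k i => U k i - U k μ * v i, ?_, ?_, Function.update σ μ κ, ?_, ?_⟩
      · intro i
        rcases le_or_gt i μ with h | h
        · simp [ac i h, hw]
        · simp [hU0 i μ h, hw]
      · intro k i hki
        by_contra hlt
        push Not at hlt
        apply hki
        rcases le_or_gt i μ with h | h
        · simp [ac i h, hU0 k i hlt]
        · simp [hU0 k μ (h.trans hlt), hU0 k i hlt]
      · intro k i hk hkm
        rw [hG']
        by_cases hkμ : k = μ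
        · rw [hkμ, update_self, hv]; simp only
          rw [if_pos (hkμ ▸ hk), mul_div_cancel₀ _ hp, sub_self]
        · rw [update_of_ne hkμ]
          have hk' : (k : ℕ) < m := lt_of_le_of_ne (by omega) fun h => hkμ (Fin.ext h)
          rw [ee k i hk hk', ee k μ hk' hk', zero_mul, sub_zero]
      · intro i hi
        simp only [hG', ac i (Fin.le_def.2 (by rw [hμ]; simp only; omega)), mul_zero, sub_zero]
        by_cases hiμ : i = μ
        · rw [hiμ, update_self]; exact ⟨fun k => hκ k (mem_univ k), hp⟩
        · rw [update_of_ne hiμ]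
          exact el i (lt_of_le_of_ne (by omega) fun h => hiμ (Fin.ext h))
  obtain ⟨U, hw, ea, σ, ee, el⟩ := key n
  have hinj : Injective σ := by
    intro a b hab
    by_contra hne
    rcases lt_or_gt_of_ne hne with h | h
    · exact (el b b.2).2 (hab ▸ ee a b h a.2)
    · exact (el a a.2).2 (hab ▸ ee b a h b.2)
  exact ⟨U, hw, ea, ofBijective σ (Finite.injective_iff_bijective.1 hinj), fun k i h => ee k i h k.2, fun i => (el i i.2).1, fun i => (el i i.2).2⟩
lemma dom (w : AV K) (Γ : Mx n K) (s : Fin n → ℝ) (hs : ∀ i, 0 < s i) (σ : Perm (Fin n))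
    (eo : ∀ k i, k < i → Γ (σ k) i = 0) (hm : ∀ i k, w (Γ k i) * s k ≤ w (Γ (σ i) i) * s (σ i)) (a : Fin n → K) (β : ℝ) (k : Fin n)
    (hβ : ∀ l ≤ k, w (Γ.mulVec a (σ l)) * s (σ l) ≤ β) : w (a k) * (w (Γ (σ k) k) * s (σ k)) ≤ 2 ^ (k : ℕ) * β := by
  classical
  induction k using WellFoundedLT.induction with
  | ind k ih =>
    have ei : Γ (σ k) k * a k = Γ.mulVec a (σ k) - ∑ l ∈ Iio k, Γ (σ k) l * a l := by
      rw [mulVec, dotProduct, eq_sub_iff_add_eq, ← sum_insert (s := Iio k) (f := fun l => Γ (σ k) l * a l) (by simp)]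
      refine sum_subset (subset_univ _) fun l _ hl => ?_
      simp only [mem_insert, mem_Iio, not_or, not_lt] at hl
      rw [eo k l (lt_of_le_of_ne hl.2 (Ne.symm hl.1)), zero_mul]
    have et : w (Γ (σ k) k * a k) ≤ w (Γ.mulVec a (σ k)) + ∑ l ∈ Iio k, w (Γ (σ k) l * a l) := by
      rw [ei, sub_eq_add_neg]
      refine (w.add_le _ _).trans ?_
      rw [w.map_neg]
      exact add_le_add_right (w.sum_le _ _) _
    have ed := mlr et (hs (σ k)).le
    rw [map_mul, add_mul, sum_mul] at ed
    have ev : ∑ l ∈ Iio k, w (Γ (σ k) l * a l) * s (σ k) ≤ ∑ l ∈ Iio k, 2 ^ (l : ℕ) * β := by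
      refine sum_le_sum fun l hl => ?_
      rw [mem_Iio] at hl
      refine le_trans ?_ (ih l hl fun l' hl' => hβ l' (hl'.trans hl.le))
      rw [map_mul]
      have := mll (hm l (σ k)) (w.nonneg (a l))
      linarith
    have am : ∑ l ∈ Iio k, (2:ℝ) ^ (l : ℕ) = 2 ^ (k : ℕ) - 1 := by
      have hw := sum_map (Iio k) Fin.valEmbedding (fun i => (2:ℝ) ^ i)
      rw [Fin.map_valEmbedding_Iio, Nat.Iio_eq_range, geom_sum_eq (by norm_num)] at hw
      simp only [Fin.valEmbedding_apply] at hw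
      rw [← hw]; norm_num
    rw [← sum_mul (s := Iio k) (f := fun l : Fin n => (2:ℝ) ^ (l : ℕ)), am] at ev
    have := hβ k le_rfl
    linarith
lemma piv_det (w : AV K) (Γ : Mx n K) (σ : Perm (Fin n))
    (eo : ∀ k i, k < i → Γ (σ k) i = 0) : w Γ.det = ∏ i, w (Γ (σ i) i) := by
  have hw := Matrix.det_permute σ Γ
  rw [Matrix.det_of_lowerTriangular] at hw
  · have ea := congrArg w hw
    rw [map_mul, AbsoluteValue.map_units_intCast, one_mul, map_prod] at ea
    exact ea.symm
  · intro i j hij; exact eo i j hij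
end red
end
section
open MvPolynomial
section red2
variable {K : Type} [Field K] {S : Type} [Fintype S] {n : ℕ}
structure Red (Φ : PlaceSys K S) (L : S → Mx n K) (C : ℝ) (s : S → Fin n → ℝ) where
  Z : Mx n K
  t : Fin n → ℝ
  U : S → Mx n K
  σ : S → Perm (Fin n)
  p : S → Fin n → ℝ
  hZ : ∀ i j, Z i j ∈ Φ.R
  hd : Z.det ≠ 0
  hdC : ∏ v, Φ.w v Z.det ≤ C
  t0 : ∀ i, 0 < t i
  tm : ∀ k l, k ≤ l → t k ≤ 2 * t l
  ty : ∀ a, (∀ i, Z.mulVec a i ∈ Φ.R) → (∀ v i, Φ.w v ((L v).mulVec (Z.mulVec a) i) * s v i ≤ 1) → ∀ l, a l ≠ 0 → t l ≤ C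
  U1 : ∀ v i, U v i i = 1
  U2 : ∀ v k i, U v k i ≠ 0 → k ≤ i
  piv0 : ∀ v k i, k < i → (L v * Z * U v) (σ v k) i = 0
  hp : ∀ v i, p v i = Φ.w v ((L v * Z * U v) (σ v i) i) * s v (σ v i)
  piv : ∀ v i k, Φ.w v ((L v * Z * U v) k i) * s v k ≤ p v i
  p0 : ∀ v i, 0 < p v i
  tau1 : ∀ i, ∏ v, p v i ≤ C * t i
  tau2 : ∀ i, t i ≤ C * ∏ v, p v i
  st : ∏ v, ∏ i, s v i ≤ C * ∏ i, t i
  ts : ∏ i, t i ≤ C * ∏ v, ∏ i, s v i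
  tl : ∀ M, 1 ≤ M → (∀ v i, 1 ≤ M * s v i) → ∀ i, 1 ≤ C * M ^ fc S * t i
lemma red_num (t τ : Fin n → ℝ) (ht : ∀ i, 0 < t i) (hτ : ∀ i, 0 < τ i) (ec ek ey d sp : ℝ) (bu : 0 < ec) (hC2 : 1 ≤ ek) (hD : 0 < ey) (hd : 1 ≤ d) (hs : 0 < sp)
    (hw : ∏ i, t i ≤ ec * sp) (ea : ∀ i, τ i ≤ ek * t i) (ee : ∏ i, τ i = ey * d * sp) :
    d ≤ ek ^ n * ec / ey ∧ sp ≤ ek ^ n / ey * ∏ i, t i ∧ ∀ i, t i ≤ ek ^ n * ec / ey * τ i := by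
  have el : ∏ i, τ i ≤ ek ^ n * ∏ i, t i := by
    refine (prod_le_prod (fun i _ => (hτ i).le) fun i _ => ea i).trans (le_of_eq ?_)
    rw [prod_mul_distrib]; simp
  have hC2n : 0 < ek ^ n := by positivity
  refine ⟨?_, ?_, fun i => ?_⟩
  · rw [le_div_iff₀ hD]
    have eb : (d * ey) * sp ≤ (ek ^ n * ec) * sp := by
      have := mll hw hC2n.le
      linarith
    exact le_of_mul_le_mul_right eb hs
  · rw [div_mul_eq_mul_div, le_div_iff₀ hD]
    have := mll hd (mul_pos hD hs).le
    linarith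
  · have eb : ∏ k ∈ univ.erase i, τ k ≤ ek ^ n * ∏ k ∈ univ.erase i, t k := by
      refine (prod_le_prod (fun i _ => (hτ i).le) fun i _ => ea i).trans ?_
      rw [prod_mul_distrib, prod_const]
      refine mlr (pow_le_pow_right₀ hC2 ?_) (prod_nonneg fun i _ => (ht i).le)
      refine (card_le_univ _).trans (by simp)
    have ew := mul_prod_erase univ t (mem_univ i)
    have aa := mul_prod_erase univ τ (mem_univ i)
    have hP : 0 < ∏ k ∈ univ.erase i, t k := prod_pos fun i _ => ht i
    rw [div_mul_eq_mul_div, le_div_iff₀ hD]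
    refine le_of_mul_le_mul_right (a := ∏ k ∈ univ.erase i, t k) ?_ hP
    have bl := mll eb (hτ i).le
    rw [aa, ee] at bl
    have bg : ey * sp ≤ ey * d * sp := by
      have := mll hd (mul_pos hD hs).le
      linarith
    have h10 := mll (bg.trans bl) bu.le
    have h11 := mll hw hD.le
    rw [← ew] at h11
    linarith
lemma dav (Φ : PlaceSys K S) (er : S) (hn : 1 ≤ n) (L : S → Mx n K) (hL : ∀ v, (L v).det ≠ 0) :
    ∃ ec : ℝ, 0 < ec ∧ ∀ (s : S → Fin n → ℝ) (hs : ∀ v i, 0 < s v i) (Z U : Mx n K) (t : Fin n → ℝ) (σ : Perm (Fin n)),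
      Z.det ≠ 0 → (∀ i, 0 < t i) → (∀ k l, k ≤ l → t k ≤ 2 * t l) →
      (∀ a, (∀ i, Z.mulVec a i ∈ Φ.R) → ∀ l, a l ≠ 0 → t l ≤ 2 * ∏ v, ∑ i, Φ.w v ((L v).mulVec (Z.mulVec a) i) * s v i) →
      (∀ i, U i i = 1) → (∀ k i, U k i ≠ 0 → k ≤ i) → (∀ k i, k < i → (L er * Z * U) (σ k) i = 0) →
      (∀ i k, Φ.w er ((L er * Z * U) k i) * s er k ≤ Φ.w er ((L er * Z * U) (σ i) i) * s er (σ i)) →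
      ∏ i, t i ≤ ec * ∏ v, ∏ i, s v i := by
  classical
  obtain ⟨C, hC, hmink⟩ := Φ.mink n L hn hL
  set bv : ℝ := (2 * (n : ℝ) ^ fc S * (n * 2 ^ n * 2) * 2)⁻¹ with hA0
  have hn' : (0:ℝ) < n := mod_cast hn
  have hA0p : 0 < bv := by rw [hA0]; positivity
  refine ⟨C / bv ^ n, by positivity, fun s hs Z U t σ hZ ht htm hty ai ba eo hm => ?_⟩
  by_contra hcon
  push Not at hcon
  have hsp : 0 < ∏ v, ∏ i, s v i := prod_pos fun v _ => prod_pos fun i _ => hs v i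
  set A : S → Fin n → ℝ := fun v k => (if v = er then bv * t (σ.symm k) else 1) / s v k with hA
  obtain ⟨y, bd, hyR, hy⟩ := hmink A (fun v k => by
      simp only [hA]; refine div_pos ?_ (hs v k); split_ifs; exacts [mul_pos hA0p (ht _), one_pos]) (by
    have ei : ∏ v, ∏ i, A v i = bv ^ n * (∏ i, t i) / ∏ v, ∏ i, s v i := by
      simp only [hA, prod_div_distrib]
      congr 1
      rw [prod_eq_single er (fun v _ hv => by simp [hv]) (by simp)]
      simp only [if_true, prod_mul_distrib, prod_const, card_univ, Fintype.card_fin]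
      rw [Equiv.prod_comp σ.symm t]
    rw [ei, le_div_iff₀ hsp]
    rw [div_mul_eq_mul_div, div_lt_iff₀ (by positivity)] at hcon
    linarith)
  have hUd := uni_det U ai ba
  set a' := U⁻¹.mulVec (Z⁻¹.mulVec y) with ha'
  have hya : Z.mulVec (U.mulVec a') = y := by
    have : U.mulVec a' = Z⁻¹.mulVec y := by
      rw [ha', mulVec_mulVec, mul_nonsing_inv _ (by rw [hUd]; exact isUnit_one), one_mulVec]
    rw [this, mulVec_mulVec, mul_nonsing_inv _ hZ.isUnit, one_mulVec]
  have bc : a' ≠ 0 := by intro h; rw [h, mulVec_zero, mulVec_zero] at hya; exact bd hya.symm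
  obtain ⟨k, bt, hk2, bw⟩ := uni_top U ai ba a' bc
  have hLy : ∀ v, (L v).mulVec y = (L v * Z * U).mulVec a' := by intro v; rw [← hya, mulVec_mulVec, mulVec_mulVec]
  have hw := hty (U.mulVec a') (by rw [hya]; exact hyR) k (by rw [bw]; exact bt)
  rw [hya] at hw
  have hys : ∀ v i, Φ.w v ((L v).mulVec y i) * s v i ≤ if v = er then bv * t (σ.symm i) else 1 := by
    intro v i; have := hy v i; simp only [hA] at this; rwa [le_div_iff₀ (hs v i)] at this
  set β := 2 * bv * t k with hβ
  have hβ0 : 0 < β := by have := ht k; positivity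
  have hq : ∀ l, Φ.w er (a' l) * (Φ.w er ((L er * Z * U) (σ l) l) * s er (σ l)) ≤ 2 ^ n * β := by
    intro l
    rcases le_or_gt l k with hl | hl
    · refine (dom (Φ.w er) (L er * Z * U) (s er) (hs er) σ eo hm a' β l fun l' hl' => ?_).trans
        (mlr (pow_le_pow_right₀ (by norm_num) l.2.le) hβ0.le)
      have := hys er (σ l')
      rw [if_pos rfl, Equiv.symm_apply_apply, hLy] at this
      refine this.trans ?_
      have := mll (htm l' k (hl'.trans hl)) hA0p.le
      rw [hβ]; linarith
    · rw [hk2 l hl, map_zero, zero_mul]; positivity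
  have ax : ∀ i, Φ.w er ((L er).mulVec y i) * s er i ≤ n * (2 ^ n * β) := by
    intro i
    rw [hLy, mulVec, dotProduct]
    refine (mlr ((Φ.w er).sum_le _ _) (hs er i).le).trans ?_
    rw [sum_mul]
    refine (sum_le_card_nsmul _ _ (2 ^ n * β) fun l _ => ?_).trans (by simp)
    refine le_trans ?_ (hq l)
    rw [map_mul]
    have := mll (hm l i) ((Φ.w er).nonneg (a' l))
    linarith
  have hN : ∏ v, ∑ i, Φ.w v ((L v).mulVec y i) * s v i ≤ n ^ fc S * (n * (2 ^ n * β)) := by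
    have ei : ∀ v, ∑ i, Φ.w v ((L v).mulVec y i) * s v i ≤ n * if v = er then n * (2 ^ n * β) else 1 := by
      intro v
      refine (sum_le_card_nsmul _ _ (if v = er then n * (2 ^ n * β) else 1) fun i _ => ?_).trans (by simp)
      split_ifs with hv
      · rw [hv]; exact ax i
      · have := hys v i; rwa [if_neg hv] at this
    refine (prod_le_prod (fun v _ => sum_nonneg fun i _ => mul_nonneg ((Φ.w v).nonneg _) (hs v i).le) fun v _ => ei v).trans (le_of_eq ?_)
    rw [prod_mul_distrib, prod_ite_eq' univ er]; simp
  have ea : t k ≤ t k / 2 := by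
    refine hw.trans ((mll hN zero_le_two).trans (le_of_eq ?_))
    rw [hβ, hA0]; field_simp
  have := ht k
  linarith
theorem red (Φ : PlaceSys K S) (er : S) (hn : 1 ≤ n) (L : S → Mx n K) (hL : ∀ v, (L v).det ≠ 0) :
    ∃ C : ℝ, 1 ≤ C ∧ ∀ s : S → Fin n → ℝ, (∀ v i, 0 < s v i) → Nonempty (Red Φ L C s) := by
  classical
  obtain ⟨ec, bu, hdav⟩ := dav Φ er hn L hL
  set ey := ∏ v, Φ.w v (L v).det with hD0
  have hD0p : 0 < ey := prod_pos fun v _ => (Φ.w v).pos (hL v)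
  set ek : ℝ := (2 ^ n) ^ fc S with hC2
  have hC21 : 1 ≤ ek := one_le_pow₀ (one_le_pow₀ (by norm_num))
  clear_value ek
  have q1 : 0 ≤ ek ^ n * ec / ey := by positivity
  have q2 : 0 ≤ ek ^ n / ey := by positivity
  have q3 : 0 ≤ 2 * (n:ℝ) ^ fc S := by positivity
  set Mc : S → ℝ := fun v => 1 + ∑ i, ∑ j, Φ.w v ((L v)⁻¹ i j) with hMc
  have q5 : 0 < ∏ v, Mc v := prod_pos fun v _ => add_pos_of_pos_of_nonneg one_pos
    (sum_nonneg fun i _ => sum_nonneg fun j _ => (Φ.w v).nonneg _)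
  refine ⟨ek + ek ^ n * ec / ey + ek ^ n / ey + 2 * (n:ℝ) ^ fc S + ec + ∏ v, Mc v, by linarith, fun s hs => ?_⟩
  set H : (Fin n → K) → ℝ := fun y => ∏ v, ∑ i, Φ.w v ((L v).mulVec y i) * s v i with hH
  set M : S → ℝ := fun v => 1 + ∑ i, ∑ j, Φ.w v ((L v)⁻¹ i j) / s v j with hM
  have hM0 : ∀ v, 0 < M v := fun v => add_pos_of_pos_of_nonneg one_pos
    (sum_nonneg fun i _ => sum_nonneg fun j _ => div_nonneg ((Φ.w v).nonneg _) (hs v j).le)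
  have hMp : 0 < ∏ v, M v := prod_pos fun v _ => hM0 v
  have Nn : ∀ v y, 0 ≤ ∑ i, Φ.w v ((L v).mulVec y i) * s v i := fun v y => sum_nonneg fun i _ => mul_nonneg ((Φ.w v).nonneg _) (hs v i).le
  have Nle : ∀ v y i, Φ.w v ((L v).mulVec y i) * s v i ≤ ∑ i, Φ.w v ((L v).mulVec y i) * s v i := fun v y i =>
    single_le_sum (f := fun i => Φ.w v ((L v).mulVec y i) * s v i) (fun i _ => mul_nonneg ((Φ.w v).nonneg _) (hs v i).le) (mem_univ i)
  have hlow : ∀ y, (∀ i, y i ∈ Φ.R) → y ≠ 0 → (∏ v, M v)⁻¹ ≤ H y := by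
    intro y hy bd
    obtain ⟨i, hi⟩ := ne_iff.1 bd
    rw [inv_le_iff_one_le_mul₀ hMp, hH]; simp only
    rw [← prod_mul_distrib]
    refine (Φ.prod_ge (y i) (hy i) hi).trans (prod_le_prod (fun v _ => (Φ.w v).nonneg _) fun v _ => ?_)
    have ei : y i = ∑ j, (L v)⁻¹ i j * (L v).mulVec y j := by
      have : (L v)⁻¹.mulVec ((L v).mulVec y) = y := by rw [mulVec_mulVec, nonsing_inv_mul _ (hL v).isUnit, one_mulVec]
      conv_lhs => rw [← this]
      rfl
    rw [ei]
    refine ((Φ.w v).sum_le _ _).trans ?_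
    have et : ∀ j, Φ.w v ((L v)⁻¹ i j * (L v).mulVec y j) ≤ (∑ i, Φ.w v ((L v).mulVec y i) * s v i) * (Φ.w v ((L v)⁻¹ i j) / s v j) := by
      intro j
      rw [map_mul, ← mul_div_assoc, le_div_iff₀ (hs v j)]
      have := mll (Nle v y j) ((Φ.w v).nonneg ((L v)⁻¹ i j))
      linarith
    refine (sum_le_sum fun j _ => et j).trans ?_
    rw [← mul_sum]
    refine mll ?_ (Nn v y)
    have := single_le_sum (f := fun i => ∑ j, Φ.w v ((L v)⁻¹ i j) / s v j)
      (fun i _ => sum_nonneg fun j _ => div_nonneg ((Φ.w v).nonneg _) (hs v j).le) (mem_univ i)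
    simp only [hM]; linarith
  obtain ⟨Z, hZ, hZd, hZm⟩ := nearmin Φ.R H _ (inv_pos.2 hMp) hlow
  have hLZ : ∀ v, (L v * Z).det ≠ 0 := fun v => by rw [det_mul]; exact mul_ne_zero (hL v) hZd
  choose U ai ba σ hσ0 hσm hσn using fun v => pivot (Φ.w v) (L v * Z) (hLZ v) (s v) (hs v)
  set p : S → Fin n → ℝ := fun v i => Φ.w v ((L v * Z * U v) (σ v i) i) * s v (σ v i) with hp
  have hp0 : ∀ v i, 0 < p v i := fun v i => mul_pos ((Φ.w v).pos (hσn v i)) (hs _ _)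
  set t : Fin n → ℝ := fun k => H fun r => Z r k with ht
  have hcol : ∀ k, Z.mulVec (Pi.single k 1) = fun r => Z r k := fun k => by ext r; simp
  have hne : ∀ k, (fun r => Z r k) ≠ 0 := fun k h => hZd (Matrix.det_eq_zero_of_column_eq_zero k fun r => congrFun h r)
  have bx : ∀ k, 0 < t k := fun k => (inv_pos.2 hMp).trans_le (hlow _ (fun r => hZ r k) (hne k))
  have htm : ∀ k l, k ≤ l → t k ≤ 2 * t l := by
    intro k l hkl
    have := hZm (Pi.single l 1) (by rw [hcol]; exact fun r => hZ r l) k l hkl (by simp)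
    rwa [hcol] at this
  have ht1 := hdav s hs Z (U er) t (σ er) hZd bx htm (fun a ha l hl => hZm a ha l l le_rfl hl) (ai er) (ba er) (hσ0 er) (hσm er)
  have htau1 : ∀ i, ∏ v, p v i ≤ ek * t i := by
    intro i
    have ei : ∀ v, p v i ≤ 2 ^ n * ∑ r, Φ.w v ((L v).mulVec (fun r => Z r i) r) * s v r := by
      intro v
      have hUu : IsUnit (U v).det := by rw [uni_det _ (ai v) (ba v)]; exact isUnit_one
      have ha : (U v).mulVec ((U v)⁻¹.mulVec (Pi.single i 1)) = Pi.single i 1 := by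
        rw [mulVec_mulVec, mul_nonsing_inv _ hUu, one_mulVec]
      have bc : (U v)⁻¹.mulVec (Pi.single i 1) ≠ 0 := by
        intro h; rw [h, mulVec_zero] at ha
        have := congrFun ha i; simp at this
      obtain ⟨k, bt, _, bw⟩ := uni_top (U v) (ai v) (ba v) _ bc
      rw [ha] at bw
      have hki : k = i := by by_contra hki; rw [Pi.single_apply, if_neg hki] at bw; exact bt bw.symm
      subst hki
      have hx : (L v * Z * U v).mulVec ((U v)⁻¹.mulVec (Pi.single k 1)) = (L v).mulVec fun r => Z r k := by
        rw [← mulVec_mulVec, ha, ← mulVec_mulVec, hcol]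
      have := dom (Φ.w v) (L v * Z * U v) (s v) (hs v) (σ v) (hσ0 v) (hσm v) ((U v)⁻¹.mulVec (Pi.single k 1)) _ k (fun l _ => by rw [hx]; exact Nle v _ _)
      rw [← bw, Pi.single_eq_same, map_one, one_mul] at this
      exact this.trans (mlr (pow_le_pow_right₀ (by norm_num) k.2.le) (Nn v _))
    refine (prod_le_prod (fun v _ => (hp0 v i).le) fun v _ => ei v).trans (le_of_eq ?_)
    rw [prod_mul_distrib, prod_const, hC2]; rfl
  have hdet : ∏ i, ∏ v, p v i = ey * (∏ v, Φ.w v Z.det) * ∏ v, ∏ i, s v i := by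
    rw [prod_comm, hD0, ← prod_mul_distrib, ← prod_mul_distrib]
    refine prod_congr rfl fun v _ => ?_
    simp only [hp, prod_mul_distrib]
    rw [← piv_det (Φ.w v) _ (σ v) (hσ0 v), Equiv.prod_comp (σ v) (s v), det_mul, uni_det _ (ai v) (ba v), mul_one, det_mul, map_mul]
  have hZR : Z.det ∈ Φ.R := by
    rw [det_apply]
    exact Subring.sum_mem _ fun π _ => by
      rw [Units.smul_def, zsmul_eq_mul]
      exact Φ.R.mul_mem (intCast_mem _ _) (Subring.prod_mem _ fun i _ => hZ _ _)
  obtain ⟨r1, r2, r3⟩ := red_num t (fun i => ∏ v, p v i) bx (fun i => prod_pos fun v _ => hp0 v i) ec ek ey _ _ bu hC21 hD0p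
    (Φ.prod_ge _ hZR hZd) (prod_pos fun v _ => prod_pos fun i _ => hs v i) ht1 htau1 hdet
  refine ⟨⟨Z, t, U, σ, p, hZ, hZd, by linarith, bx, htm, ?_, ai, ba, hσ0, fun _ _ => rfl, hσm, hp0, ?_, ?_, ?_, ?_, ?_⟩⟩
  · intro a ha hle l hl
    have ei := hZm a ha l l le_rfl hl
    have et : H (Z.mulVec a) ≤ (n:ℝ) ^ fc S := by
      rw [hH]
      refine (prod_le_prod (fun v _ => Nn v _) fun v _ => (sum_le_card_nsmul _ _ 1 fun i _ => hle v i)).trans (by simp)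
    have ed : t l ≤ 2 * H (Z.mulVec a) := ei
    linarith
  · intro i; refine (htau1 i).trans (mlr (by linarith) (bx i).le)
  · intro i; refine (r3 i).trans (mlr (by linarith) (prod_nonneg fun v _ => (hp0 v i).le))
  · refine r2.trans (mlr (by linarith) (prod_nonneg fun i _ => (bx i).le))
  · refine ht1.trans (mlr (by linarith) (prod_nonneg fun v _ => prod_nonneg fun i _ => (hs v i).le))
  · intro B hB hBs i
    have ei := hlow _ (fun r => hZ r i) (hne i)
    rw [inv_le_iff_one_le_mul₀ hMp] at ei
    refine ei.trans ?_
    rw [mul_comm]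
    refine mlr ?_ (bx i).le
    have et : ∏ v, M v ≤ (∏ v, Mc v) * B ^ fc S := by
      have : (∏ v, Mc v) * B ^ fc S = ∏ v, Mc v * B := by rw [prod_mul_distrib, prod_const]; rfl
      rw [this]
      refine prod_le_prod (fun v _ => (hM0 v).le) fun v _ => ?_
      simp only [hM, hMc]
      rw [add_mul, sum_mul]
      refine add_le_add (by linarith) (sum_le_sum fun i _ => ?_)
      rw [sum_mul]
      refine sum_le_sum fun j _ => ?_
      rw [div_le_iff₀ (hs v j)]
      have := mll (hBs v j) ((Φ.w v).nonneg ((L v)⁻¹ i j))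
      linarith
    have hBp : 0 < B ^ fc S := by positivity
    refine et.trans (mlr (by linarith) hBp.le)
end red2
end
section
open MvPolynomial
section wst1
variable {n q : ℕ}
lemma img_ex (σ : Perm (Fin n)) : ∃ e : (Fin q ↪o Fin n) ≃ (Fin q ↪o Fin n), ∀ K, ∃ π : Perm (Fin q), ∀ a, e K (π a) = σ (K a) := by
  classical
  have hw : ∀ K : Fin q ↪o Fin n, ∃ K' : Fin q ↪o Fin n, ∃ π : Perm (Fin q), ∀ a, K' (π a) = σ (K a) := by
    intro K
    have hc : (univ.map (K.toEmbedding.trans σ.toEmbedding)).card = q := by simp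
    have ea : ∀ a, ∃ b, (univ.map (K.toEmbedding.trans σ.toEmbedding)).orderEmbOfFin hc b = σ (K a) := by
      intro a
      have : σ (K a) ∈ Set.range ((univ.map (K.toEmbedding.trans σ.toEmbedding)).orderEmbOfFin hc) := by
        rw [range_orderEmbOfFin]; simp
      exact this
    choose π hπ using ea
    have hi : Injective π := by
      intro a b hab
      have := hπ a; rw [hab, hπ b] at this
      exact K.injective (σ.injective this.symm)
    exact ⟨_, ofBijective π (Finite.injective_iff_bijective.1 hi), hπ⟩
  choose f π hf using hw
  have hi : Injective f := by
    intro K1 K2 h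
    refine (emb_eq K2 K1 ((π K1).trans (π K2).symm) fun a => ?_).symm
    apply σ.injective
    rw [← hf K2, ← hf K1, h]; simp
  exact ⟨ofBijective f (Finite.injective_iff_bijective.1 hi), fun K => ⟨π K, hf K⟩⟩
lemma inv_sum (σ : Perm (Fin n)) (G : (Fin q → Fin n) → ℝ) (hG : ∀ f (π : Perm (Fin q)), G (f ∘ π) = G f) :
    ∑ K : Fin q ↪o Fin n, G (fun a => σ (K a)) = ∑ K : Fin q ↪o Fin n, G K := by
  obtain ⟨e, he⟩ := img_ex (q := q) σ
  rw [← e.sum_comp (fun K => G K)]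
  refine sum_congr rfl fun K _ => ?_
  obtain ⟨π, hπ⟩ := he K
  rw [← hG (e K) π]
  congr 1
  funext a
  exact (hπ a).symm
lemma cnt (hn : 1 ≤ n) : ∃ M : ℝ, 0 ≤ M ∧ ∀ f : Fin n → ℝ, ∑ K : Fin q ↪o Fin n, ∑ a, f (K a) = M * ∑ i, f i := by
  classical
  set N : Fin n → ℝ := fun i => ∑ K : Fin q ↪o Fin n, ∑ a, if K a = i then 1 else 0 with hN
  have hw : ∀ i j, N i = N j := by
    intro i j
    rw [hN]; simp only
    rw [← inv_sum (Equiv.swap i j) (fun K => ∑ a, if K a = i then (1:ℝ) else 0) (fun f π => by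
      exact Equiv.sum_comp π (fun a => if f a = i then (1:ℝ) else 0))]
    refine sum_congr rfl fun K _ => sum_congr rfl fun a _ => ?_
    congr 1
    simp [Equiv.swap_apply_eq_iff]
  refine ⟨N ⟨0, hn⟩, sum_nonneg fun _ _ => sum_nonneg fun _ _ => by split_ifs <;> norm_num, fun f => ?_⟩
  rw [mul_sum]
  have ea : ∀ K : Fin q ↪o Fin n, ∑ a, f (K a) = ∑ i, ∑ a, (if K a = i then 1 else 0) * f i := by
    intro K
    rw [sum_comm]
    refine sum_congr rfl fun a _ => ?_
    simp
  rw [sum_congr rfl fun K _ => ea K, sum_comm]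
  refine sum_congr rfl fun i _ => ?_
  rw [hw _ i, hN]
  simp only [sum_mul]
lemma gap {K : Type} [Field K] (t : Fin n → ℝ) (ht : ∀ i, 0 < t i) (tm : ∀ k l, k ≤ l → t k ≤ 2 * t l) (a : Fin n → K) (ha : a ≠ 0)
    (C E : ℝ) (hC : 1 ≤ C) (hE : 1 ≤ E) (hl : ∀ l, a l ≠ 0 → t l ≤ C) (hbig : (2 * C * E ^ n) ^ n < ∏ i, t i) :
    ∃ p, 1 ≤ p ∧ p < n ∧ (∀ l : Fin n, p ≤ l → a l = 0) ∧ ∀ k l : Fin n, (k:ℕ) < p → p ≤ l → E * t k ≤ 4 * t l := by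
  classical
  have hne : (univ.filter fun l => a l ≠ 0).Nonempty := by
    obtain ⟨l, hl⟩ := ne_iff.1 ha; exact ⟨l, by simpa using hl⟩
  set i := (univ.filter fun l => a l ≠ 0).max' hne with hi
  have hia : a i ≠ 0 := by have := max'_mem _ hne; rw [← hi] at this; simpa using this
  have htop : ∀ l, i < l → a l = 0 := by
    intro l hl; by_contra h
    have := le_max' (univ.filter fun l => a l ≠ 0) l (by simpa using h)
    exact absurd hl (not_lt.2 this)
  have hp : ∃ k l : Fin n, i ≤ k ∧ (l:ℕ) = k + 1 ∧ E * t k ≤ t l := by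
    by_contra hno
    push Not at hno
    have hw : ∀ d : ℕ, ∀ l : Fin n, (l:ℕ) = i + d → t l ≤ C * E ^ d := by
      intro d
      induction d with
      | zero => intro l hl'; have : l = i := Fin.ext hl'; rw [this]; simpa using hl i hia
      | succ d ih =>
        intro l hl'
        have ea := ih ⟨i + d, by omega⟩ rfl
        have ee := hno ⟨i + d, by omega⟩ l (by rw [Fin.le_def]; simp) (by simp; omega)
        rw [pow_succ]
        have := mll ea (zero_le_one.trans hE)
        linarith
    have hEn : 1 ≤ E ^ n := one_le_pow₀ hE
    have hCE : C ≤ C * E ^ n := le_mul_of_one_le_right (by linarith) hEn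
    refine absurd hbig (not_lt.2 ?_)
    refine (prod_le_prod (fun l _ => (ht l).le) (fun l _ => (show t l ≤ 2 * C * E ^ n from ?_))).trans (by simp)
    rcases le_total l i with h | h
    · have := tm l i h; have := hl i hia; linarith
    · have el := hw (l - i) l (by rw [Fin.le_def] at h; omega)
      have eb : E ^ ((l:ℕ) - i) ≤ E ^ n := pow_le_pow_right₀ hE (by omega)
      have := mll eb (zero_le_one.trans hC)
      linarith
  obtain ⟨k, l, hk, hl', h⟩ := hp
  refine ⟨l, by omega, l.2, fun l' h' => htop l' (by rw [Fin.lt_def]; rw [Fin.le_def] at hk; omega), fun k' l' hk' hl'' => ?_⟩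
  have hw := tm k' k (by rw [Fin.le_def]; omega)
  have ea := tm l l' (by rw [Fin.le_def]; omega)
  have := mll hw (zero_le_one.trans hE)
  linarith
end wst1
end
section
open MvPolynomial
section wst2
variable {n q : ℕ}
def Gf (lt : Fin n → ℝ) (p : ℕ) (x : ℝ) (f : Fin q → Fin n) : ℝ := ∑ a, lt (f a) - if ∀ a, p ≤ (f a : ℕ) then x else 0
lemma Gf_perm (lt : Fin n → ℝ) (p : ℕ) (x : ℝ) (f : Fin q → Fin n) (π : Perm (Fin q)) : Gf lt p x (f ∘ π) = Gf lt p x f := by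
  unfold Gf
  congr 1
  · exact Equiv.sum_comp π (fun a => lt (f a))
  · have : (∀ a, p ≤ ((f ∘ π) a : ℕ)) ↔ ∀ a, p ≤ (f a : ℕ) := ⟨fun h a => by have := h (π.symm a); simpa using this, fun h a => h _⟩
    simp only [this]
lemma Gf_cmp (lt : Fin n → ℝ) (p : ℕ) (x : ℝ) (hx : 0 ≤ x) (hw : ∀ k l, k ≤ l → lt k ≤ lt l + log 2)
    (ea : ∀ k l : Fin n, (k:ℕ) < p → p ≤ l → x + lt k ≤ lt l + log 4) (ar an : Fin q → Fin n) (hle : ∀ a, ar a ≤ an a) :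
    Gf lt p x ar ≤ Gf lt p x an + (q * log 2 + log 4) := by
  have l4 : 0 ≤ log 4 := log_nonneg (by norm_num)
  have l2 : 0 ≤ log 2 := log_nonneg (by norm_num)
  have hs : ∑ a, lt (ar a) ≤ ∑ a, lt (an a) + q * log 2 := by
    refine (sum_le_sum fun a _ => hw _ _ (hle a)).trans ?_
    rw [sum_add_distrib]; simp
  unfold Gf
  by_cases ag : ∀ a, p ≤ (an a : ℕ)
  · by_cases ad : ∀ a, p ≤ (ar a : ℕ)
    · rw [if_pos ad, if_pos ag]; linarith
    · rw [if_neg ad, if_pos ag]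
      push Not at ad
      obtain ⟨al, bc⟩ := ad
      have : ∑ a, (lt (ar a) + if a = al then x else 0) ≤ ∑ a, (lt (an a) + log 2 + if a = al then log 4 else 0) := by
        refine sum_le_sum fun a _ => ?_
        split_ifs with h
        · have := ea (ar al) (an al) bc (ag al); rw [h]; linarith
        · have := hw _ _ (hle a); linarith
      simp only [sum_add_distrib, sum_ite_eq', mem_univ, if_true] at this
      simp only [sum_const, card_univ, Fintype.card_fin, nsmul_eq_mul] at this
      linarith
  · have ad : ¬ ∀ a, p ≤ (ar a : ℕ) := fun h => ag fun a => (h a).trans (hle a)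
    rw [if_neg ad, if_neg ag]; linarith
variable {K : Type} [Field K] {S : Type} [Fintype S]
lemma minor_ne (Γ : Mx n K) (σ : Perm (Fin n)) (eo : ∀ k i, k < i → Γ (σ k) i = 0) (I J : Fin q ↪o Fin n)
    (h : cm q Γ I J ≠ 0) : ∃ π : Perm (Fin q), ∀ a, J a ≤ σ.symm (I (π a)) := by
  rw [cm, of_apply, det_apply] at h
  obtain ⟨π, _, hπ⟩ := exists_ne_zero_of_sum_ne_zero h
  refine ⟨π, fun a => ?_⟩
  by_contra hc
  push Not at hc
  apply hπ
  rw [prod_eq_zero (mem_univ a), smul_zero]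
  have := eo _ _ hc
  rw [Equiv.apply_symm_apply] at this
  exact this
lemma cm_inv (A : Mx n K) (hA : A.det ≠ 0) : cm q A * cm q A⁻¹ = 1 := by
  classical
  rw [← cm_mul, mul_nonsing_inv _ hA.isUnit, cm_one_one]
lemma cm_det (A : Mx n K) (hA : A.det ≠ 0) : (cm q A).det ≠ 0 := by
  intro h
  have := congrArg Matrix.det (cm_inv (q := q) A hA)
  rw [det_mul, h, zero_mul, Matrix.det_one] at this
  exact zero_ne_one this
lemma adj_row (Z : Mx n K) (T : Fin q ↪o Fin n) :
    vecMul (fun J => cm q Z.adjugate T J) (cm q Z) = (Z.det ^ q) • Pi.single T 1 := by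
  have h : cm q Z.adjugate * cm q Z = (Z.det ^ q) • (1 : Matrix (Fin q ↪o Fin n) (Fin q ↪o Fin n) K) := by
    rw [← cm_mul, Matrix.adjugate_mul, cm_smul, cm_one_one]
  ext J
  have := congrFun (congrFun h T) J
  rw [Matrix.mul_apply] at this
  rw [vecMul, dotProduct, this]
  simp [Matrix.one_apply, Pi.single_apply, eq_comm]
lemma log_t (Φ : PlaceSys K S) (L : S → Mx n K) (C : ℝ) (hC : 1 ≤ C) (hn : 1 ≤ n) (B X : ℝ) (hB : 0 ≤ B) (hX : 1 ≤ X) (hXC : log C ≤ X)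
    (c : S → Fin n → ℝ) (hc : ∀ v i, |c v i| ≤ B) (D : Red Φ L C (fun v i => exp (-(X * c v i)))) :
    ∑ i, log (D.t i) ≤ log C - X * ∑ v, ∑ i, c v i ∧
    ∀ i, |log (D.t i)| ≤ ((1 + n * fc S * B) + n * (1 + fc S * B)) * X := by
  have hw : ∑ i, log (D.t i) ≤ log C - X * ∑ v, ∑ i, c v i := by
    rw [← log_prod (fun i _ => (D.t0 i).ne')]
    refine (log_le_log (prod_pos fun i _ => D.t0 i) D.ts).trans (le_of_eq ?_)
    simp only [← exp_sum]
    rw [log_mul (by linarith) (exp_pos _).ne', log_exp, mul_sum]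
    simp only [mul_sum, sum_neg_distrib]
    ring
  refine ⟨hw, ?_⟩
  set N := (fc S : ℝ) with hN
  have ax : 0 ≤ N := by rw [hN]; positivity
  have hlow : ∀ i, -((1 + N * B) * X) ≤ log (D.t i) := by
    intro i
    have ei := D.tl (exp (B * X)) (one_le_exp (by positivity)) (fun v i => by
      rw [← exp_add]; apply one_le_exp
      have := (abs_le.1 (hc v i)).2
      have := mll this (zero_le_one.trans hX)
      linarith) i
    have et := log_nonneg ei
    rw [log_mul (by positivity) (D.t0 i).ne', log_mul (by linarith) (by positivity), ← exp_nat_mul, log_exp, ← hN] at et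
    linarith
  have ea : ∑ i, log (D.t i) ≤ (1 + n * N * B) * X := by
    have ei : -(N * (n * B)) ≤ ∑ v, ∑ i, c v i := by
      have : ∑ v : S, ∑ i : Fin n, -B ≤ ∑ v, ∑ i, c v i := sum_le_sum fun v _ => sum_le_sum fun i _ => (abs_le.1 (hc v i)).1
      simp only [sum_const, card_univ, nsmul_eq_mul, Fintype.card_fin] at this
      linarith
    have := mll ei (zero_le_one.trans hX)
    linarith
  have hn1 : (1:ℝ) ≤ n := mod_cast hn
  have hP : 0 ≤ (1 + N * B) * X := by positivity
  have hP2 : 0 ≤ (1 + n * N * B) * X := by positivity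
  have hP3 := mlr hn1 hP
  intro i
  rw [abs_le]
  constructor
  · have := hlow i; linarith
  · have ei := add_sum_erase univ (fun i => log (D.t i)) (mem_univ i)
    have et : -(n * ((1 + N * B) * X)) ≤ ∑ k ∈ univ.erase i, log (D.t k) := by
      have : ∑ k ∈ univ.erase i, -((1 + N * B) * X) ≤ ∑ k ∈ univ.erase i, log (D.t k) := sum_le_sum fun k _ => hlow k
      refine le_trans ?_ this
      rw [sum_const, nsmul_eq_mul, mul_neg, neg_le_neg_iff]
      refine mlr ?_ hP
      have : (univ.erase i).card ≤ n := (card_le_univ _).trans (by simp)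
      exact_mod_cast this
    linarith
lemma lt_props (Φ : PlaceSys K S) (L : S → Mx n K) (C : ℝ) (s) (D : Red Φ L C s) (p : ℕ) (x : ℝ)
    (hgap : ∀ k l : Fin n, (k:ℕ) < p → p ≤ l → exp x * D.t k ≤ 4 * D.t l) :
    (∀ k l, k ≤ l → log (D.t k) ≤ log (D.t l) + log 2) ∧
    (∀ k l : Fin n, (k:ℕ) < p → p ≤ l → x + log (D.t k) ≤ log (D.t l) + log 4) := by
  constructor
  · intro k l h
    have := log_le_log (D.t0 k) (D.tm k l h)
    rw [log_mul two_ne_zero (D.t0 l).ne'] at this; linarith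
  · intro k l hw ea
    have := log_le_log (mul_pos (exp_pos _) (D.t0 k)) (hgap k l hw ea)
    rw [log_mul (by norm_num) (D.t0 l).ne', log_mul (exp_pos _).ne' (D.t0 k).ne', log_exp] at this; linarith
end wst2
end
section
open MvPolynomial
section wst3
variable {n q : ℕ} {K : Type} [Field K] [CharZero K] {S : Type} [Fintype S]
theorem topH (Φ : PlaceSys K S) (er : S) (hn : 1 ≤ n) (L : S → Mx n K) (hL : ∀ v, (L v).det ≠ 0) (C : ℝ) (hC : 1 ≤ C)
    (p : ℕ) (h : p + q = n) (B g η : ℝ) (hB : 0 ≤ B) (hg : 0 < g) (hη : 0 < η) :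
    ∃ ao, ∀ X ≥ ao, ∀ c : S → Fin n → ℝ, (∀ v i, |c v i| ≤ B) → ∀ D : Red Φ L C (fun v i => exp (-(X * c v i))),
      (∀ k l : Fin n, (k:ℕ) < p → p ≤ l → exp (g * X) * D.t k ≤ 4 * D.t l) →
      ∏ v, ∑ J, Φ.w v (cm q D.Z.adjugate (top p q n h) J) < exp (η * X) := by
  classical
  obtain ⟨M, hM0, hM⟩ := cnt (q := q) hn
  set be : ℝ := (1 + n * fc S * B) + n * (1 + fc S * B) with hB1
  have hB10 : 0 ≤ be := by positivity
  set B' : ℝ := q * B + q * be + g with hB'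
  have hB'0 : 0 ≤ B' := by positivity
  set C' : ℝ := q.factorial * (2 ^ q * 4) * C ^ q with hC'
  have ar : (1:ℝ) ≤ q.factorial := mod_cast Nat.one_le_iff_ne_zero.2 (Nat.factorial_ne_zero q)
  have an : (1:ℝ) ≤ 2 ^ q * 4 := by have : (1:ℝ) ≤ 2 ^ q := one_le_pow₀ (by norm_num); linarith
  have f3 : (1:ℝ) ≤ C ^ q := one_le_pow₀ hC
  have f12 : (1:ℝ) ≤ q.factorial * (2 ^ q * 4) := one_le_mul_of_one_le_of_one_le ar an
  have hC'1 : 1 ≤ C' := one_le_mul_of_one_le_of_one_le f12 f3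
  have hC'q : C ^ q ≤ C' := le_mul_of_one_le_left (by linarith) f12
  have hC'f : q.factorial * (2 ^ q * 4) ≤ C' := le_mul_of_one_le_right (by linarith) f3
  clear_value be C'
  obtain ⟨ao, hX0⟩ := thmA Φ (fun v => cm q (L v)) (fun v => cm_det (L v) (hL v)) om (top p q n h)
    (fun J => by
      by_cases hJ : J = top p q n h
      · rw [hJ]
      · exact (om_top p q n h J hJ).le) C' B' η (g / 2) hC'1 hB'0 hη (half_pos hg)
  refine ⟨max ao (max 1 (max (log C) (2 * M * log C / g))), fun X hX c hc D hgap => ?_⟩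
  have hXX0 := (le_max_left _ _).trans hX
  have bm := ((le_max_left _ _).trans (le_max_right _ _)).trans hX
  have hXC := ((le_max_left _ _).trans ((le_max_right _ _).trans (le_max_right _ _))).trans hX
  have hXM := ((le_max_right _ _).trans ((le_max_right _ _).trans (le_max_right _ _))).trans hX
  clear hX
  have hXp : 0 < X := by linarith
  obtain ⟨hts, htb⟩ := log_t Φ L C hC hn B X hB bm hXC c hc D
  rw [← hB1] at htb
  obtain ⟨hlt1, hlt2⟩ := lt_props Φ L C _ D p (g * X) hgap
  set lt : Fin n → ℝ := fun i => log (D.t i) with hlt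
  have hgX : 0 ≤ g * X := by positivity
  set G : (Fin q → Fin n) → ℝ := Gf lt p (g * X) with hG
  have hGb : ∀ f, |G f| ≤ (q * be + g) * X := by
    intro f
    rw [hG, Gf]
    have ei : |∑ a, lt (f a)| ≤ q * (be * X) := by
      refine (abs_sum_le_sum_abs _ _).trans ((sum_le_card_nsmul _ _ (be * X) fun a _ => htb (f a)).trans (by simp))
    rw [abs_le] at ei ⊢
    split_ifs <;> constructor <;> linarith [ei.1, ei.2]
  set c' : S → (Fin q ↪o Fin n) → ℝ := fun v I => ∑ a, c v (I a) + if v = er then G (fun a => (D.σ er).symm (I a)) / X else 0 with hc'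
  have hcb : ∀ v I, |c' v I| ≤ B' := by
    intro v I
    have ei : |∑ a, c v (I a)| ≤ q * B :=
      (abs_sum_le_sum_abs _ _).trans ((sum_le_card_nsmul _ _ B fun a _ => hc v (I a)).trans (by simp))
    have et : |if v = er then G (fun a => (D.σ er).symm (I a)) / X else 0| ≤ q * be + g := by
      split_ifs
      · rw [abs_div, abs_of_pos hXp, div_le_iff₀ hXp]; exact hGb _
      · rw [abs_zero]; positivity
    exact (abs_add_le _ _).trans (by rw [hB']; linarith)
  have hsum : ∑ v, ∑ I, c' v I ≤ -(g / 2) := by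
    have ei : ∑ v, ∑ I, c' v I = M * ∑ v, ∑ i, c v i + (∑ J : Fin q ↪o Fin n, G J) / X := by
      simp only [hc', sum_add_distrib, hM, mul_sum]
      congr 1
      rw [sum_comm]
      simp only [sum_ite_eq', mem_univ, if_true]
      rw [← sum_div, inv_sum (D.σ er).symm G (Gf_perm lt p (g * X))]
    have et : ∑ J : Fin q ↪o Fin n, G J ≤ M * ∑ i, lt i - g * X := by
      simp only [hG, Gf, sum_sub_distrib, hM]
      have : (if ∀ a, p ≤ ((top p q n h) a : ℕ) then g * X else 0) ≤ ∑ J : Fin q ↪o Fin n, if ∀ a, p ≤ (J a : ℕ) then g * X else 0 :=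
        single_le_sum (f := fun J : Fin q ↪o Fin n => if ∀ a, p ≤ (J a : ℕ) then g * X else 0)
          (fun J _ => by split_ifs <;> [exact hgX; exact le_rfl]) (mem_univ (top p q n h))
      rw [if_pos (fun a => by rw [top_val]; omega)] at this
      linarith
    have ed := mll hts hM0
    rw [div_le_iff₀ hg] at hXM
    rw [ei, ← le_sub_iff_add_le', div_le_iff₀ hXp]
    linarith
  by_contra hcon
  push Not at hcon
  refine hX0 X hXX0 c' hcb hsum ?_
  have hT : ∀ J : Fin q ↪o Fin n, ∏ a, D.t (J a) = exp (∑ a, lt (J a)) := fun J => by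
    rw [exp_sum]; exact prod_congr rfl fun a _ => (exp_log (D.t0 _)).symm
  have hpt : ∀ J : Fin q ↪o Fin n, ∏ v, ∏ a, D.p v (J a) ≤ C ^ q * exp (∑ a, lt (J a)) := by
    intro J
    rw [prod_comm, ← hT]
    refine (prod_le_prod (fun a _ => prod_nonneg fun v _ => (D.p0 v _).le) fun a _ => D.tau1 (J a)).trans (le_of_eq ?_)
    rw [prod_mul_distrib]; simp
  set μ : S → (Fin q ↪o Fin n) → ℝ := fun v J => (∏ a, D.p v (J a)) * if v = er then exp (-G J) else 1 with hμ
  have hμp : ∀ J, ∏ v, μ v J ≤ C ^ q * exp (if ∀ a, p ≤ (J a : ℕ) then g * X else 0) := by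
    intro J
    simp only [hμ, prod_mul_distrib, prod_ite_eq', mem_univ, if_true]
    refine (mlr (hpt J) (exp_pos _).le).trans (le_of_eq ?_)
    rw [mul_assoc, ← exp_add, hG, Gf]; congr 2; ring
  refine ⟨cm q D.Z, fun v => cm q (D.U v), μ, fun J => cm q D.Z.adjugate (top p q n h) J, D.Z.det ^ q, cm_mem _ _ D.hZ, cm_det _ D.hd,
    fun v J => (cm_upper (D.U v) (D.U1 v) (D.U2 v)).1 J, fun v I J hIJ => (cm_upper (D.U v) (D.U1 v) (D.U2 v)).2 I J hIJ, ?_, ?_, ?_, ?_,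
    adj_row _ _, pow_ne_zero _ D.hd, ?_, hcon⟩
  · intro v J
    exact mul_pos (prod_pos fun a _ => D.p0 v _) (by split_ifs <;> [exact exp_pos _; exact one_pos])
  · intro v I J
    have hpos : 0 < ∏ a, D.p v (J a) := prod_pos fun a _ => D.p0 v _
    rw [← cm_mul, ← cm_mul]
    by_cases hz : cm q (L v * D.Z * D.U v) I J = 0
    · rw [hz, map_zero]
      simp only [hμ]
      refine mul_nonneg (mul_nonneg (by linarith) (exp_pos _).le) (mul_nonneg hpos.le ?_)
      split_ifs <;> [exact (exp_pos _).le; exact zero_le_one]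
    have ei := cm_bound (q := q) (Φ.w v) (L v * D.Z * D.U v) (fun i => exp (X * c v i)) (D.p v) (fun i j => by
      have := D.piv v j i
      rw [Real.exp_neg, ← div_eq_mul_inv, div_le_iff₀ (exp_pos _)] at this
      linarith) I J
    rw [← exp_sum, ← mul_sum] at ei
    refine ei.trans ?_
    have et : exp (X * ∑ a, c v (I a)) * ∏ a, D.p v (J a) ≤ (2 ^ q * 4) * (exp (X * c' v I) * μ v J) := by
      have ed : exp (X * c' v I) * μ v J = exp (X * ∑ a, c v (I a)) * (∏ a, D.p v (J a)) *
          (if v = er then exp (G (fun a => (D.σ er).symm (I a)) - G J) else 1) := by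
        simp only [hc', hμ]
        split_ifs
        · rw [mul_add, exp_add, mul_div_cancel₀ _ hXp.ne', sub_eq_add_neg, exp_add]; ring
        · rw [add_zero]; ring
      rw [ed]
      have ev : 1 ≤ (2 ^ q * 4) * (if v = er then exp (G (fun a => (D.σ er).symm (I a)) - G J) else 1) := by
        split_ifs with hv
        · subst hv
          obtain ⟨π, hπ⟩ := minor_ne _ (D.σ v) (D.piv0 v) I J hz
          have am := Gf_cmp lt p (g * X) hgX hlt1 hlt2 J _ hπ
          have ak := Gf_perm lt p (g * X) (fun a => (D.σ v).symm (I a)) π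
          have bn : log (2 ^ q * 4) = q * log 2 + log 4 := by rw [log_mul (by positivity) (by norm_num), log_pow]
          have bz : (2 ^ q * 4 : ℝ) = exp (q * log 2 + log 4) := by rw [← bn, exp_log (by positivity)]
          rw [bz, ← exp_add]
          apply one_le_exp
          have e9 : G J ≤ G (fun a => (D.σ v).symm (I a)) + (q * log 2 + log 4) := by
            rw [hG, ← ak]; exact am
          linarith
        · linarith
      have hpp : 0 ≤ exp (X * ∑ a, c v (I a)) * ∏ a, D.p v (J a) := mul_nonneg (exp_pos _).le hpos.le
      have := mll ev hpp
      linarith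
    have hfn : (0:ℝ) ≤ q.factorial := by linarith
    have e10 := mll et hfn
    have e11 : 0 ≤ exp (X * c' v I) * μ v J := by
      have := (mul_nonneg (exp_pos (X * ∑ a, c v (I a))).le hpos.le).trans et
      exact (mul_nonneg_iff_of_pos_left (by linarith)).1 this
    have e12 := mlr hC'f e11
    linarith
  · intro J hJ
    refine (hμp J).trans ?_
    obtain ⟨a, ha⟩ := ne_top_low p q n h J hJ
    rw [if_neg (fun hh => absurd (hh a) (by omega)), Real.exp_zero, mul_one]
    exact hC'q
  · refine (hμp _).trans (mul_le_mul hC'q (exp_le_exp.2 ?_) (exp_pos _).le (by linarith))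
    have : g * X ≤ B' * X := mlr (by rw [hB']; linarith [(by positivity : 0 ≤ q * B + q * be)]) hXp.le
    split_ifs <;> linarith
  · refine le_trans (le_of_eq ?_) ((pow_le_pow_left₀ (prod_nonneg fun v _ => (Φ.w v).nonneg _) D.hdC q).trans hC'q)
    rw [← prod_pow]
    exact prod_congr rfl fun v _ => map_pow _ _ _
end wst3
end
section
open MvPolynomial
section wst4
variable {n q : ℕ} {K : Type} [Field K] [CharZero K] {S : Type} [Fintype S]
lemma low (Φ : PlaceSys K S) {ι : Type} [Fintype ι] (Λ : S → Matrix ι ι K) : ∃ CL : ℝ, 0 < CL ∧ ∀ ℓ : ι → K, (∀ i, ℓ i ∈ Φ.R) → ∀ v k,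
    vecMul ℓ (Λ v) k ≠ 0 → ∑ i, Φ.w v (ℓ i) ≤ CL * Φ.w v (vecMul ℓ (Λ v) k) * ∏ v, ∑ i, Φ.w v (ℓ i) := by
  classical
  obtain ⟨r, hr, hr0, hrx⟩ := common_den Φ (fun x : S × ι × ι => Λ x.1 x.2.1 x.2.2)
  set M : S → ℝ := fun v' => 1 + ∑ x : S × ι × ι, Φ.w v' (Λ x.1 x.2.1 x.2.2) with hM
  have bk : ∀ v', 1 ≤ M v' := fun v' => le_add_of_nonneg_right (sum_nonneg fun x _ => (Φ.w v').nonneg _)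
  have hwr : ∀ v', 0 < Φ.w v' r := fun v' => (Φ.w v').pos hr0
  refine ⟨∏ v', Φ.w v' r * M v', prod_pos fun v' _ => mul_pos (hwr v') (by linarith [bk v']), fun ℓ hℓ v k hk => ?_⟩
  set N : S → ℝ := fun v => ∑ i, Φ.w v (ℓ i) with hN
  have ax : ∀ v, 0 ≤ N v := fun v => sum_nonneg fun i _ => (Φ.w v).nonneg _
  set a := vecMul ℓ (Λ v) k with ha
  have hyR : r * a ∈ Φ.R := by
    rw [ha, vecMul, dotProduct, mul_sum]
    refine Subring.sum_mem _ fun i _ => ?_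
    rw [mul_left_comm]; exact Φ.R.mul_mem (hℓ i) (hrx (v, i, k))
  have hwa : ∀ v', Φ.w v' a ≤ M v' * N v' := by
    intro v'
    rw [ha, vecMul, dotProduct, hN, mul_sum]
    refine ((Φ.w v').sum_le _ _).trans (sum_le_sum fun i _ => ?_)
    rw [map_mul, mul_comm]
    refine mlr ?_ ((Φ.w v').nonneg _)
    have := single_le_sum (f := fun x : S × ι × ι => Φ.w v' (Λ x.1 x.2.1 x.2.2)) (fun x _ => (Φ.w v').nonneg _) (mem_univ (v, i, k))
    simp only [hM]; linarith
  have hw := Φ.prod_ge _ hyR (mul_ne_zero hr0 hk)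
  rw [← mul_prod_erase _ _ (mem_univ v)] at hw
  have ea : ∏ v' ∈ univ.erase v, Φ.w v' (r * a) ≤ ∏ v' ∈ univ.erase v, (Φ.w v' r * M v' * N v') := by
    refine prod_le_prod (fun v' _ => (Φ.w v').nonneg _) fun v' _ => ?_
    rw [map_mul, mul_assoc]
    exact mll (hwa v') (hwr v').le
  have ee : (∏ v', Φ.w v' r * M v') * Φ.w v a * ∏ v, N v = Φ.w v a * ((Φ.w v r * M v * N v) * ∏ v' ∈ univ.erase v, (Φ.w v' r * M v' * N v')) := by
    rw [mul_prod_erase univ (fun v' => Φ.w v' r * M v' * N v') (mem_univ v)]; simp only [prod_mul_distrib]; ring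
  rw [ee]
  have el : 1 ≤ Φ.w v (r * a) * ∏ v' ∈ univ.erase v, (Φ.w v' r * M v' * N v') := hw.trans (mll ea ((Φ.w v).nonneg _))
  rw [map_mul] at el
  have eb := mll el (mul_nonneg (zero_le_one.trans (bk v)) (ax v))
  have ew := mlr (bk v) (ax v)
  have aa : N v ≤ M v * N v * (Φ.w v r * Φ.w v a * ∏ v' ∈ univ.erase v, (Φ.w v' r * M v' * N v')) := by linarith
  refine aa.trans (le_of_eq (by ring))
lemma a_up (Φ : PlaceSys K S) (L : S → Mx n K) (hL : ∀ v, (L v).det ≠ 0) (C : ℝ) (p : ℕ) (h : p + q = n) (s) (hs : ∀ v i, 0 < s v i)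
    (D : Red Φ L C s) (v : S) (I : Fin q ↪o Fin n) :
    Φ.w v (vecMul (fun J => cm q D.Z.adjugate (top p q n h) J) (cm q (L v)⁻¹) I) * ∏ a, D.p v (top p q n h a) ≤
      Φ.w v (D.Z.det ^ q) * (q.factorial * (2 ^ n) ^ q) * ∏ a, s v (I a) := by
  set Γ := L v * D.Z * D.U v with hΓ
  have hUd := uni_det (D.U v) (D.U1 v) (D.U2 v)
  have hΓd : Γ.det ≠ 0 := by rw [hΓ, det_mul, det_mul, hUd, mul_one]; exact mul_ne_zero (hL v) D.hd
  have ei : D.Z.adjugate * (L v)⁻¹ = D.Z.det • (D.U v * Γ⁻¹) := by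
    have et : D.Z.adjugate = D.Z.det • D.Z⁻¹ := by
      rw [Matrix.inv_def, smul_smul, Ring.mul_inverse_cancel _ D.hd.isUnit, one_smul]
    rw [hΓ, Matrix.mul_inv_rev, Matrix.mul_inv_rev, ← Matrix.mul_assoc, mul_nonsing_inv _ (by rw [hUd]; exact isUnit_one), Matrix.one_mul, et, smul_mul]
  have ed : vecMul (fun J => cm q D.Z.adjugate (top p q n h) J) (cm q (L v)⁻¹) I = D.Z.det ^ q * cm q Γ⁻¹ (top p q n h) I := by
    have : vecMul (fun J => cm q D.Z.adjugate (top p q n h) J) (cm q (L v)⁻¹) I = (cm q D.Z.adjugate * cm q (L v)⁻¹) (top p q n h) I := rfl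
    rw [this, ← cm_mul, ei, cm_smul, cm_mul, Matrix.smul_apply, smul_eq_mul, Matrix.mul_apply, sum_eq_single (top p q n h)]
    · rw [(cm_upper (D.U v) (D.U1 v) (D.U2 v)).1, one_mul]
    · intro J _ hJ
      by_contra hne
      have hw := (cm_upper (D.U v) (D.U1 v) (D.U2 v)).2 _ J hJ.symm (left_ne_zero_of_mul hne)
      exact absurd (om_top p q n h J hJ) (by omega)
    · simp
  have ev : ∀ l k, Φ.w v (Γ⁻¹ l k) ≤ 2 ^ n * (D.p v l)⁻¹ * s v k := by
    intro l k
    have am := dom (Φ.w v) Γ (s v) (hs v) (D.σ v) (D.piv0 v) (fun i k => by rw [← D.hp]; exact D.piv v i k) (fun l => Γ⁻¹ l k) (s v k) l (fun l' _ => by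
      have : Γ.mulVec (fun l => Γ⁻¹ l k) (D.σ v l') = (Γ * Γ⁻¹) (D.σ v l') k := rfl
      rw [this, mul_nonsing_inv _ hΓd.isUnit, Matrix.one_apply]
      split_ifs with hh
      · rw [map_one, one_mul, hh]
      · rw [map_zero, zero_mul]; exact (hs v k).le)
    rw [← D.hp, ← le_div_iff₀ (D.p0 v l)] at am
    refine am.trans ?_
    rw [div_eq_mul_inv, mul_right_comm]
    refine mlr (mlr (pow_le_pow_right₀ (by norm_num) l.2.le) (inv_pos.2 (D.p0 v l)).le) (hs v k).le
  have ak := cm_bound (q := q) (Φ.w v) Γ⁻¹ (fun l => 2 ^ n * (D.p v l)⁻¹) (s v) ev (top p q n h) I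
  rw [prod_mul_distrib, prod_const, card_univ, Fintype.card_fin, prod_inv_distrib] at ak
  rw [ed, map_mul]
  have hP : 0 < ∏ a, D.p v (top p q n h a) := prod_pos fun a _ => D.p0 v _
  have bn := mlr ak hP.le
  have bz := mll bn ((Φ.w v).nonneg (D.Z.det ^ q))
  rw [← mul_assoc] at bz
  refine bz.trans (le_of_eq ?_)
  field_simp
lemma elim_num (Φ : PlaceSys K S) (x : K) (hx : 1 ≤ ∏ v, Φ.w v x) (A N PJ PT k : S → ℝ) (em H Ck CJ : ℝ) (hA : ∀ v, 0 ≤ A v) (hN : ∀ v, 0 < N v) (hPT : ∀ v, 0 < PT v)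
    (hPJ : ∀ v, 0 < PJ v) (hk : ∀ v, 0 ≤ k v) (bi : 0 ≤ em)
    (hw : ∀ v, Φ.w v x * (N v * PT v) ≤ A v * (em * H * k v * PJ v)) (hH : ∏ v, N v = H) (bo : 1 ≤ H) (bt : ∏ v, k v ≤ Ck)
    (E : ℝ) (hE : 0 ≤ E) (hJ : E * ∏ v, PJ v ≤ CJ * ∏ v, PT v) : E ≤ (em ^ fc S * Ck * CJ) * (∏ v, A v) * H ^ fc S := by
  have ea := prod_le_prod (s := univ) (fun v _ => mul_nonneg ((Φ.w v).nonneg x) (mul_nonneg (hN v).le (hPT v).le)) fun v _ => hw v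
  simp only [prod_mul_distrib, prod_const, card_univ, hH] at ea
  have pT : 0 < ∏ v, PT v := prod_pos fun v _ => hPT v
  have pJ : 0 < ∏ v, PJ v := prod_pos fun v _ => hPJ v
  have pA : 0 ≤ ∏ v, A v := prod_nonneg fun v _ => hA v
  have pk : 0 ≤ ∏ v, k v := prod_nonneg fun v _ => hk v
  set a := ∏ v, A v
  set T := ∏ v, PT v
  set j := ∏ v, PJ v
  set κ := ∏ v, k v
  set c := em ^ fc S with hc
  have pc : 0 ≤ c := pow_nonneg bi _
  set Hs := H ^ fc S with hHs
  have pH : 0 ≤ Hs := pow_nonneg (by linarith) _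
  have hHT : T ≤ H * T := le_mul_of_one_le_left pT.le bo
  have ee : T ≤ a * (c * Hs * κ * j) := by
    have := mlr hx (mul_nonneg (zero_le_one.trans bo) pT.le)
    linarith
  refine le_of_mul_le_mul_right (a := T) ?_ pT
  have el := mll ee hE
  have eb := mll hJ (mul_nonneg pA (mul_nonneg (mul_nonneg pc pH) pk))
  have ew := mll bt (mul_nonneg (mul_nonneg pA (mul_nonneg pc pH)) ((mul_nonneg hE pJ.le).trans hJ))
  linarith
lemma elim (Φ : PlaceSys K S) (L : S → Mx n K) (hL : ∀ v, (L v).det ≠ 0) (C : ℝ) (hC : 1 ≤ C) (p : ℕ) (h : p + q = n) :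
    ∃ Cst : ℝ, ∀ (s : S → Fin n → ℝ) (hs : ∀ v i, 0 < s v i) (D : Red Φ L C s) (x : ℝ) (hx : 0 ≤ x)
      (hgap : ∀ k l : Fin n, (k:ℕ) < p → p ≤ l → exp x * D.t k ≤ 4 * D.t l) (ℓ0 : (Fin q ↪o Fin n) → K) (hℓ0 : ∀ I, ℓ0 I ∈ Φ.R)
      (hsupp : ∀ v I, vecMul ℓ0 (cm q (L v)⁻¹) I ≠ 0 → vecMul (fun J => cm q D.Z.adjugate (top p q n h) J) (cm q (L v)⁻¹) I ≠ 0),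
      (∃ J, J ≠ top p q n h ∧ vecMul ℓ0 (cm q D.Z) J ≠ 0) →
      exp x ≤ Cst * (∏ v, ∑ I, Φ.w v (vecMul ℓ0 (cm q (L v)⁻¹) I)) * (∏ v, ∑ J, Φ.w v (cm q D.Z.adjugate (top p q n h) J)) ^ fc S := by
  classical
  obtain ⟨CL, hCL, hlow⟩ := low Φ (fun v => cm q (L v)⁻¹)
  set bf : ℝ := q.factorial * (2 ^ n) ^ q with hc1
  have hc1p : 0 < bf := by positivity
  refine ⟨(q.factorial * (CL * bf)) ^ fc S * C ^ q * (C ^ q * (2 ^ q * 4) * C ^ q), fun s hs D x hx hgap ℓ0 hℓ0 hsupp hex => ?_⟩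
  set T := top p q n h with hT
  set ℓ : (Fin q ↪o Fin n) → K := fun J => cm q D.Z.adjugate T J with hℓ
  have hadjR : ∀ i j, D.Z.adjugate i j ∈ Φ.R := by
    intro i j
    rw [Matrix.adjugate_apply, det_apply]
    exact Subring.sum_mem _ fun π _ => by
      rw [Units.smul_def, zsmul_eq_mul]
      refine Φ.R.mul_mem (intCast_mem _ _) (Subring.prod_mem _ fun k _ => ?_)
      rw [Matrix.updateRow_apply]
      split_ifs
      · rw [Pi.single_apply]; split_ifs <;> [exact Φ.R.one_mem; exact Φ.R.zero_mem]
      · exact D.hZ _ _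
  have hℓR : ∀ J, ℓ J ∈ Φ.R := fun J => cm_mem Φ.R _ hadjR T J
  have hℓ0' : ∃ J, ℓ J ≠ 0 := by
    by_contra hno
    push Not at hno
    have hw := adj_row D.Z T
    rw [show (fun J => cm q D.Z.adjugate T J) = 0 from funext hno, zero_vecMul] at hw
    have := congrFun hw T
    simp at this
    exact pow_ne_zero q D.hd this.symm
  obtain ⟨J1, hJ1⟩ := hℓ0'
  have hNp : ∀ v, 0 < ∑ J, Φ.w v (ℓ J) := fun v => lt_of_lt_of_le ((Φ.w v).pos hJ1)
    (single_le_sum (f := fun J => Φ.w v (ℓ J)) (fun J _ => (Φ.w v).nonneg _) (mem_univ J1))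
  set H := ∏ v, ∑ J, Φ.w v (ℓ J) with hH
  have bo : 1 ≤ H := (Φ.prod_ge _ (hℓR J1) hJ1).trans (prod_le_prod (fun v _ => (Φ.w v).nonneg _) fun v _ =>
    single_le_sum (f := fun J => Φ.w v (ℓ J)) (fun J _ => (Φ.w v).nonneg _) (mem_univ J1))
  set b := vecMul ℓ0 (cm q D.Z) with hb
  obtain ⟨J, hJm, hJmin⟩ := exists_min_image (univ.filter fun J => J ≠ T ∧ b J ≠ 0) om (by
    obtain ⟨J, hJ⟩ := hex; exact ⟨J, by simpa using hJ⟩)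
  simp only [mem_filter, mem_univ, true_and] at hJm hJmin
  have hbR : b J ∈ Φ.R := Subring.sum_mem _ fun I _ => Φ.R.mul_mem (hℓ0 I) (cm_mem _ _ D.hZ _ _)
  have hbv : ∀ v, b J = ∑ I, vecMul ℓ0 (cm q (L v)⁻¹) I * cm q (L v * D.Z * D.U v) I J := by
    intro v
    have ei : vecMul (vecMul ℓ0 (cm q (L v)⁻¹)) (cm q (L v * D.Z * D.U v)) J = vecMul b (cm q (D.U v)) J := by
      rw [hb, vecMul_vecMul, vecMul_vecMul, ← cm_mul, ← cm_mul, Matrix.mul_assoc (L v), ← Matrix.mul_assoc (L v)⁻¹,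
        nonsing_inv_mul _ (hL v).isUnit, Matrix.one_mul]
    refine Eq.trans ?_ ei.symm
    rw [vecMul, dotProduct, sum_eq_single J]
    · rw [(cm_upper (D.U v) (D.U1 v) (D.U2 v)).1, mul_one]
    · intro I _ hI
      by_contra hne
      have hw := (cm_upper (D.U v) (D.U1 v) (D.U2 v)).2 I J hI (right_ne_zero_of_mul hne)
      have ea := om_top p q n h J hJm.1
      by_cases hIT : I = T
      · rw [hIT, hT] at hw; omega
      · have := hJmin I ⟨hIT, left_ne_zero_of_mul hne⟩; omega
    · simp
  refine elim_num Φ (b J) (Φ.prod_ge _ hbR hJm.2) (fun v => ∑ I, Φ.w v (vecMul ℓ0 (cm q (L v)⁻¹) I)) (fun v => ∑ J, Φ.w v (ℓ J))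
    (fun v => ∏ a, D.p v (J a)) (fun v => ∏ a, D.p v (T a)) (fun v => Φ.w v (D.Z.det ^ q)) (q.factorial * (CL * bf)) H (C ^ q) _
    (fun v => sum_nonneg fun I _ => (Φ.w v).nonneg _) hNp (fun v => prod_pos fun a _ => D.p0 v _)
    (fun v => prod_pos fun a _ => D.p0 v _) (fun v => (Φ.w v).nonneg _) (by positivity) (fun v => ?_) rfl bo ?_ _ (exp_pos x).le ?_
  · have hPT : 0 < ∏ a, D.p v (T a) := prod_pos fun a _ => D.p0 v _
    have hPJ : 0 < ∏ a, D.p v (J a) := prod_pos fun a _ => D.p0 v _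
    have hN := hNp v
    obtain ⟨N, hNd⟩ : ∃ N, N = ∑ J, Φ.w v (ℓ J) := ⟨_, rfl⟩
    rw [hbv v]
    rw [← hNd] at hN ⊢
    refine (mlr ((Φ.w v).sum_le _ _) (mul_nonneg hN.le hPT.le)).trans ?_
    rw [sum_mul, sum_mul]
    refine sum_le_sum fun I _ => ?_
    rw [map_mul, mul_assoc]
    by_cases hz : vecMul ℓ0 (cm q (L v)⁻¹) I = 0
    · rw [hz, map_zero, zero_mul, zero_mul]
    refine mll ?_ ((Φ.w v).nonneg _)
    have g1 := hlow ℓ hℓR v I (hsupp v I hz)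
    have bp := a_up Φ L hL C p h s hs D v I
    have g3 := cm_bound (q := q) (Φ.w v) (L v * D.Z * D.U v) (fun i => (s v i)⁻¹) (D.p v) (fun i j => by
      rw [mul_comm, ← div_eq_mul_inv, le_div_iff₀ (hs v i)]; exact D.piv v j i) I J
    rw [prod_inv_distrib] at g3
    have hsI : 0 < ∏ a, s v (I a) := prod_pos fun a _ => hs v _
    rw [← hT, ← hc1] at bp
    change Φ.w v (vecMul ℓ (cm q (L v)⁻¹) I) * _ ≤ _ at bp
    rw [← hH] at g1
    generalize Φ.w v (vecMul ℓ (cm q (L v)⁻¹) I) = α at g1 bp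
    generalize Φ.w v (cm q (L v * D.Z * D.U v) I J) = ξ at g3 ⊢
    generalize (∏ a, s v (I a)) = sI at bp g3 hsI
    generalize (∏ a, D.p v (J a)) = PJ at g3 hPJ ⊢
    generalize (∏ a, D.p v (T a)) = PT at bp hPT ⊢
    rw [← hNd] at g1
    have hk := (Φ.w v).nonneg (D.Z.det ^ q)
    generalize Φ.w v (D.Z.det ^ q) = k at bp hk ⊢
    have hf : (0:ℝ) ≤ q.factorial := by positivity
    have g4 : N * PT ≤ CL * bf * H * k * sI := by
      have ei := mlr g1 hPT.le
      have et := mll bp (mul_nonneg hCL.le (zero_le_one.trans bo))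
      linarith
    have g5 : ξ * sI ≤ q.factorial * PJ := by
      have := mlr g3 hsI.le
      refine this.trans (le_of_eq ?_); field_simp
    refine le_of_mul_le_mul_right (a := sI) ?_ hsI
    have ed := mlr g5 (mul_nonneg hN.le hPT.le)
    have ev := mll g4 (mul_nonneg hf hPJ.le)
    linarith
  · refine le_trans (le_of_eq ?_) (pow_le_pow_left₀ (prod_nonneg fun v _ => (Φ.w v).nonneg _) D.hdC q)
    rw [← prod_pow]
    exact prod_congr rfl fun v _ => map_pow _ _ _
  · obtain ⟨hlt1, hlt2⟩ := lt_props Φ L C _ D p x hgap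
    have ei := Gf_cmp (fun i => log (D.t i)) p x hx hlt1 hlt2 J T (emb_le_top p q n h J)
    obtain ⟨a, ha⟩ := ne_top_low p q n h J hJm.1
    unfold Gf at ei
    rw [if_neg (fun hh => absurd (hh a) (by omega)), if_pos (fun a => by rw [hT, top_val]; omega)] at ei
    have hTT : ∀ J : Fin q ↪o Fin n, ∏ a, D.t (J a) = exp (∑ a, log (D.t (J a))) := fun J => by
      rw [exp_sum]; exact prod_congr rfl fun a _ => (exp_log (D.t0 _)).symm
    have bn : log (2 ^ q * 4) = q * log 2 + log 4 := by rw [log_mul (by positivity) (by norm_num), log_pow]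
    have bz : (2 ^ q * 4 : ℝ) = exp (q * log 2 + log 4) := by rw [← bn, exp_log (by positivity)]
    have et : exp x * ∏ a, D.t (J a) ≤ 2 ^ q * 4 * ∏ a, D.t (T a) := by
      rw [hTT, hTT, bz, ← exp_add, ← exp_add]
      apply exp_le_exp.2; linarith
    have hCq : 0 ≤ C ^ q := by positivity
    have ed : ∏ v, ∏ a, D.p v (J a) ≤ C ^ q * ∏ a, D.t (J a) := by
      rw [prod_comm]
      refine (prod_le_prod (fun a _ => prod_nonneg fun v _ => (D.p0 v _).le) fun a _ => D.tau1 (J a)).trans (le_of_eq ?_)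
      rw [prod_mul_distrib]; simp
    have ev : ∏ a, D.t (T a) ≤ C ^ q * ∏ v, ∏ a, D.p v (T a) := by
      rw [prod_comm]
      refine (prod_le_prod (fun a _ => (D.t0 _).le) fun a _ => D.tau2 (T a)).trans (le_of_eq ?_)
      rw [prod_mul_distrib]; simp
    have am := mll ed (exp_pos x).le
    have ak := mll et hCq
    have e9 := mll ev (mul_nonneg hCq (by positivity : (0:ℝ) ≤ 2 ^ q * 4))
    linarith
end wst4
end
section
open MvPolynomial
section wst5
variable {n q : ℕ} {K : Type} [Field K] [CharZero K] {S : Type} [Fintype S]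
lemma fiber_inf {α β : Type*} [Finite β] (A : Set α) (hA : A.Infinite) (f : α → β) : ∃ y, {x ∈ A | f x = y}.Infinite := by
  by_contra hno
  push Not at hno
  refine hA ((Set.finite_iUnion hno).subset fun x hx => Set.mem_iUnion.2 ⟨f x, hx, rfl⟩)
lemma kill (Φ : PlaceSys K S) (L : S → Mx n K) (C : ℝ) (p : ℕ) (h : p + q = n) (hq : 0 < q) (au Z : Mx n K) (hZ0 : au.det ≠ 0) (hZ : Z.det ≠ 0)
    (eo : ∀ J, J ≠ top p q n h → vecMul (fun J => cm q au.adjugate (top p q n h) J) (cm q Z) J = 0)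
    (y : Fin n → K) (ha : ∀ l : Fin n, p ≤ l → Z⁻¹.mulVec y l = 0) : (fun k => au.adjugate (top p q n h ⟨0, hq⟩) k) ⬝ᵥ y = 0 := by
  classical
  set T := top p q n h with hT
  have hb : ∀ J, vecMul (fun J => cm q au.adjugate T J) (cm q Z) J = (((au.adjugate * Z).submatrix T id).submatrix id J).det := by
    intro J
    have : vecMul (fun J => cm q au.adjugate T J) (cm q Z) J = (cm q au.adjugate * cm q Z) T J := rfl
    rw [this, ← cm_mul]; rfl
  have hw : (((au.adjugate * Z).submatrix T id).submatrix id T).det ≠ 0 := by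
    intro hw
    rw [← hb] at hw
    have ea : vecMul (fun J => cm q au.adjugate T J) (cm q Z) = 0 := by
      funext J
      by_cases hJ : J = T
      · rw [hJ]; exact hw
      · exact eo J hJ
    have ee := congrArg (fun u => vecMul u (cm q Z⁻¹)) ea
    simp only [vecMul_vecMul, cm_inv Z hZ, Matrix.vecMul_one, zero_vecMul] at ee
    have el := adj_row au T
    rw [ee, zero_vecMul] at el
    have := congrFun el T
    simp at this
    exact pow_ne_zero q hZ0 this.symm
  have hm := minors_zero p q n h ((au.adjugate * Z).submatrix T id) (fun J hJ => by rw [← hb]; exact eo J hJ) hw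
  have hy : y = Z.mulVec (Z⁻¹.mulVec y) := by rw [mulVec_mulVec, mul_nonsing_inv _ hZ.isUnit, one_mulVec]
  have ei : (fun k => au.adjugate (T ⟨0, hq⟩) k) ⬝ᵥ y = (au.adjugate * Z).mulVec (Z⁻¹.mulVec y) (T ⟨0, hq⟩) := by
    rw [← mulVec_mulVec, ← hy]; rfl
  rw [ei, mulVec, dotProduct]
  refine sum_eq_zero fun l _ => ?_
  by_cases hl : (l:ℕ) < p
  · have := hm l hl ⟨0, hq⟩
    rw [show (au.adjugate * Z) (T ⟨0, hq⟩) l = 0 from this, zero_mul]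
  · rw [ha l (by omega), mul_zero]
theorem wst (Φ : PlaceSys K S) (er : S) (hn : 1 ≤ n) (L : S → Mx n K) (hL : ∀ v, (L v).det ≠ 0) (B δ : ℝ) (hB : 0 ≤ B) (hδ : 0 < δ)
    (X : ℕ → ℝ) (hX : Filter.Tendsto X atTop atTop) (c : ℕ → S → Fin n → ℝ) (hc : ∀ j v i, |c j v i| ≤ B)
    (hsum : ∀ j, ∑ v, ∑ i, c j v i ≤ -δ) (y : ℕ → Fin n → K) (hyR : ∀ j i, y j i ∈ Φ.R) (bd : ∀ j, y j ≠ 0)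
    (hy : ∀ j v i, Φ.w v ((L v).mulVec (y j) i) ≤ exp (X j * c j v i)) : ∃ φ : Fin n → K, φ ≠ 0 ∧ {j | φ ⬝ᵥ y j = 0}.Infinite := by
  classical
  obtain ⟨C, hC, hred⟩ := red Φ er hn L hL
  have hD : ∀ j, Nonempty (Red Φ L C (fun v i => exp (-(X j * c j v i)))) := fun j => hred _ fun v i => exp_pos _
  obtain ⟨D⟩ : Nonempty (∀ j, Red Φ L C (fun v i => exp (-(X j * c j v i)))) := ⟨fun j => (hD j).some⟩
  have hn0 : (0:ℝ) < n := mod_cast hn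
  set g : ℝ := δ / (2 * n ^ 2) with hg
  have hg0 : 0 < g := by positivity
  have hya : ∀ j, (D j).Z.mulVec ((D j).Z⁻¹.mulVec (y j)) = y j := fun j => by
    rw [mulVec_mulVec, mul_nonsing_inv _ (D j).hd.isUnit, one_mulVec]
  have hgap : ∀ᶠ j in atTop, ∃ p : Fin n, 1 ≤ (p:ℕ) ∧ (∀ l : Fin n, p ≤ l → (D j).Z⁻¹.mulVec (y j) l = 0) ∧
      ∀ k l : Fin n, k < p → p ≤ l → exp (g * X j) * (D j).t k ≤ 4 * (D j).t l := by
    have hev := hX.eventually_gt_atTop (max 0 ((log C + n * log (2 * C)) * 2 / δ))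
    filter_upwards [hev] with j hj
    have hj0 : 0 < X j := (le_max_left _ _).trans_lt hj
    have hj1 := (le_max_right _ _).trans_lt hj
    rw [div_lt_iff₀ hδ] at hj1
    have hw : (D j).Z⁻¹.mulVec (y j) ≠ 0 := fun eo => bd j (by rw [← hya j, eo, mulVec_zero])
    have ea : (2 * C * exp (g * X j) ^ n) ^ n < ∏ i, (D j).t i := by
      have ei := (D j).st
      simp only [← exp_sum] at ei
      have et : δ * X j ≤ ∑ v, ∑ i, -(X j * c j v i) := by
        simp only [sum_neg_distrib, ← mul_sum]
        have := mll (hsum j) hj0.le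
        linarith
      have hP : 0 < ∏ i, (D j).t i := prod_pos fun i _ => (D j).t0 i
      have ed := (log_le_log (exp_pos _) ((exp_le_exp.2 et).trans ei))
      rw [log_exp, log_mul (by linarith) hP.ne'] at ed
      rw [← Real.log_lt_log_iff (by positivity) hP, log_pow, log_mul (by linarith) (by positivity), log_pow, log_exp]
      have ev : (n:ℝ) * (n * (g * X j)) = δ * X j / 2 := by rw [hg]; field_simp
      rw [mul_add, ev]
      linarith
    obtain ⟨p, hp1, hpn, hpa, hpt⟩ := gap (D j).t (D j).t0 (D j).tm _ hw C (exp (g * X j)) hC (one_le_exp (by positivity))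
      (fun l hl => (D j).ty _ (by rw [hya]; exact hyR j) (fun v i => by
        rw [hya, Real.exp_neg, ← div_eq_mul_inv, div_le_one (exp_pos _)]; exact hy j v i) l hl) ea
    exact ⟨⟨p, hpn⟩, hp1, fun l hl => hpa l hl, fun k l hk hl => hpt k l hk hl⟩
  obtain ⟨ex, hj1⟩ := Filter.eventually_atTop.1 hgap
  have hpc : ∀ j, ∃ p : Fin n, ex ≤ j → 1 ≤ (p:ℕ) ∧ (∀ l : Fin n, p ≤ l → (D j).Z⁻¹.mulVec (y j) l = 0) ∧
      ∀ k l : Fin n, k < p → p ≤ l → exp (g * X j) * (D j).t k ≤ 4 * (D j).t l := by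
    intro j
    by_cases hj : ex ≤ j
    · obtain ⟨p, hp⟩ := hj1 j hj; exact ⟨p, fun _ => hp⟩
    · exact ⟨⟨0, hn⟩, fun h => absurd h hj⟩
  choose pf hpf using hpc
  obtain ⟨p, hp⟩ := fiber_inf (Set.Ici ex) (Set.Ici_infinite ex) pf
  obtain ⟨q, hq⟩ : ∃ q, (p:ℕ) + q = n := ⟨n - p, by omega⟩
  have hq0 : 0 < q := by omega
  set T := top p q n hq with hT
  set ℓ : ℕ → (Fin q ↪o Fin n) → K := fun j J => cm q (D j).Z.adjugate T J with hℓ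
  obtain ⟨I, hI⟩ := fiber_inf _ hp (fun j => fun (v : S) (J : Fin q ↪o Fin n) => (vecMul (ℓ j) (cm q (L v)⁻¹) J = 0 : Prop))
  obtain ⟨av, ⟨hj0, hj0p⟩, hj0I⟩ := hI.nonempty
  obtain ⟨Cst, hCst⟩ := elim Φ L hL C hC p hq
  set N := fc S with hN
  obtain ⟨ao, hX0⟩ := topH (q := q) Φ er hn L hL C hC p hq B g (g / (2 * (N + 1))) hB hg0 (by positivity)
  set A := Cst * (∏ v, ∑ I, Φ.w v (vecMul (ℓ av) (cm q (L v)⁻¹) I)) with hA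
  have hev := hX.eventually_gt_atTop (max (max 0 ao) (2 * |A| / g))
  obtain ⟨j2, hj2⟩ := Filter.eventually_atTop.1 hev
  refine ⟨fun k => (D av).Z.adjugate (T ⟨0, hq0⟩) k, ?_, ?_⟩
  · intro eo
    have hw := Matrix.adjugate_mul (D av).Z
    have ea := congrFun (congrFun hw (T ⟨0, hq0⟩)) (T ⟨0, hq0⟩)
    rw [Matrix.mul_apply, sum_eq_zero (fun k _ => by rw [show (D av).Z.adjugate (T ⟨0, hq0⟩) k = 0 from congrFun eo k, zero_mul])] at ea
    simp at ea
    exact (D av).hd ea.symm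
  · refine (hI.diff (Set.finite_lt_nat j2)).mono ?_
    rintro j ⟨⟨⟨hj, hjp⟩, hjI⟩, hjj⟩
    have hjX := hj2 j (not_lt.1 hjj)
    have hjX0 : 0 < X j := ((le_max_left _ _).trans (le_max_left _ _)).trans_lt hjX
    have hjX1 : ao ≤ X j := ((le_max_right _ _).trans (le_max_left _ _)).trans hjX.le
    have hjX2 := (le_max_right _ _).trans_lt hjX
    rw [div_lt_iff₀ hg0] at hjX2
    obtain ⟨_, ha, hgp⟩ := hpf j hj
    rw [hjp] at ha hgp
    refine kill Φ L C p hq hq0 _ (D j).Z (D av).hd (D j).hd ?_ (y j) ha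
    by_contra hno
    push Not at hno
    have hfin := hCst _ (fun v i => exp_pos _) (D j) (g * X j) (by positivity) hgp (ℓ av) (fun J => cm_mem _ _ (fun a b => by
      rw [Matrix.adjugate_apply, det_apply]
      exact Subring.sum_mem _ fun π _ => by
        rw [Units.smul_def, zsmul_eq_mul]
        refine Φ.R.mul_mem (intCast_mem _ _) (Subring.prod_mem _ fun k _ => ?_)
        rw [Matrix.updateRow_apply]
        split_ifs
        · rw [Pi.single_apply]; split_ifs <;> [exact Φ.R.one_mem; exact Φ.R.zero_mem]
        · exact (D av).hZ _ _) _ _) (fun v J hne eo => hne (by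
          have : (fun (v : S) (J : Fin q ↪o Fin n) => (vecMul (ℓ j) (cm q (L v)⁻¹) J = 0 : Prop)) = fun v J => (vecMul (ℓ av) (cm q (L v)⁻¹) J = 0 : Prop) := hjI.trans hj0I.symm
          have := congrFun (congrFun this v) J
          exact this.mp eo)) hno
    have hH := hX0 (X j) hjX1 (c j) (hc j) (D j) hgp
    have hHp : (∏ v, ∑ J, Φ.w v (cm q (D j).Z.adjugate (top p q n hq) J)) ^ N ≤ exp (g * X j / 2) := by
      refine (pow_le_pow_left₀ (prod_nonneg fun v _ => sum_nonneg fun J _ => (Φ.w v).nonneg _) hH.le N).trans ?_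
      rw [← exp_nat_mul]
      apply exp_le_exp.2
      have ee : (N:ℝ) * (g / (2 * (N + 1)) * X j) = (g * X j / 2) * (N / (N + 1)) := by field_simp
      rw [ee]
      refine mul_le_of_le_one_right (by positivity) ?_
      rw [div_le_one (by positivity)]; linarith
    have el : exp (g * X j) ≤ |A| * exp (g * X j / 2) := by
      refine hfin.trans ?_
      refine (mlr (le_abs_self A) (pow_nonneg (prod_nonneg fun v _ => sum_nonneg fun J _ => (Φ.w v).nonneg _) N)).trans ?_
      exact mll hHp (abs_nonneg A)
    have aa : exp (g * X j) = exp (g * X j / 2) * exp (g * X j / 2) := by rw [← exp_add]; congr 1; ring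
    rw [aa] at el
    have eb : exp (g * X j / 2) ≤ |A| := le_of_mul_le_mul_right el (exp_pos (g * X j / 2))
    have ew := add_one_le_exp (g * X j / 2)
    linarith
end wst5
end
section
open NumberField
section inst
lemma cells {α ι β : Type*} [Fintype ι] [Fintype β] (t : Finset α) (f : α → ι → ℂ) (g : α → β) (D ε : ι → ℝ) (hε : ∀ i, 0 < ε i)
    (hD : ∀ a ∈ t, ∀ i, ‖f a i‖ ≤ D i) (h : (fc β : ℝ) * ∏ i, (4 * D i / ε i + 3) ^ 2 < t.card) :
    ∃ a ∈ t, ∃ b ∈ t, a ≠ b ∧ g a = g b ∧ ∀ i, ‖f a i - f b i‖ < ε i := by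
  classical
  rcases t.eq_empty_or_nonempty with rfl | ⟨al, bc⟩
  · exfalso; simp only [card_empty, Nat.cast_zero] at h
    exact absurd h (not_lt.2 (mul_nonneg (Nat.cast_nonneg _) (prod_nonneg fun i _ => sq_nonneg _)))
  have hD0 : ∀ i, 0 ≤ 2 * D i / ε i := fun i => div_nonneg (by linarith [hD al bc i, norm_nonneg (f al i)]) (hε i).le
  let I : ι → Finset ℤ := fun i => Icc (-⌈2 * D i / ε i⌉) ⌈2 * D i / ε i⌉
  let P : Finset (β × (ι → ℤ × ℤ)) := univ ×ˢ piFinset fun i => I i ×ˢ I i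
  let φ : α → β × (ι → ℤ × ℤ) := fun a => (g a, fun i => (⌊2 * (f a i).re / ε i⌋, ⌊2 * (f a i).im / ε i⌋))
  have hI : ∀ i, ∀ r : ℝ, |r| ≤ D i → ⌊2 * r / ε i⌋ ∈ I i := fun i r hr => by
    rw [abs_le] at hr
    rw [mem_Icc, Int.le_floor]
    constructor
    · push_cast
      have := Int.le_ceil (2 * D i / ε i)
      have ea : -(2 * D i / ε i) ≤ 2 * r / ε i := by rw [← neg_div]; exact div_le_div_of_nonneg_right (by linarith) (hε i).le
      linarith
    · exact (Int.floor_le_floor (div_le_div_of_nonneg_right (by linarith) (hε i).le)).trans (Int.floor_le_ceil _)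
  have hφ : ∀ a ∈ t, φ a ∈ P := fun a ha => by
    simp only [P, φ, mem_product, mem_univ, true_and, Fintype.mem_piFinset]
    exact fun i => ⟨hI i _ ((Complex.abs_re_le_norm _).trans (hD a ha i)), hI i _ ((Complex.abs_im_le_norm _).trans (hD a ha i))⟩
  have hcI : ∀ i, ((I i).card : ℝ) ≤ 4 * D i / ε i + 3 := fun i => by
    have hc := Int.ceil_nonneg (hD0 i)
    rw [Int.card_Icc, ← Int.cast_natCast, Int.toNat_of_nonneg (by omega)]
    push_cast
    have := Int.ceil_lt_add_one (2 * D i / ε i)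
    have ea : 4 * D i / ε i = 2 * (2 * D i / ε i) := by ring
    rw [ea]; linarith
  have hcard : (P.card : ℝ) < t.card := by
    refine lt_of_le_of_lt ?_ h
    rw [card_product, card_piFinset, card_univ]; push_cast
    refine mll (prod_le_prod (fun i _ => Nat.cast_nonneg _) fun i _ => ?_) (Nat.cast_nonneg _)
    rw [card_product, ← sq]; push_cast
    exact pow_le_pow_left₀ (Nat.cast_nonneg _) (hcI i) 2
  obtain ⟨a, ha, b, hb, hab, he⟩ := exists_ne_map_eq_of_card_lt_of_maps_to (mod_cast hcard) hφ
  refine ⟨a, ha, b, hb, hab, (Prod.ext_iff.1 he).1, fun i => ?_⟩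
  have ea := Prod.ext_iff.1 (congrFun (Prod.ext_iff.1 he).2 i)
  have key : ∀ r r' : ℝ, ⌊2 * r / ε i⌋ = ⌊2 * r' / ε i⌋ → |r - r'| < ε i / 2 := fun r r' hr => by
    have := Int.abs_sub_lt_one_of_floor_eq_floor hr
    rw [← sub_div, ← mul_sub, abs_div, abs_mul, abs_of_pos (hε i), abs_two, div_lt_one (hε i)] at this
    linarith
  have ee := key _ _ ea.1
  have el := key _ _ ea.2
  have eb := Complex.norm_le_abs_re_add_abs_im (f a i - f b i)
  rw [Complex.sub_re, Complex.sub_im] at eb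
  linarith
variable {K : Type} [Field K] [NumberField K]
def sqv (v : FinitePlace K) : AV K where
  toFun x := √(v x)
  map_mul' x y := by rw [map_mul, Real.sqrt_mul (apply_nonneg v x)]
  nonneg' x := sqrt_nonneg _
  eq_zero' x := by rw [Real.sqrt_eq_zero (apply_nonneg v x), map_eq_zero]
  add_le' x y := by
    refine (Real.sqrt_le_sqrt (map_add_le_add v x y)).trans ?_
    rw [Real.sqrt_le_left (by positivity)]
    nlinarith [sq_sqrt (apply_nonneg v x), sq_sqrt (apply_nonneg v y), sqrt_nonneg (v x), sqrt_nonneg (v y)]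
abbrev Sf (N : K) := {v : FinitePlace K // v N ≠ 1}
def wv (N : K) : InfinitePlace K ⊕ Sf N → AV K := Sum.elim (fun s => s.1) (fun v => sqv v.1)
def RN (N : K) : Subring K where
  carrier := {x | ∀ v : FinitePlace K, v N = 1 → v x ≤ 1}
  mul_mem' ha hb v hv := by rw [map_mul]; exact mul_le_one₀ (ha v hv) (apply_nonneg v _) (hb v hv)
  one_mem' v hv := by rw [map_one]
  add_mem' ha hb v hv := (map_add_le_max v _ _).trans (max_le (ha v hv) (hb v hv))
  zero_mem' v hv := by rw [map_zero]; exact zero_le_one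
  neg_mem' ha v hv := by rw [map_neg_eq_map]; exact ha v hv
lemma int_le (v : FinitePlace K) (x : 𝓞 K) : v (x : K) ≤ 1 := by
  rw [← FinitePlace.norm_embedding_eq]; exact FinitePlace.norm_le_one K v.maximalIdeal x
lemma int_mem (N : K) (x : 𝓞 K) : (x : K) ∈ RN N := fun v _ => int_le v x
def qv (v : FinitePlace K) : ℝ := Ideal.absNorm v.maximalIdeal.asIdeal
lemma qv_gt (v : FinitePlace K) : 1 < qv v := by
  have := NumberField.HeightOneSpectrum.one_lt_absNorm v.maximalIdeal
  unfold qv; exact_mod_cast this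
lemma mem_pow_le (v : FinitePlace K) (e : ℕ) (x : 𝓞 K) (h : x ∈ v.maximalIdeal.asIdeal ^ e) : v (x : K) ≤ (qv v ^ e)⁻¹ := by
  by_cases hx : x = 0
  · rw [hx]; simp only [map_zero]; have := qv_gt v; positivity
  have hw := FinitePlace.apply_mul_absNorm_pow_eq_one v hx
  have ea : e ≤ multiplicity v.maximalIdeal.asIdeal (Ideal.span {x}) := by
    refine FiniteMultiplicity.le_multiplicity_of_pow_dvd ?_ ?_
    · exact FiniteMultiplicity.of_prime_left v.maximalIdeal.prime (by simpa using hx)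
    · rwa [Ideal.dvd_span_singleton]
  have hq := qv_gt v
  rw [← qv] at hw
  rw [eq_inv_of_mul_eq_one_left hw]
  exact inv_anti₀ (by positivity) (pow_le_pow_right₀ hq.le ea)
variable (N : K) [Fintype (Sf N)] [IsTotallyComplex K]
lemma pge (x : K) (hx : x ∈ RN N) (eo : x ≠ 0) : 1 ≤ ∏ s, wv N s x := by
  classical
  have hw := prod_abs_eq_one eo
  simp only [IsTotallyComplex.mult_eq, prod_pow] at hw
  have hpos : ∀ v : FinitePlace K, 0 < v x := fun v => FinitePlace.pos_iff.2 eo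
  have ea : ∏ᶠ v : FinitePlace K, v x ≤ ∏ v : Sf N, v.1 x := by
    have hf := FinitePlace.hasFiniteMulSupport eo
    rw [finprod_eq_prod_of_mulSupport_subset (s := hf.toFinset ∪ univ.image fun v : Sf N => v.1) _ (fun v hv => mem_coe.2 (mem_union_left _ (hf.mem_toFinset.2 hv)))]
    rw [← prod_image (s := univ) (g := fun v : Sf N => v.1) (f := fun v : FinitePlace K => v x) (fun a _ b _ h => Subtype.ext h),
      ← prod_sdiff (subset_union_right : univ.image (fun v : Sf N => v.1) ⊆ hf.toFinset ∪ univ.image fun v : Sf N => v.1)]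
    refine mul_le_of_le_one_left (prod_nonneg fun v _ => (hpos v).le) (prod_le_one (fun v _ => (hpos v).le) fun v hv => hx v ?_)
    by_contra hN
    exact (mem_sdiff.1 hv).2 (mem_image.2 ⟨⟨v, hN⟩, mem_univ _, rfl⟩)
  have ee : (∏ s, wv N s x) ^ 2 = (∏ w : InfinitePlace K, w x) ^ 2 * ∏ v : Sf N, v.1 x := by
    rw [prod_sum_type, mul_pow]
    congr 1
    rw [← prod_pow]; exact prod_congr rfl fun v _ => sq_sqrt (apply_nonneg _ _)
  have el : 1 ≤ (∏ s, wv N s x) ^ 2 := by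
    rw [ee]; exact hw.symm.le.trans (mll ea (sq_nonneg _))
  exact (one_le_sq_iff₀ (prod_nonneg fun s _ => (wv N s).nonneg _)).1 el
lemma wcount : ∃ C : ℝ, ∃ κ : ℕ, 1 ≤ C ∧ ∀ B : ℝ, 1 ≤ B → ∀ t : Finset K,
    (∀ x ∈ t, x ∈ RN N ∧ ∀ s, wv N s x ≤ B) → (t.card : ℝ) ≤ C * B ^ κ := by
  classical
  set b := fc (Sf N)
  set a := fc (InfinitePlace K)
  refine ⟨((4 * 2 ^ b + 3) ^ 2) ^ a, ((b + 1) * 2) * a, one_le_pow₀ (one_le_pow₀ (by have : (0:ℝ) < 2 ^ b := by positivity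
                                                                                     linarith)), fun B hB t ht => ?_⟩
  by_contra hlt
  have hε : (0:ℝ) < ((2 * B) ^ b)⁻¹ := by positivity
  obtain ⟨x, hx, y, hy, hxy, -, h⟩ := cells t (fun x (s : InfinitePlace K) => s.embedding x) (fun _ => ()) (fun _ => B) (fun _ => ((2 * B) ^ b)⁻¹)
    (fun _ => hε) (fun x hx s => by rw [InfinitePlace.norm_embedding_eq]; exact (ht x hx).2 (Sum.inl s)) (by
      refine lt_of_le_of_lt ?_ (not_le.1 hlt)
      rw [prod_const, card_univ, Fintype.card_unit, Nat.cast_one, one_mul, pow_mul, ← mul_pow, pow_mul, ← mul_pow]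
      refine pow_le_pow_left₀ (by positivity) (pow_le_pow_left₀ (by positivity) ?_ 2) _
      have : (1:ℝ) ≤ B ^ (b + 1) := one_le_pow₀ hB
      rw [div_inv_eq_mul, mul_pow]
      have eb : 4 * B * (2 ^ b * B ^ b) = 4 * 2 ^ b * B ^ (b + 1) := by ring
      rw [eb, add_mul]; linarith)
  have hw := pge N (x - y) ((RN N).sub_mem (ht x hx).1 (ht y hy).1) (sub_ne_zero.2 hxy)
  rw [prod_sum_type] at hw
  have hs : ∀ s : InfinitePlace K, wv N (Sum.inl s) (x - y) < ((2 * B) ^ b)⁻¹ := fun s => by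
    have := h s
    rw [← map_sub, InfinitePlace.norm_embedding_eq] at this; exact this
  have ea : ∏ v : Sf N, wv N (Sum.inr v) (x - y) ≤ (2 * B) ^ b := by
    refine (prod_le_prod (fun v _ => AbsoluteValue.nonneg _ _) fun v _ => ?_).trans_eq (prod_const _)
    refine ((wv N (Sum.inr v)).sub_le_add _ _).trans ?_
    linarith [(ht x hx).2 (Sum.inr v), (ht y hy).2 (Sum.inr v)]
  obtain ⟨s0⟩ : Nonempty (InfinitePlace K) := inferInstance
  have ee : ∏ s : InfinitePlace K, wv N (Sum.inl s) (x - y) < ((2 * B) ^ b)⁻¹ := by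
    rw [← mul_prod_erase univ _ (mem_univ s0)]
    refine lt_of_le_of_lt (mul_le_of_le_one_right (AbsoluteValue.nonneg _ _) (prod_le_one (fun _ _ => AbsoluteValue.nonneg _ _) fun s _ => ?_)) (hs s0)
    exact (hs s).le.trans (inv_le_one_of_one_le₀ (one_le_pow₀ (by linarith)))
  have el := mul_lt_mul_of_pos_right ee (inv_pos.1 hε)
  rw [inv_mul_cancel₀ (inv_pos.1 hε).ne'] at el
  exact absurd (hw.trans (mll ea (prod_nonneg fun _ _ => AbsoluteValue.nonneg _ _))) (not_le.2 el)
end inst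
end
section
open NumberField
section inst2
variable {K : Type} [Field K] [NumberField K]
variable (N : K) [Fintype (Sf N)] [IsTotallyComplex K] {n : ℕ}
lemma minkI (L : InfinitePlace K ⊕ Sf N → Mx n K) (M : 𝓞 K) (hM : M ≠ 0) (P : Sf N → Fin n → Fin n → 𝓞 K)
    (hP : ∀ v i j, (P v i j : K) = M * L (Sum.inr v) i j) : ∃ C : ℝ, 0 < C ∧ ∀ A : InfinitePlace K ⊕ Sf N → Fin n → ℝ, (∀ s i, 0 < A s i) →
      (∀ v i, A (Sum.inr v) i ^ 2 * v.1 (M : K) ≤ 1) → C ≤ ∏ s, ∏ i, A s i →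
      ∃ y : Fin n → 𝓞 K, y ≠ 0 ∧ ∀ s i, wv N s ((L s).mulVec (fun i => (y i : K)) i) ≤ A s i := by
  classical
  set bs := RingOfIntegers.basis K
  let D : InfinitePlace K × Fin n → ℝ := fun p => ∑ j, p.1 (L (Sum.inl p.1) p.2 j) * ∑ k, p.1 (bs k : K)
  have hD : ∀ p, 0 ≤ D p := fun p => sum_nonneg fun j _ => mul_nonneg (apply_nonneg _ _) (sum_nonneg fun k _ => apply_nonneg _ _)
  have hMv : ∀ v : FinitePlace K, 0 < v (M : K) := fun v => FinitePlace.pos_iff.2 (by simpa using hM)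
  let ez : ℝ := ∏ p : Sf N × Fin n, qv p.1.1 / p.1.1 (M : K)
  let af : ℝ := ∏ p : InfinitePlace K × Fin n, (4 * D p + 3) ^ 2
  have hE1 : 0 < ez := prod_pos fun p _ => div_pos (by linarith [qv_gt p.1.1]) (hMv _)
  have hE2 : 0 < af := prod_pos fun p _ => by have := hD p; positivity
  have hE : 0 < ez * af := mul_pos hE1 hE2
  refine ⟨ez * af + 1, by linarith, fun A hA hA1 hC => ?_⟩
  have hex : ∀ p : Sf N × Fin n, ∃ e : ℕ, (qv p.1.1 ^ e)⁻¹ ≤ A (Sum.inr p.1) p.2 ^ 2 * p.1.1 (M : K) ∧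
      qv p.1.1 ^ e ≤ qv p.1.1 / p.1.1 (M : K) / A (Sum.inr p.1) p.2 ^ 2 := fun p => by
    have hr : 0 < A (Sum.inr p.1) p.2 ^ 2 * p.1.1 (M : K) := mul_pos (pow_pos (hA _ _) 2) (hMv _)
    have hq := qv_gt p.1.1
    obtain ⟨m, hw, ea⟩ := exists_nat_pow_near ((one_le_inv₀ hr).2 (hA1 p.1 p.2)) hq
    refine ⟨m + 1, ?_, ?_⟩
    · rw [inv_le_comm₀ (by positivity) hr]; exact ea.le
    · rw [pow_succ', div_div, mul_comm (p.1.1 (M : K)), div_eq_mul_inv]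
      exact mll hw (by linarith)
  choose e he1 he2 using hex
  let I : Sf N × Fin n → Ideal (𝓞 K) := fun p => p.1.1.maximalIdeal.asIdeal ^ e p
  have hI : ∀ p, I p ≠ ⊥ := fun p => pow_ne_zero _ p.1.1.maximalIdeal.ne_bot
  letI : ∀ p, Fintype (𝓞 K ⧸ I p) := fun p => haveI := Ideal.finiteQuotientOfFreeOfNeBot (I p) (hI p); Fintype.ofFinite _
  obtain ⟨X, hX⟩ : ∃ X : ℕ, 1 + ∑ p : InfinitePlace K × Fin n, A (Sum.inl p.1) p.2 ≤ X := exists_nat_ge _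
  have hsA : ∀ p : InfinitePlace K × Fin n, A (Sum.inl p.1) p.2 ≤ X := fun p => by
    have := single_le_sum (f := fun p : InfinitePlace K × Fin n => A (Sum.inl p.1) p.2) (fun p _ => (hA _ _).le) (mem_univ p)
    linarith
  have hX0 : (0:ℝ) < X := by
    have := sum_nonneg (s := univ) (f := fun p : InfinitePlace K × Fin n => A (Sum.inl p.1) p.2) (fun p _ => (hA _ _).le)
    linarith
  let Y : (Fin n × Module.Free.ChooseBasisIndex ℤ (𝓞 K) → Fin X) → Fin n → 𝓞 K := fun a i => ∑ k, ((a (i, k) : ℕ) : ℤ) • bs k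
  have hY : Injective Y := fun a b hab => by
    funext ⟨i, k⟩
    have hw := congrFun hab i
    have ea := bs.equivFun.symm.injective (a₁ := fun k => ((a (i, k) : ℕ) : ℤ)) (a₂ := fun k => ((b (i, k) : ℕ) : ℤ)) (by
      rw [Basis.equivFun_symm_apply, Basis.equivFun_symm_apply]; exact hw)
    have ee := congrFun ea k
    exact Fin.ext (mod_cast ee)
  obtain ⟨a, -, b, -, hab, hg, hf⟩ := cells univ (fun a (p : InfinitePlace K × Fin n) => p.1.embedding ((L (Sum.inl p.1)).mulVec (fun i => (Y a i : K)) p.2))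
    (fun a (p : Sf N × Fin n) => Ideal.Quotient.mk (I p) (∑ j, P p.1 p.2 j * Y a j)) (fun p => X * D p) (fun p => A (Sum.inl p.1) p.2) (fun p => hA _ _)
    (fun a _ p => by
      rw [InfinitePlace.norm_embedding_eq]
      simp only [mulVec, dotProduct, D, mul_sum (a := (X:ℝ))]
      refine (p.1.1.sum_le _ _).trans (sum_le_sum fun j _ => ?_) 
      rw [map_mul, mul_left_comm]
      refine mll ?_ (apply_nonneg _ _)
      simp only [Y, map_sum, mul_sum]
      refine (p.1.1.sum_le _ _).trans (sum_le_sum fun k _ => ?_) 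
      rw [zsmul_eq_mul, map_mul, map_mul]
      refine mlr ?_ (apply_nonneg _ _)
      simp only [Int.cast_natCast, map_natCast]
      have bl : p.1 (((a (j, k) : ℕ)) : K) = ((a (j, k) : ℕ) : ℝ) := by
        rw [← InfinitePlace.norm_embedding_eq, map_natCast, Complex.norm_natCast]
      exact bl.le.trans (mod_cast (a (j, k)).2.le))
    (by
      have hcc : fc (InfinitePlace K) = InfinitePlace.nrComplexPlaces K := by
        rw [InfinitePlace.card_eq_nrRealPlaces_add_nrComplexPlaces, IsTotallyComplex.nrRealPlaces_eq_zero, zero_add]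
      have hcb : (fc (∀ p, 𝓞 K ⧸ I p) : ℝ) = ∏ p, qv p.1.1 ^ e p := by
        rw [Fintype.card_pi]; push_cast
        refine prod_congr rfl fun p _ => ?_
        rw [← Nat.card_eq_fintype_card, ← Submodule.cardQuot_apply, ← Ideal.absNorm_apply, map_pow]; push_cast; rfl
      rw [hcb, card_univ, card_fun, card_prod, Fintype.card_fin, Fintype.card_fin, ← Module.finrank_eq_card_chooseBasisIndex,
        RingOfIntegers.rank, IsTotallyComplex.finrank, ← hcc]
      have hp1 : ∏ p, qv p.1.1 ^ e p ≤ ez / (∏ p : Sf N × Fin n, A (Sum.inr p.1) p.2) ^ 2 := by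
        rw [← prod_pow, ← prod_div_distrib]
        exact prod_le_prod (fun p _ => by have := qv_gt p.1.1; positivity) fun p _ => he2 p
      have hp2 : ∏ p : InfinitePlace K × Fin n, (4 * (X * D p) / A (Sum.inl p.1) p.2 + 3) ^ 2 ≤
          af * (X ^ 2) ^ (fc (InfinitePlace K) * n) / (∏ p : InfinitePlace K × Fin n, A (Sum.inl p.1) p.2) ^ 2 := by
        rw [← prod_pow, show (((X:ℝ) ^ 2) ^ (fc (InfinitePlace K) * n)) = ∏ p : InfinitePlace K × Fin n, (X:ℝ) ^ 2 by
          rw [prod_const, card_univ, card_prod, Fintype.card_fin], ← prod_mul_distrib, ← prod_div_distrib]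
        refine prod_le_prod (fun p _ => sq_nonneg _) fun p _ => ?_
        rw [← mul_pow, ← div_pow]
        have hw := hA (Sum.inl p.1) p.2
        have ea := hD p
        refine pow_le_pow_left₀ (by positivity) ?_ 2
        rw [div_add' _ _ _ hw.ne']
        refine div_le_div_of_nonneg_right ?_ hw.le
        linarith [hsA p]
      have hAA : (∏ p : InfinitePlace K × Fin n, A (Sum.inl p.1) p.2) * ∏ p : Sf N × Fin n, A (Sum.inr p.1) p.2 = ∏ s, ∏ i, A s i := by
        rw [prod_sum_type, prod_prod_type, prod_prod_type]
      set a1 := ∏ p : InfinitePlace K × Fin n, A (Sum.inl p.1) p.2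
      set a2 := ∏ p : Sf N × Fin n, A (Sum.inr p.1) p.2
      have ha1 : 0 < a1 := prod_pos fun p _ => hA _ _
      have ha2 : 0 < a2 := prod_pos fun p _ => hA _ _
      refine (mul_le_mul hp1 hp2 (prod_nonneg fun p _ => sq_nonneg _) (by positivity)).trans_lt ?_
      rw [← pow_mul]
      have bg : ez * af < (a1 * a2) ^ 2 := by rw [hAA]; nlinarith
      have h10 : 2 * (fc (InfinitePlace K) * n) = n * (2 * fc (InfinitePlace K)) := by ring
      rw [h10]; push_cast
      have h11 : (0:ℝ) < (X:ℝ) ^ (n * (2 * fc (InfinitePlace K))) := by positivity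
      rw [div_mul_div_comm, div_lt_iff₀ (by positivity)]
      have h12 := mul_lt_mul_of_pos_right bg h11
      linarith)
  refine ⟨fun i => Y a i - Y b i, fun h => hab (hY (funext fun i => sub_eq_zero.1 (congrFun h i))), fun s i => ?_⟩
  have hsub : (fun i => ((Y a i - Y b i : 𝓞 K) : K)) = (fun i => (Y a i : K)) - fun i => (Y b i : K) := by
    funext i; simp
  rcases s with s | v
  · have := hf (s, i)
    rw [← map_sub, InfinitePlace.norm_embedding_eq, ← Pi.sub_apply, ← Matrix.mulVec_sub, ← hsub] at this
    exact this.le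
  · have hw := congrFun hg (v, i)
    rw [Ideal.Quotient.mk_eq_mk_iff_sub_mem, ← sum_sub_distrib] at hw
    have ea := (mem_pow_le _ _ _ hw).trans (he1 (v, i))
    have ee : ((∑ j, (P v i j * Y a j - P v i j * Y b j) : 𝓞 K) : K) = M * ((L (Sum.inr v)).mulVec (fun i => ((Y a i - Y b i : 𝓞 K) : K)) i) := by
      simp only [mulVec, dotProduct, mul_sum, map_sum, map_sub, map_mul]
      refine sum_congr rfl fun j _ => ?_
      have := hP v i j
      linear_combination (algebraMap (𝓞 K) K (Y a j) - algebraMap (𝓞 K) K (Y b j)) * this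
    rw [ee, map_mul, mul_comm] at ea
    have el := le_of_mul_le_mul_right ea (hMv v.1)
    exact Real.sqrt_le_iff.2 ⟨(hA _ _).le, el⟩
end inst2
end
section
open NumberField
section inst3
variable {K : Type} [Field K] [NumberField K]
lemma tc (i : K) (hi : i ^ 2 = -1) : IsTotallyComplex K := ⟨fun w => by
  by_contra h
  rw [InfinitePlace.not_isComplex_iff_isReal] at h
  have hw := InfinitePlace.embedding_of_isReal_apply h i
  have ea : (InfinitePlace.embedding_of_isReal h i) ^ 2 = -1 := by rw [← map_pow, hi, map_neg, map_one]
  nlinarith [sq_nonneg (InfinitePlace.embedding_of_isReal h i)]⟩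
lemma dvd_one {m N : 𝓞 K} (h : m ∣ N) (v : FinitePlace K) (hv : v (N : K) = 1) : v (m : K) = 1 := by
  obtain ⟨k, rfl⟩ := h
  have ea : v (m : K) * v (k : K) = 1 := by rw [← hv, ← map_mul]; congr 1
  refine le_antisymm (int_le v m) ?_
  rw [← ea]; exact mul_le_of_le_one_right (apply_nonneg _ _) (int_le v k)
lemma dvd_inv {m N : 𝓞 K} (h : m ∣ N) : (m : K)⁻¹ ∈ RN (N : K) := fun v hv => by
  rw [map_inv₀, dvd_one h v hv, inv_one]
theorem ex_place [IsTotallyComplex K] (T : Finset K) (hT : ∀ x ∈ T, x ≠ 0) : ∃ (S : Type) (_ : Fintype S) (Φ : PlaceSys K S),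
    Nonempty S ∧ ∀ x ∈ T, x ∈ Φ.R ∧ x⁻¹ ∈ Φ.R := by
  classical
  have hJ : ∀ c : ClassGroup (𝓞 K), ∃ J : nonZeroDivisors (Ideal (𝓞 K)), ∃ m : 𝓞 K, ClassGroup.mk0 J = c ∧ m ∈ (J : Ideal (𝓞 K)) ∧ m ≠ 0 := fun c => by
    obtain ⟨J, hJ⟩ := ClassGroup.mk0_surjective c
    obtain ⟨m, hm, hm0⟩ := Submodule.exists_mem_ne_zero_of_ne_bot (nonZeroDivisors.ne_zero J.2)
    exact ⟨J, m, hJ, hm, hm0⟩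
  choose J m hJ hm hm0 using hJ
  have hnd : ∀ x : K, ∃ a b : 𝓞 K, b ≠ 0 ∧ x = a / b := fun x => by
    obtain ⟨a, b, hb, h⟩ := IsFractionRing.div_surjective (𝓞 K) x
    exact ⟨a, b, nonZeroDivisors.ne_zero hb, h.symm⟩
  choose nu de hde hnu using hnd
  have hnu0 : ∀ x ≠ 0, nu x ≠ 0 := fun x hx h => hx (by rw [hnu x, h]; simp)
  obtain ⟨N, ax, hNT, hNm⟩ : ∃ N : 𝓞 K, N ≠ 0 ∧ (∀ x ∈ T, nu x * de x ∣ N) ∧ ∀ c, m c ∣ N :=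
    ⟨(∏ x ∈ T, nu x * de x) * ∏ c, m c, mul_ne_zero (prod_ne_zero_iff.2 fun x hx => mul_ne_zero (hnu0 x (hT x hx)) (hde x)) (prod_ne_zero_iff.2 fun c _ => hm0 c),
      fun x hx => (dvd_prod_of_mem _ hx).mul_right _, fun c => (dvd_prod_of_mem _ (mem_univ c)).mul_left _⟩
  have hNK : (N : K) ≠ 0 := by simpa using ax
  haveI : Fintype (Sf (N : K)) := (FinitePlace.hasFiniteMulSupport hNK).fintype
  have hNi : (N : K)⁻¹ ∈ RN (N : K) := dvd_inv dvd_rfl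
  refine ⟨InfinitePlace K ⊕ Sf (N : K), inferInstance, ⟨RN (N : K), wv (N : K), pge (N : K), fun x => ?_, wcount (N : K), fun n L _ _ => ?_⟩, ?_, fun x hx => ?_⟩
  · have hI0 : Ideal.span {nu x, de x} ≠ ⊥ := fun h => hde x (by
      have : de x ∈ Ideal.span {nu x, de x} := Ideal.subset_span (by simp)
      rwa [h, Ideal.mem_bot] at this)
    set c := ClassGroup.mk0 ⟨Ideal.span {nu x, de x}, mem_nonZeroDivisors_of_ne_zero hI0⟩ with hc
    obtain ⟨r, s, hr, hs, he⟩ := (ClassGroup.mk0_eq_mk0_iff).1 (hc.symm.trans (hJ c).symm)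
    have hmem : ∀ z ∈ Ideal.span {nu x, de x}, ∃ z', s * z' = r * z := fun z hz => by
      have : r * z ∈ Ideal.span {s} * (J c : Ideal (𝓞 K)) := by rw [← he]; exact Ideal.mul_mem_mul (Ideal.mem_span_singleton_self r) hz
      obtain ⟨z', -, h⟩ := Ideal.mem_span_singleton_mul.1 this
      exact ⟨z', h⟩
    obtain ⟨a, ha⟩ := hmem (nu x) (Ideal.subset_span (by simp))
    obtain ⟨b, hb⟩ := hmem (de x) (Ideal.subset_span (by simp))
    have : s * m c ∈ Ideal.span {r} * Ideal.span {nu x, de x} := by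
      have h := Ideal.mul_mem_mul (Ideal.mem_span_singleton_self s) (hm c)
      rwa [← he] at h
    obtain ⟨z, hz, hz2⟩ := Ideal.mem_span_singleton_mul.1 this
    obtain ⟨u, v, huv⟩ := Ideal.mem_span_pair.1 hz
    have hw : m c = u * a + v * b := mul_left_cancel₀ hs (by linear_combination -hz2 - r * huv - u * ha - v * hb)
    have bb : b ≠ 0 := by rintro rfl; rw [mul_zero] at hb; exact mul_ne_zero hr (hde x) hb.symm
    have hmi := dvd_inv (hNm c)
    have hmK : (m c : K) ≠ 0 := by simpa using hm0 c
    have hbK : (b : K) ≠ 0 := by simpa using bb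
    refine ⟨a, int_mem _ a, b, int_mem _ b, hbK, ?_, u * (m c : K)⁻¹, (RN (N:K)).mul_mem (int_mem _ u) hmi,
      v * (m c : K)⁻¹, (RN (N:K)).mul_mem (int_mem _ v) hmi, ?_⟩
    · have ea : (s * (b * nu x) : 𝓞 K) = s * (a * de x) := by linear_combination nu x * hb - de x * ha
      have ee := congrArg (algebraMap (𝓞 K) K) (mul_left_cancel₀ hs ea)
      rw [map_mul, map_mul] at ee
      have hd : (de x : K) ≠ 0 := by simpa using hde x
      rw [hnu x, div_eq_div_iff hd hbK]; linear_combination ee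
    · have ee := congrArg (algebraMap (𝓞 K) K) hw
      rw [map_add, map_mul, map_mul] at ee
      field_simp; exact ee.symm
  · obtain ⟨M, hM⟩ := IsLocalization.exist_integer_multiples_of_finite (nonZeroDivisors (𝓞 K)) (fun p : Sf (N:K) × Fin n × Fin n => L (Sum.inr p.1) p.2.1 p.2.2)
    choose P hP using hM
    obtain ⟨C, hC, h⟩ := minkI (N : K) L M (nonZeroDivisors.ne_zero M.2) (fun v i j => P (v, i, j)) (fun v i j => (hP (v, i, j)).trans (Algebra.smul_def _ _))
    refine ⟨C, hC, fun A hA hCA => ?_⟩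
    have hk : ∀ᶠ k : ℕ in atTop, ∀ p : Sf (N:K) × Fin n, A (Sum.inr p.1) p.2 ^ 2 * (p.1.1 (N:K)) ^ k * p.1.1 ((M : 𝓞 K) : K) ≤ 1 := by
      rw [Filter.eventually_all]
      intro p
      have hw := tendsto_pow_atTop_nhds_zero_of_lt_one (apply_nonneg p.1.1 (N:K)) (lt_of_le_of_ne (int_le _ N) p.1.2)
      have ea := (hw.const_mul (A (Sum.inr p.1) p.2 ^ 2)).mul_const (p.1.1 ((M : 𝓞 K) : K))
      rw [mul_zero, zero_mul] at ea
      exact ea.eventually_le_const zero_lt_one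
    obtain ⟨k, hk⟩ := hk.exists
    have hNk : (N : K) ^ k ≠ 0 := pow_ne_zero _ hNK
    have hwp : ∀ s, 0 < wv (N:K) s ((N:K) ^ k) := fun s => (wv (N:K) s).pos hNk
    obtain ⟨y, bd, hy⟩ := h (fun s i => A s i * wv (N:K) s ((N:K) ^ k)) (fun s i => mul_pos (hA s i) (hwp s)) (fun v i => by
        refine le_of_eq_of_le ?_ (hk (v, i))
        have : (wv (N:K) (Sum.inr v) ((N:K) ^ k)) ^ 2 = v.1 (N:K) ^ k := by rw [← map_pow v.1]; exact sq_sqrt (apply_nonneg _ _)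
        rw [mul_pow, this]) (by
        simp only [prod_mul_distrib, prod_const, prod_pow]
        refine hCA.trans (le_mul_of_one_le_right (prod_nonneg fun s _ => prod_nonneg fun i _ => (hA s i).le) (one_le_pow₀ ?_))
        exact pge (N:K) _ ((RN (N:K)).pow_mem (int_mem _ N) k) hNk)
    refine ⟨((N:K) ^ k)⁻¹ • fun i => (y i : K), ?_, fun i => ?_, fun s i => ?_⟩
    · refine smul_ne_zero (inv_ne_zero hNk) fun h => bd (funext fun i => ?_)
      have := congrFun h i
      simpa using this
    · rw [Pi.smul_apply, smul_eq_mul, ← inv_pow]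
      exact (RN (N:K)).mul_mem ((RN (N:K)).pow_mem hNi k) (int_mem _ _)
    · rw [mulVec_smul, Pi.smul_apply, smul_eq_mul, map_mul, map_inv₀, inv_mul_le_iff₀ (hwp s), mul_comm]
      exact hy s i
  · exact ⟨Sum.inl (Classical.arbitrary _)⟩
  · have hw := (Dvd.intro _ rfl : nu x ∣ nu x * de x).trans (hNT x hx)
    have ea := (Dvd.intro_left _ rfl : de x ∣ nu x * de x).trans (hNT x hx)
    show x ∈ RN (N:K) ∧ x⁻¹ ∈ RN (N:K)
    constructor
    · rw [hnu x, div_eq_mul_inv]; exact (RN (N:K)).mul_mem (int_mem _ _) (dvd_inv ea)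
    · rw [hnu x, inv_div, div_eq_mul_inv]; exact (RN (N:K)).mul_mem (int_mem _ _) (dvd_inv hw)
end inst3
end
section
section app
variable {K : Type} [Field K] [CharZero K] {S : Type} [Fintype S]
def RU (Φ : PlaceSys K S) : Subgroup Kˣ where
  carrier := {g | (g : K) ∈ Φ.R ∧ ((g⁻¹ : Kˣ) : K) ∈ Φ.R}
  mul_mem' ha hb := ⟨by rw [val_mul]; exact Φ.R.mul_mem ha.1 hb.1, by rw [mul_inv, val_mul]; exact Φ.R.mul_mem ha.2 hb.2⟩
  one_mem' := ⟨Φ.R.one_mem, by rw [inv_one]; exact Φ.R.one_mem⟩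
  inv_mem' ha := ⟨ha.2, by rw [inv_inv]; exact ha.1⟩
lemma RU_prod (Φ : PlaceSys K S) (g : Kˣ) (hg : g ∈ RU Φ) : ∑ v, log (Φ.w v (g : K)) = 0 := by
  have hp : ∀ g : Kˣ, ∀ v ∈ (univ : Finset S), Φ.w v (g : K) ≠ 0 := fun g v _ => (Φ.w v).ne_zero g.ne_zero
  have hw := log_nonneg (Φ.prod_ge g hg.1 g.ne_zero)
  have ea := log_nonneg (Φ.prod_ge _ hg.2 (g⁻¹).ne_zero)
  rw [log_prod (hp _)] at hw ea
  simp only [val_inv_eq_inv_val, map_inv₀, Real.log_inv, sum_neg_distrib] at ea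
  linarith
lemma fin_of_count (Φ : PlaceSys K S) (M : Set ℤ) (f : ℤ → K) (hf : Set.InjOn f M) (B : ℝ) (hB : 1 ≤ B)
    (h : ∀ m ∈ M, f m ∈ Φ.R ∧ ∀ v, Φ.w v (f m) ≤ B) : M.Finite := by
  classical
  obtain ⟨C, κ, -, hC⟩ := Φ.count
  by_contra hM
  obtain ⟨k, hk⟩ := exists_nat_gt (C * B ^ κ)
  obtain ⟨t, ht, hc⟩ := Set.Infinite.exists_subset_card_eq hM k
  have := hC B hB (t.image f) (fun x hx => by
    obtain ⟨m, hm, rfl⟩ := mem_image.1 hx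
    exact h m (ht hm))
  rw [card_image_of_injOn (hf.mono ht), hc] at this
  linarith
lemma tau_prod {n : ℕ} (F : Option (Fin n) → ℝ) (k : Option (Fin n)) :
    ∑ i : Fin n, F (if k = some i then none else some i) = (∑ o, F o) - F k := by
  classical
  rw [Fintype.sum_option]
  rcases k with _ | p
  · simp
  · rw [← add_sum_erase univ _ (mem_univ p), ← add_sum_erase univ (fun i => F (some i)) (mem_univ p), if_pos rfl]
    rw [sum_congr rfl (g := fun i => F (some i)) fun i hi => by rw [if_neg (fun h => (mem_erase.1 hi).1 (Option.some.inj h).symm)]]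
    ring
theorem unit_eq (Φ : PlaceSys K S) (er : S) (Γ : Subgroup Kˣ) (lam : Kˣ) (hΓ : Γ ≤ RU Φ) (hl : lam ∈ RU Φ) (hlin : ∀ m : ℤ, lam ^ m ∈ Γ → m = 0) :
    ∀ N (a : Fin N → K), {m : ℤ | ∃ u : Fin N → Kˣ, (∀ i, u i ∈ Γ) ∧ ((lam ^ m : Kˣ) : K) = ∑ i, a i * u i}.Finite := by
  classical
  intro N
  induction N with
  | zero => exact fun a => Set.Finite.subset Set.finite_empty fun m ⟨u, _, h⟩ => absurd h (by rw [univ_eq_empty, sum_empty]; exact (lam ^ m).ne_zero)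
  | succ N ih =>
  intro a
  have hred : ∀ p, ∀ φ : Fin (N + 1) → K, φ p ≠ 0 → {m : ℤ | ∃ u : Fin (N + 1) → Kˣ, (∀ i, u i ∈ Γ) ∧ ((lam ^ m : Kˣ) : K) = ∑ i, a i * u i ∧ ∑ i, φ i * u i = 0}.Finite := fun p φ hp => by
    refine (ih fun i => a (p.succAbove i) - a p * (φ (p.succAbove i) / φ p)).subset ?_
    rintro m ⟨u, hu, hw, ea⟩
    refine ⟨fun i => u (p.succAbove i), fun i => hu _, ?_⟩
    rw [Fin.sum_univ_succAbove _ p] at hw ea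
    have ee : (u p : K) = -∑ i, φ (p.succAbove i) / φ p * u (p.succAbove i) := by
      have : ∀ i, φ (p.succAbove i) / φ p * (u (p.succAbove i) : K) = (φ p)⁻¹ * (φ (p.succAbove i) * u (p.succAbove i)) := fun i => by ring
      simp only [this, ← mul_sum]
      field_simp
      linear_combination ea
    rw [hw, ee]
    simp only [sub_mul, sum_sub_distrib, mul_assoc, ← mul_sum]
    ring
  by_cases ha : ∃ p, a p = 0
  · obtain ⟨p, hp⟩ := ha
    refine (ih fun i => a (p.succAbove i)).subset ?_
    rintro m ⟨u, hu, hw⟩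
    exact ⟨fun i => u (p.succAbove i), fun i => hu _, by rw [hw, Fin.sum_univ_succAbove _ p, hp, zero_mul, zero_add]⟩
  push Not at ha
  by_contra hinf
  set M := {m : ℤ | ∃ u : Fin (N + 1) → Kˣ, (∀ i, u i ∈ Γ) ∧ ((lam ^ m : Kˣ) : K) = ∑ i, a i * u i} with hM
  have hu : ∀ m : ℤ, ∃ u : Fin (N + 1) → Kˣ, (∀ i, u i ∈ Γ) ∧ (m ∈ M → ((lam ^ m : Kˣ) : K) = ∑ i, a i * u i) := fun m => by
    by_cases h : m ∈ M
    · obtain ⟨u, hw, ea⟩ := h; exact ⟨u, hw, fun _ => ea⟩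
    · exact ⟨1, fun i => Γ.one_mem, fun h' => absurd h' h⟩
  choose u huΓ hue using hu
  let z : ℤ → Option (Fin (N + 1)) → Kˣ := fun m o => o.elim 1 fun i => u m i * (lam ^ m)⁻¹
  have hz : ∀ m o, z m o ∈ RU Φ := fun m o => by
    cases o with
    | none => exact (RU Φ).one_mem
    | some i => exact (RU Φ).mul_mem (hΓ (huΓ m i)) ((RU Φ).inv_mem ((RU Φ).zpow_mem hl m))
  let W : ℤ → S → Option (Fin (N + 1)) → ℝ := fun m v o => log (Φ.w v (z m o : K))
  have hW0 : ∀ m o, ∑ v, W m v o = 0 := fun m o => RU_prod Φ _ (hz m o)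
  have hWn : ∀ m v, W m v none = 0 := fun m v => by simp [W, z]
  have hWe : ∀ m v o, exp (W m v o) = Φ.w v (z m o : K) := fun m v o => exp_log ((Φ.w v).pos (z m o).ne_zero)
  have hk : ∀ m v, ∃ o, ∀ o', W m v o' ≤ W m v o := fun m v => Finite.exists_max _
  choose k hk using hk
  obtain ⟨κ, hκ⟩ : ∃ κ : S → Option (Fin (N + 1)), (M ∩ {m | k m = κ}).Infinite := by
    by_contra h
    simp only [not_exists, Set.not_infinite] at h
    exact hinf ((Set.finite_iUnion h).subset fun m hm => Set.mem_iUnion.2 ⟨k m, hm, rfl⟩)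
  let X : ℤ → ℝ := fun m => ∑ v, W m v (k m v)
  have hWk : ∀ m v, 0 ≤ W m v (k m v) := fun m v => by rw [← hWn m v]; exact hk m v none
  have hWX : ∀ m v o, |W m v o| ≤ X m := fun m v o => by
    have eo := hW0 m o
    have hX : X m = W m v (k m v) + ∑ v ∈ univ.erase v, W m v (k m v) := (add_sum_erase univ (fun v => W m v (k m v)) (mem_univ v)).symm
    rw [← add_sum_erase univ _ (mem_univ v)] at eo
    have hw := sum_nonneg (s := univ.erase v) fun v _ => hWk m v
    have ea := sum_le_sum (s := univ.erase v) fun v _ => hk m v o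
    rw [abs_le]
    constructor <;> linarith [hk m v o, hWk m v]
  have hfin : ∀ B : ℝ, (M ∩ {m | X m ≤ B}).Finite := fun B => by
    refine fin_of_count Φ _ (fun m => (z m (some 0) : K)) ?_ (max 1 (exp B)) (le_max_left _ _) fun m hm => ⟨(hz m _).1, fun v => ?_⟩
    · intro m hm m' hm' h
      have hw : u m 0 * (lam ^ m)⁻¹ = u m' 0 * (lam ^ m')⁻¹ := Units.ext h
      have ea : lam ^ (m - m') = u m 0 * (u m' 0)⁻¹ := by
        rw [zpow_sub, eq_mul_inv_iff_mul_eq, mul_right_comm, mul_inv_eq_iff_eq_mul]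
        rw [mul_inv_eq_iff_eq_mul, mul_right_comm, eq_mul_inv_iff_mul_eq] at hw
        rw [hw]; exact mul_comm _ _
      exact sub_eq_zero.1 (hlin _ (ea ▸ Γ.mul_mem (huΓ m 0) (Γ.inv_mem (huΓ m' 0))))
    · rw [← hWe]
      exact le_max_of_le_right (exp_le_exp.2 ((le_abs_self _).trans ((hWX m v _).trans hm.2)))
  have hinf2 : (M ∩ {m | k m = κ} ∩ {m | 1 ≤ X m}).Infinite := by
    refine (hκ.diff (hfin 1)).mono ?_
    rintro m ⟨⟨hw, ea⟩, ee⟩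
    exact ⟨⟨hw, ea⟩, (le_of_not_ge fun h => ee ⟨hw, h⟩ : (1:ℝ) ≤ X m)⟩
  let e := hinf2.natEmbedding
  let s : ℕ → ℤ := fun j => (e j : ℤ)
  have hs : Injective s := fun i j h => e.injective (Subtype.ext h)
  have hsM : ∀ j, s j ∈ M := fun j => (e j).2.1.1
  have hsk : ∀ j, k (s j) = κ := fun j => (e j).2.1.2
  have hsX : ∀ j, 1 ≤ X (s j) := fun j => (e j).2.2
  have hXt : Filter.Tendsto (fun j => X (s j)) atTop atTop := by
    rw [Filter.tendsto_atTop]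
    intro B
    rw [← Nat.cofinite_eq_atTop, Filter.eventually_cofinite]
    refine Set.Finite.subset ((hfin B).preimage hs.injOn) fun j hj => ⟨hsM j, (not_le.1 hj).le⟩
  let τ : S → Fin (N + 1) → Option (Fin (N + 1)) := fun v i => if κ v = some i then none else some i
  let L : S → Matrix (Fin (N + 1)) (Fin (N + 1)) K := fun v => (κ v).elim 1 fun p => (1 : Matrix _ _ K).updateRow p a
  have hL : ∀ v, (L v).det ≠ 0 := fun v => by
    simp only [L]
    rcases κ v with _ | p
    · simp
    · simp only [Option.elim]
      rw [← Matrix.cramer_transpose_apply, Matrix.transpose_one, Matrix.cramer_one]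
      exact ha p
  have hLy : ∀ j v i, (L v).mulVec (fun i => (z (s j) (some i) : K)) i = z (s j) (τ v i) := fun j v i => by
    simp only [L, τ]
    rcases κ v with _ | p
    · simp
    · simp only [Option.elim, Option.some.injEq]
      by_cases hpi : p = i
      · subst hpi
        rw [if_pos rfl, mulVec, Matrix.updateRow_self]
        have hw := hue (s j) (hsM j)
        simp only [z, Option.elim, val_mul, val_one, dotProduct, ← mul_assoc, ← sum_mul]
        rw [← hw, ← val_mul, mul_inv_cancel, val_one]
      · rw [if_neg hpi, mulVec, Matrix.updateRow_ne (Ne.symm hpi)]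
        exact congrFun (one_mulVec _) i
  obtain ⟨φ, hφ, hinf3⟩ := wst Φ er (by omega) L hL 1 1 zero_le_one zero_lt_one (fun j => X (s j)) hXt (fun j v i => W (s j) v (τ v i) / X (s j))
    (fun j v i => by
      have := hsX j
      rw [abs_div, abs_of_pos (by linarith : 0 < X (s j)), div_le_one (by linarith)]; exact hWX _ _ _)
    (fun j => by
      have := hsX j
      simp only [← sum_div, τ, tau_prod (W (s j) _), sum_sub_distrib]
      rw [sum_comm]
      simp only [hW0, sum_const_zero, zero_sub]
      rw [div_le_iff₀ (by linarith), ← hsk j, neg_one_mul])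
    (fun j i => z (s j) (some i)) (fun j i => (hz _ _).1) (fun j h => (z (s j) (some 0)).ne_zero (congrFun h 0))
    (fun j v i => by
      have := hsX j
      rw [hLy, ← hWe, mul_div_cancel₀ _ (by linarith : (0:ℝ) < X (s j)).ne'])
  obtain ⟨p, hp⟩ := ne_iff.1 hφ
  refine (hinf3.image hs.injOn) ((hred p φ hp).subset ?_)
  rintro _ ⟨j, hj, rfl⟩
  refine ⟨u (s j), huΓ _, hue _ (hsM j), ?_⟩
  have hj : ∑ i, φ i * ((u (s j) i * (lam ^ s j)⁻¹ : Kˣ) : K) = 0 := hj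
  simp only [val_mul, ← mul_assoc, ← sum_mul] at hj
  exact (mul_eq_zero.1 hj).resolve_right (Units.ne_zero _)
end app
end
section
theorem unit_fin {A : Type} [Field A] [CharZero A] [Algebra ℚ A] [Algebra.IsAlgebraic ℚ A] [IsAlgClosed A] (D : Set Aˣ) (hD : D.Finite) (lam : Aˣ)
    (hlin : ∀ m : ℤ, lam ^ m ∈ Subgroup.closure D → m = 0) (N : ℕ) (a : Fin N → A) :
    {m : ℤ | ∃ u : Fin N → Aˣ, (∀ i, u i ∈ Subgroup.closure D) ∧ ((lam ^ m : Aˣ) : A) = ∑ i, a i * u i}.Finite := by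
  classical
  obtain ⟨I, hI⟩ := IsAlgClosed.exists_pow_nat_eq (-1 : A) (n := 2) (by norm_num)
  let ca : Set A := insert I (insert (lam : A) ((fun g : Aˣ => (g : A)) '' D ∪ Set.range a))
  have hT0 : ca.Finite := ((((hD.image _).union (Set.finite_range a)).insert _).insert _)
  let K : IntermediateField ℚ A := IntermediateField.adjoin ℚ ca
  have hmem : ∀ x ∈ ca, x ∈ K := fun x hx => IntermediateField.subset_adjoin ℚ ca hx
  haveI : FiniteDimensional ℚ K := by
    haveI := hT0.to_subtype
    exact IntermediateField.finiteDimensional_adjoin fun x _ => Algebra.IsIntegral.isIntegral x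
  haveI : NumberField K := { to_charZero := inferInstance, to_finiteDimensional := by convert (inferInstance : FiniteDimensional ℚ K); exact Subsingleton.elim _ _ }
  let f : Kˣ →* Aˣ := Units.map (algebraMap K A : K →* A)
  have hfi : Injective f := Units.map_injective (algebraMap K A).injective
  have hf : ∀ g : Kˣ, ((f g : Aˣ) : A) = ((g : K) : A) := fun g => rfl
  have hlift : ∀ g : Aˣ, (g : A) ∈ ca → ∃ g' : Kˣ, f g' = g := fun g hg =>
    ⟨Units.mk0 ⟨g, hmem _ hg⟩ (fun h => g.ne_zero (congrArg Subtype.val h)), Units.ext rfl⟩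
  obtain ⟨l, hl⟩ := hlift lam (by simp [ca])
  have hDl : ∀ g ∈ D, ∃ g' : Kˣ, f g' = g := fun g hg => hlift g (Or.inr (Or.inr (Or.inl ⟨g, hg, rfl⟩)))
  let D' : Set Kˣ := f ⁻¹' D
  have hD' : D'.Finite := hD.preimage hfi.injOn
  have hcl : (Subgroup.closure D').map f = Subgroup.closure D := by
    rw [MonoidHom.map_closure, Set.image_preimage_eq_of_subset]
    exact hDl
  haveI := tc (⟨I, hmem _ (Or.inl rfl)⟩ : K) (Subtype.ext hI)
  obtain ⟨S, _, Φ, ⟨er⟩, hΦ⟩ := ex_place (K := K) ((insert l hD'.toFinset).image fun g : Kˣ => (g : K)) (by simp)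
  have hR : ∀ g ∈ insert l D', g ∈ RU Φ := fun g hg => by
    have := hΦ g (mem_image_of_mem _ (by simpa using hg))
    exact ⟨this.1, by rw [val_inv_eq_inv_val]; exact this.2⟩
  refine (unit_eq Φ er (Subgroup.closure D') l ((Subgroup.closure_le _).2 fun g hg => hR g (Or.inr hg)) (hR l (Or.inl rfl))
    (fun m hm => hlin m ?_) N (fun i => ⟨a i, hmem _ (Or.inr (Or.inr (Or.inr ⟨i, rfl⟩)))⟩)).subset ?_
  · rw [← hcl, ← hl, ← map_zpow]; exact Subgroup.mem_map_of_mem _ hm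
  · rintro m ⟨u, hu, he⟩
    have : ∀ i, ∃ u' : Kˣ, u' ∈ Subgroup.closure D' ∧ f u' = u i := fun i => by
      have := hu i; rwa [← hcl] at this
    choose u' hu' hfu using this
    refine ⟨u', hu', Subtype.ext ?_⟩
    rw [← hl, ← map_zpow, hf] at he
    rw [he]
    push_cast
    exact sum_congr rfl fun i _ => by rw [← hfu]; rfl
theorem expand {A : Type} [Field A] [IsAlgClosed A] {n : ℕ} (g : (Mx n A)ˣ)
    (h : End.IsSemisimple (g : Mx n A).mulVecLin) (y : Fin n → A) :
    ∃ (N : ℕ) (z : Fin N → Fin n → A) (d : Fin N → Aˣ), (∀ i, (g : Mx n A).charpoly.IsRoot (d i : A)) ∧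
      ∀ k : ℤ, ((g ^ k : (Mx n A)ˣ) : Mx n A).mulVec y = ∑ i, ((d i ^ k : Aˣ) : A) • z i := by
  have htop := End.iSup_maxGenEigenspace_eq_top (g : Mx n A).mulVecLin
  have hy : y ∈ ⨆ μ, End.maxGenEigenspace (g : Mx n A).mulVecLin μ := htop ▸ Submodule.mem_top
  induction hy using Submodule.iSup_induction' with
  | mem μ x hx =>
    rw [h.isFinitelySemisimple.maxGenEigenspace_eq_eigenspace, End.mem_eigenspace_iff] at hx
    by_cases hx0 : x = 0
    · exact ⟨0, Fin.elim0, Fin.elim0, fun i => i.elim0, fun k => by simp [hx0]⟩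
    rw [Matrix.mulVecLin_apply] at hx
    have hμ : μ ≠ 0 := by
      rintro rfl
      apply hx0
      have := congrArg (((g⁻¹ : (Mx n A)ˣ) : Mx n A).mulVec) hx
      rwa [mulVec_mulVec, ← val_mul, inv_mul_cancel, val_one, one_mulVec, zero_smul, mulVec_zero] at this
    have hx' : ((g⁻¹ : (Mx n A)ˣ) : Mx n A).mulVec x = μ⁻¹ • x := by
      have := congrArg (fun w => μ⁻¹ • ((g⁻¹ : (Mx n A)ˣ) : Mx n A).mulVec w) hx
      simp only [mulVec_mulVec, ← val_mul, inv_mul_cancel, val_one, one_mulVec, mulVec_smul, smul_smul, inv_mul_cancel₀ hμ, one_smul] at this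
      exact this.symm
    refine ⟨1, fun _ => x, fun _ => Units.mk0 μ hμ, fun _ => ?_, fun k => ?_⟩
    · rw [val_mk0, ← Matrix.charpoly_mulVecLin, ← End.hasEigenvalue_iff_isRoot_charpoly]
      exact End.hasEigenvalue_of_hasEigenvector ⟨End.mem_eigenspace_iff.2 hx, hx0⟩
    · rw [Fin.sum_univ_one]
      induction k with
      | zero => simp
      | succ i ih => rw [zpow_add_one, zpow_add_one, val_mul, ← mulVec_mulVec, hx, mulVec_smul, ih, smul_smul, val_mul, mul_comm, val_mk0]
      | pred i ih => rw [zpow_sub_one, zpow_sub_one, val_mul, ← mulVec_mulVec, hx', mulVec_smul, ih, smul_smul, val_mul, mul_comm, val_inv_eq_inv_val, val_mk0]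
  | zero => exact ⟨0, Fin.elim0, Fin.elim0, fun i => i.elim0, fun k => by simp⟩
  | add x y hx hy hx' hy' =>
    obtain ⟨N, z, d, hw, ea⟩ := hx'
    obtain ⟨N', z', d', h1', h2'⟩ := hy'
    refine ⟨N + N', Fin.append z z', Fin.append d d', fun i => ?_, fun k => ?_⟩
    · refine Fin.addCases (fun i => ?_) (fun i => ?_) i
      · rw [Fin.append_left]; exact hw i
      · rw [Fin.append_right]; exact h1' i
    · rw [Matrix.mulVec_add, ea, h2', Fin.sum_univ_add]
      simp only [Fin.append_left, Fin.append_right]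
theorem expand_prod {A : Type} [Field A] [IsAlgClosed A] {n : ℕ} (Γ : Subgroup Aˣ) (x : Fin n → A) : ∀ (r : ℕ) (g : Fin r → (Mx n A)ˣ)
    (h : ∀ i, End.IsSemisimple (g i : Mx n A).mulVecLin)
    (hΓ : ∀ i, ∀ u : Aˣ, (g i : Mx n A).charpoly.IsRoot (u : A) → u ∈ Γ),
    ∃ (ι : Type) (_ : Fintype ι) (z : ι → Fin n → A), ∀ k : Fin r → ℤ, ∃ u : ι → Aˣ, (∀ i, u i ∈ Γ) ∧
      (((List.ofFn fun i => g i ^ k i).prod : (Mx n A)ˣ) : Mx n A).mulVec x = ∑ i, (u i : A) • z i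
  | 0, g, h, hΓ => ⟨Unit, inferInstance, fun _ => x, fun k => ⟨fun _ => 1, fun _ => Γ.one_mem, by simp⟩⟩
  | r + 1, g, h, hΓ => by
    obtain ⟨ι, _, z, hz⟩ := expand_prod Γ x r (fun i => g i.succ) (fun i => h _) (fun i => hΓ _)
    choose N y d hd hy using fun i => expand (g 0) (h 0) (z i)
    refine ⟨Σ i, Fin (N i), inferInstance, fun p => y p.1 p.2, fun k => ?_⟩
    obtain ⟨u, hu, he⟩ := hz fun i => k i.succ
    refine ⟨fun p => u p.1 * d p.1 p.2 ^ k 0, fun p => Γ.mul_mem (hu _) (Γ.zpow_mem (hΓ 0 _ (hd _ _)) _), ?_⟩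
    rw [List.ofFn_succ, List.prod_cons, val_mul, ← mulVec_mulVec, he, Matrix.mulVec_sum, Fintype.sum_sigma]
    refine sum_congr rfl fun i _ => ?_
    rw [mulVec_smul, hy, smul_sum]
    simp only [val_mul, smul_smul]
end
end
end SubTh

open Matrix

/-- Case of all the `γ_i` semi-simple: if `γ` is semi-simple with an eigenvalue `λ` that is
not a root of unity and `⟨λ⟩ ∩ Λ(γ₁)⋯Λ(γ_r) = {1}`, then the set
`J = {m : γ^m ∈ ⟨γ₁⟩⋯⟨γ_r⟩}` is finite. -/
theorem stmt_10 {n : ℕ} (hn : 1 ≤ n) (r : ℕ)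
    (γs : Fin r → GL (Fin n) (AlgebraicClosure ℚ))
    (hss : ∀ i, IsSemisimpleElt (γs i))
    (γ : GL (Fin n) (AlgebraicClosure ℚ)) (hγ : IsSemisimpleElt γ)
    (lam : (AlgebraicClosure ℚ)ˣ)
    (heig : ((γ : Matrix (Fin n) (Fin n) (AlgebraicClosure ℚ)).charpoly).IsRoot
      (lam : AlgebraicClosure ℚ))
    (hru : ∀ k : ℤ, k ≠ 0 → lam ^ k ≠ 1)
    (hint : ∀ x : (AlgebraicClosure ℚ)ˣ, x ∈ Subgroup.zpowers lam →
      (∃ v : Fin r → (AlgebraicClosure ℚ)ˣ,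
        (∀ i, v i ∈ eigGroup (γs i)) ∧ x = ∏ i, v i) → x = 1) :
    Set.Finite {m : ℤ | ∃ k : Fin r → ℤ, γ ^ m = (List.ofFn fun i => γs i ^ k i).prod} := by
  classical
  let D : Set (AlgebraicClosure ℚ)ˣ := {u | ∃ i, ((γs i : Matrix (Fin n) (Fin n) (AlgebraicClosure ℚ)).charpoly).IsRoot (u : AlgebraicClosure ℚ)}
  have hD : D.Finite := by
    have h1 : D = ⋃ i, Units.val ⁻¹' {x | ((γs i : Matrix (Fin n) (Fin n) (AlgebraicClosure ℚ)).charpoly).IsRoot x} := by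
      ext u; simp [D]
    rw [h1]
    exact Set.finite_iUnion fun i => (Polynomial.finite_setOfPred_isRoot (Matrix.charpoly_monic _).ne_zero).preimage Units.val_injective.injOn
  have hcl : ∀ x ∈ Subgroup.closure D, ∃ v : Fin r → (AlgebraicClosure ℚ)ˣ, (∀ i, v i ∈ eigGroup (γs i)) ∧ x = ∏ i, v i := by
    intro x hx
    induction hx using Subgroup.closure_induction with
    | mem x hx =>
      obtain ⟨i, hi⟩ := hx
      refine ⟨Pi.mulSingle i x, fun j => ?_, (Finset.prod_pi_mulSingle' i x Finset.univ |>.trans (if_pos (Finset.mem_univ i))).symm⟩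
      by_cases h : j = i
      · subst h; rw [Pi.mulSingle_eq_same]; exact Subgroup.subset_closure hi
      · rw [Pi.mulSingle_eq_of_ne h]; exact Subgroup.one_mem _
    | one => exact ⟨1, fun i => Subgroup.one_mem _, by simp⟩
    | mul x y _ _ hx hy =>
      obtain ⟨v, hv, rfl⟩ := hx
      obtain ⟨w, hw, rfl⟩ := hy
      exact ⟨fun i => v i * w i, fun i => Subgroup.mul_mem _ (hv i) (hw i), Finset.prod_mul_distrib.symm⟩
    | inv x _ hx =>
      obtain ⟨v, hv, rfl⟩ := hx
      exact ⟨fun i => (v i)⁻¹, fun i => Subgroup.inv_mem _ (hv i), (Finset.prod_inv_distrib _).symm⟩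
  have hlin : ∀ m : ℤ, lam ^ m ∈ Subgroup.closure D → m = 0 := fun m hm => by
    by_contra h
    exact hru m h (hint _ ⟨m, rfl⟩ (hcl _ hm))
  rw [← Matrix.charpoly_mulVecLin, ← Module.End.hasEigenvalue_iff_isRoot_charpoly] at heig
  obtain ⟨x, hx, hx0⟩ := heig.exists_hasEigenvector
  rw [Module.End.mem_eigenspace_iff, Matrix.mulVecLin_apply] at hx
  have hx' : ((γ⁻¹ : GL (Fin n) (AlgebraicClosure ℚ)) : Matrix (Fin n) (Fin n) (AlgebraicClosure ℚ)).mulVec x = ((lam⁻¹ : (AlgebraicClosure ℚ)ˣ) : AlgebraicClosure ℚ) • x := by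
    have := congrArg (fun w => ((lam⁻¹ : (AlgebraicClosure ℚ)ˣ) : AlgebraicClosure ℚ) • ((γ⁻¹ : GL (Fin n) (AlgebraicClosure ℚ)) : Matrix (Fin n) (Fin n) (AlgebraicClosure ℚ)).mulVec w) hx
    simp only [Matrix.mulVec_mulVec, ← Units.val_mul, inv_mul_cancel, Units.val_one, Matrix.one_mulVec, Matrix.mulVec_smul, smul_smul, one_smul] at this
    exact this.symm
  have hpow : ∀ m : ℤ, ((γ ^ m : GL (Fin n) (AlgebraicClosure ℚ)) : Matrix (Fin n) (Fin n) (AlgebraicClosure ℚ)).mulVec x = ((lam ^ m : (AlgebraicClosure ℚ)ˣ) : AlgebraicClosure ℚ) • x := by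
    intro k
    induction k with
    | zero => simp
    | succ i ih => rw [_root_.zpow_add_one, _root_.zpow_add_one, Units.val_mul, ← Matrix.mulVec_mulVec, hx, Matrix.mulVec_smul, ih, smul_smul, Units.val_mul, mul_comm]
    | pred i ih => rw [_root_.zpow_sub_one, _root_.zpow_sub_one, Units.val_mul, ← Matrix.mulVec_mulVec, hx', Matrix.mulVec_smul, ih, smul_smul, Units.val_mul, mul_comm]
  obtain ⟨c, hc⟩ := Function.ne_iff.1 hx0
  obtain ⟨ι, _, z, hz⟩ := SubTh.expand_prod (Subgroup.closure D) x r γs hss (fun i u hu => Subgroup.subset_closure ⟨i, hu⟩)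
  let e := Fintype.equivFin ι
  have : Algebra.IsAlgebraic ℚ (AlgebraicClosure ℚ) := by
    rw [Subsingleton.elim (DivisionRing.toRatAlgebra : Algebra ℚ (AlgebraicClosure ℚ)) (AlgebraicClosure.instAlgebra ℚ)]
    exact AlgebraicClosure.isAlgebraic ℚ
  refine (SubTh.unit_fin D hD lam hlin (Fintype.card ι) (fun i => z (e.symm i) c / x c)).subset ?_
  rintro m ⟨k, hk⟩
  obtain ⟨u, hu, he⟩ := hz k
  rw [← hk, hpow] at he
  refine ⟨fun i => u (e.symm i), fun i => hu _, ?_⟩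
  have h1 := congrFun he c
  rw [Pi.smul_apply, smul_eq_mul, Finset.sum_apply] at h1
  rw [e.symm.sum_comp (fun i => z i c / x c * (u i : AlgebraicClosure ℚ))]
  refine mul_right_cancel₀ (b := x c) hc (h1.trans ?_)
  rw [Finset.sum_mul]
  refine Finset.sum_congr rfl fun i _ => ?_
  rw [Pi.smul_apply, smul_eq_mul, mul_right_comm, div_mul_cancel₀ _ hc, mul_comm]
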